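/- Zagier's conjecture in positive characteristic: for every N ∈ ℕ and every w ∈ ℕ, the dimension of CZ_{N,w} as a K_N-vector space equals d_N(w). -/

import Mathlib

noncomputable section

open scoped Classical

namespace ZHPC

variable (Fq : Type) [Field Fq] [Fintype Fq]

/-- `q`, the cardinality of the base finite field `𝔽_q`. -/
def qc : ℕ := Fintype.card Fq

/-- A fixed algebraic closure `𝔽̄_q` of `𝔽_q`. -/
abbrev Fb := AlgebraicClosure Fq

/-- The field `𝔽̄_q((1/θ))` of formal Laurent series in `1/θ` over `𝔽̄_q`, modeled as the
field of formal Laurent series in one variable, `θ` being the inverse of that variable. -/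
abbrev Kinf := LaurentSeries (Fb Fq)

/-- The embedding of the constants `𝔽̄_q → 𝔽̄_q((1/θ))`. -/
def cst : Fb Fq →+* Kinf Fq := HahnSeries.C

/-- The element `θ`. -/
def theta : Kinf Fq := HahnSeries.single (-1 : ℤ) 1

/-- `ℓ_d = ∏_{i=1}^{d} (θ - θ^{q^i})`, with `ℓ_0 = 1`. -/
def ell (d : ℕ) : Kinf Fq := ∏ i ∈ Finset.Icc 1 d, (theta Fq - theta Fq ^ qc Fq ^ i)

/-- Arrays `(𝛆;𝔰)` of some depth `n`. -/
structure PArr (F : Type) where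
  depth : ℕ
  s : Fin depth → ℕ
  eps : Fin depth → F

namespace PArr

variable {F : Type}

/-- A *positive array* for level `N`: all entries `sᵢ` are positive integers and all the
characters `εᵢ` are `N`-th roots of unity. -/
def Positive [Monoid F] (N : ℕ) (A : PArr F) : Prop := (∀ i, 0 < A.s i) ∧ ∀ i, A.eps i ^ N = 1

/-- The weight `w(𝔰) = s₁ + ⋯ + s_n`. -/
def wt (A : PArr F) : ℕ := ∑ i, A.s i

/-- The `i`-th entry of `𝔰` (`0`-indexed), with value `0` beyond the depth. -/
def sAt (A : PArr F) (i : ℕ) : ℕ := if h : i < A.depth then A.s ⟨i, h⟩ else 0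

/-- The partial sums `s₁ + ⋯ + s_i` (entries beyond the depth being `0`). -/
def psum (A : PArr F) (i : ℕ) : ℕ := ∑ j ∈ Finset.range i, A.sAt j

/-- The character `χ(𝛆) = ε₁ ⋯ ε_n`. -/
def chi [CommMonoid F] (A : PArr F) : F := ∏ i, A.eps i

end PArr

/-- The Carlitz multiple polylogarithm at roots of unity
`Li(𝛆;𝔰) = Σ_{d₁ > ⋯ > d_n ≥ 0} ε₁^{d₁}⋯ε_n^{d_n} / (ℓ_{d₁}^{s₁}⋯ℓ_{d_n}^{s_n})`. -/
def Li (A : PArr (Fb Fq)) : Kinf Fq :=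
  ∑' d : {f : Fin A.depth → ℕ // StrictAnti f},
    ∏ i, cst Fq (A.eps i ^ d.1 i) / ell Fq (d.1 i) ^ A.s i

/-- `Si_d(𝛆;𝔰)`: same summand as `Li`, over decreasing tuples with `d₁ = d`. -/
def Sid (d : ℤ) (A : PArr (Fb Fq)) : Kinf Fq :=
  ∑' f : {f : Fin A.depth → ℕ // StrictAnti f ∧ ∀ i : Fin A.depth, i.val = 0 → (f i : ℤ) = d},
    ∏ i, cst Fq (A.eps i ^ f.1 i) / ell Fq (f.1 i) ^ A.s i

/-- `Si_{<d}(𝛆;𝔰)`: same summand as `Li`, over decreasing tuples with `d > d₁`. -/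
def SidLt (d : ℤ) (A : PArr (Fb Fq)) : Kinf Fq :=
  ∑' f : {f : Fin A.depth → ℕ // StrictAnti f ∧ ∀ i : Fin A.depth, (f i : ℤ) < d},
    ∏ i, cst Fq (A.eps i ^ f.1 i) / ell Fq (f.1 i) ^ A.s i

/-- The value at `θ` of the monic polynomial `θ^e + Σ_{j<e} c_j θ^j ∈ A = 𝔽_q[θ]`. -/
def monicVal (e : ℕ) (c : Fin e → Fq) : Kinf Fq :=
  theta Fq ^ e + ∑ j, cst Fq (algebraMap Fq (Fb Fq) (c j)) * theta Fq ^ (j : ℕ)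

/-- The power sum `S_d(𝛆;𝔰)`, a sum over tuples of monic polynomials `a₁, …, a_n ∈ A₊`
with `d = deg a₁ > ⋯ > deg a_n ≥ 0`; a monic polynomial of degree `e` is encoded by its
tuple of lower coefficients `c : Fin e → Fq`. -/
def Sd (d : ℤ) (A : PArr (Fb Fq)) : Kinf Fq :=
  ∑' e : {f : Fin A.depth → ℕ // StrictAnti f ∧ ∀ i : Fin A.depth, i.val = 0 → (f i : ℤ) = d},
    ∑ c : (∀ i, Fin (e.1 i) → Fq),
      ∏ i, cst Fq (A.eps i ^ e.1 i) / monicVal Fq (e.1 i) (c i) ^ A.s i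

/-- The `N`-th cyclotomic multiple zeta value `ζ_A(𝛆;𝔰) = Σ_{d ≥ 0} S_d(𝛆;𝔰)`. -/
def zetaA (A : PArr (Fb Fq)) : Kinf Fq := ∑' d : ℕ, Sd Fq (d : ℤ) A

/-- The cyclotomic field `k_N = 𝔽_q(ζ_N) ⊆ 𝔽̄_q`. -/
def kN (N : ℕ) : Subfield (Fb Fq) :=
  Subfield.closure (Set.range (algebraMap Fq (Fb Fq)) ∪ {x | x ^ N = 1})

/-- The field `K_N = k_N(θ)`, as a subfield of `𝔽̄_q((1/θ))`. -/
def KNf (N : ℕ) : Subfield (Kinf Fq) :=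
  Subfield.closure ((cst Fq '' (kN Fq N : Set (Fb Fq))) ∪ {theta Fq})

/-- The ring `A_N = k_N[θ]`, as a subring of `𝔽̄_q((1/θ))`. -/
def AN (N : ℕ) : Subring (Kinf Fq) :=
  Subring.closure ((cst Fq '' (kN Fq N : Set (Fb Fq))) ∪ {theta Fq})

/-- `CZ_{N,w}`: the `K_N`-span of the `N`-th cyclotomic multiple zeta values of weight `w`. -/
def CZ (N w : ℕ) : Submodule (KNf Fq N) (Kinf Fq) :=
  Submodule.span (KNf Fq N) {x | ∃ A : PArr (Fb Fq), A.Positive N ∧ A.wt = w ∧ x = zetaA Fq A}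

/-- `CL_{N,w}`: the `K_N`-span of the CMPL's at `N`-th roots of unity of weight `w`. -/
def CL (N w : ℕ) : Submodule (KNf Fq N) (Kinf Fq) :=
  Submodule.span (KNf Fq N) {x | ∃ A : PArr (Fb Fq), A.Positive N ∧ A.wt = w ∧ x = Li Fq A}

/-- The index set of pairs `(𝔰,𝛆)` with `𝔰 ∈ S_w` and `𝛆 ∈ Γ_N^{depth 𝔰}`: positive arrays
of weight `w` with `q ∤ sᵢ` for all `i`. -/
def SwIdx (N w : ℕ) : Type :=
  {A : PArr (Fb Fq) // A.Positive N ∧ 0 < A.depth ∧ A.wt = w ∧ ∀ i, ¬ qc Fq ∣ A.s i}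

/-- `γ_N = |Γ_N|`, the number of `N`-th roots of unity in `𝔽̄_q`. -/
def gammaN (N : ℕ) : ℕ := Nat.card {x : Fb Fq // x ^ N = 1}

/-- The sequence `d_N(w)` (depending on `γ = γ_N` and `Q = q`): `d_N(0) = 1`,
`d_N(w) = γ(γ+1)^{w-1}` for `1 ≤ w < q`, `d_N(q) = γ((γ+1)^{q-1} - 1)`, and
`d_N(w) = γ·Σ_{i=1}^{q-1} d_N(w-i) + d_N(w-q)` for `w > q`. -/
def dN (γ Q : ℕ) : ℕ → ℕ
  | 0 => 1
  | (w + 1) =>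
    if w + 1 < Q then γ * (γ + 1) ^ w
    else if w + 1 = Q then γ * ((γ + 1) ^ (Q - 1) - 1)
    else γ * (∑ j ∈ Finset.range (Q - 1), dN γ Q (w - j)) + dN γ Q (w - (Q - 1))
  termination_by w => w
  decreasing_by all_goals omega

/-- weight of a word -/
def lwt {K : Type*} (l : List (ℕ × K)) : ℕ := (l.map Prod.fst).sum

/-- children of `B` in `I` -/
def chd {K : Type*} (I : Finset (List (ℕ × K))) (B : List (ℕ × K)) : Finset (List (ℕ × K)) :=
  I.filter fun C => C ≠ [] ∧ C.dropLast = B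

lemma mem_chd {K : Type*} {I : Finset (List (ℕ × K))} {B C : List (ℕ × K)} :
    C ∈ chd I B ↔ C ∈ I ∧ ∃ a, C = B ++ [a] := by
  simp only [chd, Finset.mem_filter]
  refine and_congr_right fun _ => ⟨fun ⟨h1, h2⟩ => ⟨C.getLast h1, ?_⟩, ?_⟩
  · rw [← h2, List.dropLast_append_getLast]
  · rintro ⟨a, rfl⟩; simp

lemma sum_chd {K M : Type*} [AddCommMonoid M] (I : Finset (List (ℕ × K)))
    (hI : ∀ B a, B ++ [a] ∈ I → B ∈ I) (f : List (ℕ × K) → List (ℕ × K) → M)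
    (hf : ∀ B, f [] B = 0) :
    ∑ B ∈ I, f B B.dropLast = ∑ B ∈ I, ∑ C ∈ chd I B, f C B := by
  have h1 : ∑ B ∈ I, f B B.dropLast = ∑ B ∈ I.filter (· ≠ []), f B B.dropLast := by
    rw [Finset.sum_filter]
    refine Finset.sum_congr rfl fun B _ => ?_
    by_cases h : B = [] <;> simp [h, hf]
  rw [h1, ← Finset.sum_fiberwise_of_maps_to (g := List.dropLast) (t := I)]
  · refine Finset.sum_congr rfl fun B _ => ?_
    rw [Finset.filter_filter]
    refine Finset.sum_congr rfl fun C hC => ?_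
    rw [(Finset.mem_filter.1 hC).2.2]
  · intro B hB
    rw [Finset.mem_filter] at hB
    apply hI _ (B.getLast hB.2)
    rw [List.dropLast_append_getLast]; exact hB.1

lemma lwt_append {K : Type*} (l m : List (ℕ × K)) : lwt (l ++ m) = lwt l + lwt m := by
  simp [lwt]

lemma lwt_single {K : Type*} (a : ℕ × K) : lwt [a] = a.1 := by simp [lwt]
lemma lwt_cons {K : Type*} (a : ℕ × K) (l) : lwt (a :: l) = a.1 + lwt l := by simp [lwt]
lemma lwt_nil {K : Type*} : lwt ([] : List (ℕ × K)) = 0 := by simp [lwt]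

/-- the combinatorial core of the functional independence -/
lemma func_comb {K E : Type*} [Field K] (q : ℕ) (hq : 2 ≤ q)
    (ch : List (ℕ × E) → K) (hch : ∀ B, ch B ≠ 0)
    (hinj : ∀ B a b, a.1 = b.1 → ch (B ++ [a]) = ch (B ++ [b]) → a = b)
    (I : Finset (List (ℕ × E)))
    (hg : ∀ B a, B ++ [a] ∈ I → 0 < a.1 ∧ ¬ q ∣ a.1)
    (r c : List (ℕ × E) → Polynomial K) (hr : ∀ B, B ∉ I → r B = 0)
    (hc : ∀ B j, (c B).coeff j = (r B).coeff j + ∑ C ∈ chd I B, (r C).coeff j)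
    (e : ℕ) (κ : K) (hκ : κ ≠ 0)
    (ha : ∀ B j, (c B).coeff j ≠ 0 →
      ∃ i, q * i + e = q * lwt B + j ∧ κ * (r B).coeff i = ch B * (c B).coeff j)
    (hb : ∀ B i, (r B).coeff i ≠ 0 →
      ∃ j, q * i + e = q * lwt B + j ∧ κ * (r B).coeff i = ch B * (c B).coeff j) :
    ∀ B i, (r B).coeff i ≠ 0 → B = [] ∧ i = 0 := by
  -- Step 1
  have hlen : ∃ n, ∀ B ∈ I, B.length ≤ n := ⟨I.sup List.length, fun B hB => Finset.le_sup hB⟩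
  obtain ⟨n, hn⟩ := hlen
  have s1 : ∀ m B j, n + 1 ≤ B.length + m → (r B).coeff j ≠ 0 → ∃ a b : ℕ, q * a + e = q * b + j := by
    intro m
    induction m with
    | zero =>
      intro B j hB h
      have : B ∉ I := fun h' => by have := hn B h'; omega
      rw [hr B this] at h; simp at h
    | succ m ih =>
      intro B j hB h
      by_cases hch : ∃ C ∈ chd I B, (r C).coeff j ≠ 0
      · obtain ⟨C, hC, h2⟩ := hch
        obtain ⟨_, a, rfl⟩ := mem_chd.1 hC
        exact ih _ _ (by simp; omega) h2
      · push Not at hch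
        have : (c B).coeff j ≠ 0 := by
          rw [hc, Finset.sum_eq_zero hch, add_zero]; exact h
        obtain ⟨i, hi, _⟩ := ha B j this
        exact ⟨_, _, hi⟩
  have s1' : ∀ B j, (r B).coeff j ≠ 0 → ∃ a b : ℕ, q * a + e = q * b + j :=
    fun B j h => s1 (n + 1) B j (by omega) h
  have hsplit : ∀ B j, (c B).coeff j ≠ 0 →
      (r B).coeff j ≠ 0 ∨ ∃ a, B ++ [a] ∈ I ∧ (r (B ++ [a])).coeff j ≠ 0 := by
    intro B j h
    by_contra h'
    push Not at h'
    apply h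
    rw [hc, h'.1, zero_add]
    refine Finset.sum_eq_zero fun C hC => ?_
    obtain ⟨hC, a, rfl⟩ := mem_chd.1 hC
    exact h'.2 a hC
  have hcn : ∀ B i j, κ * (r B).coeff i = ch B * (c B).coeff j →
      ((r B).coeff i ≠ 0 ↔ (c B).coeff j ≠ 0) := by
    intro B i j h
    constructor
    · intro h1 h2
      rw [h2, mul_zero] at h
      exact (mul_ne_zero hκ h1) h
    · intro h1 h2
      rw [h2, mul_zero] at h
      exact (mul_ne_zero (hch B) h1) h.symm
  -- Step 2
  have s2 : ∀ i B, (r B).coeff i ≠ 0 → q * lwt B + i ≤ q * i + e := by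
    intro i
    induction i using Nat.strong_induction_on with
    | _ i ih =>
      intro B h
      by_contra hlt
      push Not at hlt
      obtain ⟨j, hj, h2⟩ := hb B i h
      have hji : j < i := by omega
      have hjq : q * j + e < q * lwt B + j := by
        have : (q - 1) * j ≤ (q - 1) * i := Nat.mul_le_mul_left _ hji.le
        obtain ⟨q', rfl⟩ : ∃ q', q = q' + 1 := ⟨q - 1, by omega⟩
        simp only [Nat.add_sub_cancel] at this
        nlinarith
      rcases hsplit B j ((hcn B i j h2).1 h) with h3 | ⟨a, hI', h3⟩
      · have := ih j hji B h3
        omega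
      · have := ih j hji _ h3
        rw [lwt_append, mul_add] at this
        have : q * j + e < q * lwt B + j := hjq
        omega
  -- Step 3
  intro B0 i0 h0
  have hmax : ∃ m, (∃ B, (r B).coeff m ≠ 0) ∧ ∀ B i, (r B).coeff i ≠ 0 → i ≤ m := by
    have hbd : ∀ m, (∃ B, (r B).coeff m ≠ 0) → m ≤ I.sup fun B => (r B).natDegree := by
      rintro m ⟨B, hB⟩
      have hBI : B ∈ I := by
        by_contra h; rw [hr B h] at hB; simp at hB
      exact (Polynomial.le_natDegree_of_ne_zero hB).trans
        (Finset.le_sup (f := fun B => (r B).natDegree) hBI)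
    refine ⟨Nat.findGreatest (fun m => ∃ B, (r B).coeff m ≠ 0) (I.sup fun B => (r B).natDegree), ?_, ?_⟩
    · exact Nat.findGreatest_spec (P := fun m => ∃ B, (r B).coeff m ≠ 0) (hbd i0 ⟨B0, h0⟩) ⟨B0, h0⟩
    · intro B i h
      exact Nat.le_findGreatest (hbd i ⟨B, h⟩) ⟨B, h⟩
  obtain ⟨m, ⟨B1, hB1⟩, hm⟩ := hmax
  have s3 : ∀ B, (r B).coeff m ≠ 0 → q * m + e = q * lwt B + m ∧ κ = ch B := by
    intro B h
    obtain ⟨j, hj, h2⟩ := hb B m h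
    have h3 := s2 m B h
    have hjm : j = m := by
      refine le_antisymm ?_ (by omega)
      rcases hsplit B j ((hcn B m j h2).1 h) with h4 | ⟨a, _, h4⟩
      · exact hm _ _ h4
      · exact hm _ _ h4
    subst hjm
    refine ⟨hj, ?_⟩
    have : (c B).coeff j = (r B).coeff j := by
      rw [hc, Finset.sum_eq_zero, add_zero]
      intro C hC
      obtain ⟨hC, a, rfl⟩ := mem_chd.1 hC
      by_contra h5
      have := s2 j _ h5
      rw [lwt_append, lwt_single, mul_add] at this
      have := (hg _ _ hC).1
      have : 0 < q * a.1 := by positivity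
      omega
    rw [this] at h2
    exact mul_right_cancel₀ h h2
  have s4 : ∀ B, (r B).coeff m ≠ 0 → B = [] := by
    intro B h
    rcases List.eq_nil_or_concat' B with rfl | ⟨D, a, rfl⟩
    · rfl
    exfalso
    obtain ⟨h1, h2⟩ := s3 _ h
    have hDI : D ++ [a] ∈ I := by
      by_contra h'; rw [hr _ h'] at h; simp at h
    have hrD : (r D).coeff m = 0 := by
      by_contra h3
      obtain ⟨h4, _⟩ := s3 _ h3
      rw [lwt_append, lwt_single, mul_add] at h1
      have := (hg _ _ hDI).1
      have : 0 < q * a.1 := by positivity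
      omega
    have hcD : (c D).coeff m = (r (D ++ [a])).coeff m := by
      rw [hc, hrD, zero_add, Finset.sum_eq_single (D ++ [a])]
      · intro C hC hne
        obtain ⟨hC, b, rfl⟩ := mem_chd.1 hC
        by_contra h3
        obtain ⟨h4, h5⟩ := s3 _ h3
        apply hne
        congr 2
        apply hinj D b a
        · rw [lwt_append, lwt_single, mul_add] at h1 h4
          have : q * b.1 = q * a.1 := by omega
          exact Nat.eq_of_mul_eq_mul_left (by omega) this
        · rw [← h5, ← h2]
      · intro h3
        exact absurd (mem_chd.2 ⟨hDI, a, rfl⟩) h3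
    have hcD' : (c D).coeff m ≠ 0 := hcD ▸ h
    obtain ⟨i, hi, h3⟩ := ha D m hcD'
    have h4 := (hcn _ _ _ h3).2 hcD'
    obtain ⟨x, y, hxy⟩ := s1' _ _ h4
    obtain ⟨x', y', hxy'⟩ := s1' _ _ h
    apply (hg _ _ hDI).2
    rw [lwt_append, lwt_single, mul_add] at h1
    have h5 : m = i + a.1 := by
      have : q * m = q * (i + a.1) := by rw [mul_add]; omega
      exact Nat.eq_of_mul_eq_mul_left (by omega) this
    zify at hxy hxy' h5 ⊢
    refine ⟨x' - y' - (x - y), ?_⟩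
    linear_combination -h5 - hxy' + hxy
  have hB1' := s4 B1 hB1
  obtain ⟨h1, _⟩ := s3 B1 hB1
  have hm0 : m = 0 := by
    rw [hB1', lwt_nil] at h1
    nlinarith
  have : i0 = m := by have := hm _ _ h0; omega
  rw [this] at h0
  exact ⟨s4 _ h0, by omega⟩

/-- Cartier operator on polynomials -/
def cart {K : Type*} [Field K] (q i : ℕ) (p : Polynomial K) : Polynomial K :=
  ∑ n ∈ Finset.range (p.natDegree + 1), Polynomial.monomial n (p.coeff (q * n + i))

lemma coeff_cart {K : Type*} [Field K] {q : ℕ} (hq : 2 ≤ q) (i n : ℕ) (p : Polynomial K) :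
    (cart q i p).coeff n = p.coeff (q * n + i) := by
  simp only [cart, Polynomial.finsetSum_coeff, Polynomial.coeff_monomial]
  rw [Finset.sum_ite_eq']
  split_ifs with h
  · rfl
  · rw [Polynomial.coeff_eq_zero_of_natDegree_lt]
    simp only [Finset.mem_range, not_lt] at h
    nlinarith

lemma coeff_cartsum {K : Type*} [Field K] {q : ℕ} (hq : q ≠ 0) (G : ℕ → PowerSeries K)
    (n j : ℕ) (hj : j < q) :
    PowerSeries.coeff (q * n + j) (∑ i ∈ Finset.range q, PowerSeries.X ^ i * PowerSeries.expand q hq (G i))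
      = PowerSeries.coeff n (G j) := by
  rw [map_sum, Finset.sum_eq_single j]
  · rw [PowerSeries.coeff_X_pow_mul, mul_comm, PowerSeries.coeff_expand,
      if_pos (Dvd.intro_left n rfl), Nat.mul_div_cancel _ (by omega)]
  · intro i hi hij
    rw [Finset.mem_range] at hi
    rw [PowerSeries.coeff_X_pow_mul']
    split_ifs with h
    · rw [PowerSeries.coeff_expand, if_neg]
      rintro ⟨m, hm⟩
      have : q * n + j = q * m + i := by omega
      have h2 := congrArg (· % q) this
      simp only [Nat.mul_add_mod, Nat.mod_eq_of_lt hj, Nat.mod_eq_of_lt hi] at h2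
      exact hij h2.symm
    · rfl
  · simp [hj]

lemma cart_decomp {K : Type*} [Field K] {q : ℕ} (hq : 2 ≤ q) (p : Polynomial K) :
    (p : PowerSeries K) = ∑ i ∈ Finset.range q, PowerSeries.X ^ i *
      PowerSeries.expand q (by omega) (cart q i p : PowerSeries K) := by
  ext m
  conv_rhs => rw [← Nat.div_add_mod m q]
  rw [coeff_cartsum (by omega) (fun i => (cart q i p : PowerSeries K)) _ _ (Nat.mod_lt _ (by omega))]
  simp [coeff_cart hq, Nat.div_add_mod]

lemma monomial_of_expand {K : Type*} [Field K] {q : ℕ} (hq : 2 ≤ q) (r μ : Polynomial K) (hr : r ≠ 0)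
    (c : K) (hc : c ≠ 0) (w : ℕ)
    (h : Polynomial.C c * Polynomial.X ^ w * r = μ * Polynomial.expand K q r) :
    ∃ κ e, κ ≠ 0 ∧ μ = Polynomial.monomial e κ := by
  have hE : Polynomial.expand K q r ≠ 0 := by
    rwa [Ne, Polynomial.expand_eq_zero (by omega)]
  have hμ : μ ≠ 0 := by
    rintro rfl
    rw [zero_mul] at h
    simp [hc, hr] at h
  have ht : (Polynomial.expand K q r).natTrailingDegree ≤ r.natTrailingDegree * q := by
    apply Polynomial.natTrailingDegree_le_of_ne_zero
    rw [Polynomial.coeff_expand_mul (by omega)]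
    simpa using hr
  have ht' : r.natTrailingDegree * q ≤ (Polynomial.expand K q r).natTrailingDegree := by
    apply Polynomial.le_natTrailingDegree hE
    intro m hm
    rw [Polynomial.coeff_expand (by omega)]
    split_ifs with h1
    · apply Polynomial.coeff_eq_zero_of_lt_natTrailingDegree
      exact Nat.div_lt_of_lt_mul (by rwa [mul_comm])
    · rfl
  have h1 := congrArg Polynomial.natDegree h
  have h2 := congrArg Polynomial.natTrailingDegree h
  have hC : Polynomial.C c * Polynomial.X ^ w ≠ 0 := by simp [hc]
  rw [Polynomial.natDegree_mul hC hr, Polynomial.natDegree_mul hμ hE, Polynomial.natDegree_expand,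
    Polynomial.natDegree_C_mul_X_pow _ _ hc] at h1
  rw [Polynomial.natTrailingDegree_mul hC hr, Polynomial.natTrailingDegree_mul hμ hE,
    Polynomial.C_mul_X_pow_eq_monomial, Polynomial.natTrailingDegree_monomial hc] at h2
  have h3 := Polynomial.natTrailingDegree_le_natDegree r
  have h4 := Polynomial.natTrailingDegree_le_natDegree μ
  have h5 : μ.natDegree ≤ μ.natTrailingDegree := by nlinarith
  refine ⟨μ.coeff μ.natDegree, μ.natDegree, ?_, ?_⟩
  · simpa using hμ
  · ext n
    rw [Polynomial.coeff_monomial]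
    split_ifs with h6
    · rw [h6]
    · rcases lt_or_gt_of_ne h6 with h7 | h7
      · exact Polynomial.coeff_eq_zero_of_natDegree_lt h7
      · exact Polynomial.coeff_eq_zero_of_lt_natTrailingDegree (by omega)

/-- functional independence -/
theorem func_indep {K E : Type*} [Field K] (q : ℕ) (hq : 2 ≤ q)
    (ch : List (ℕ × E) → K) (hch : ∀ B, ch B ≠ 0)
    (hinj : ∀ B a b, a.1 = b.1 → ch (B ++ [a]) = ch (B ++ [b]) → a = b)
    (F : List (ℕ × E) → PowerSeries K) (hF0 : F [] = 1)
    (P : List (ℕ × E) → Prop) (hF : ∀ B, P B → F B = PowerSeries.C (ch B) * PowerSeries.X ^ (q * lwt B) *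
          PowerSeries.expand q (by omega) (F B) +
        if B = [] then 0 else PowerSeries.C (ch B.dropLast) * PowerSeries.X ^ (q * lwt B.dropLast) *
          PowerSeries.expand q (by omega) (F B.dropLast)) :
    ∀ (n : ℕ) (I : Finset (List (ℕ × E))), I.card = n → (∀ B ∈ I, P B) → (∀ B a, B ++ [a] ∈ I → B ∈ I) →
    (∀ B a, B ++ [a] ∈ I → 0 < a.1 ∧ ¬ q ∣ a.1) →
    ∀ (r : List (ℕ × E) → Polynomial K), (∀ B, B ∉ I → r B = 0) →
    (∑ B ∈ I, (r B : PowerSeries K) * F B = 0) → ∀ B, r B = 0 := by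
  intro n
  induction n with
  | zero =>
    intro I hI _ _ _ r hr _ B
    rw [Finset.card_eq_zero] at hI
    exact hr B (by simp [hI])
  | succ n ih =>
    intro I hcard hP hI hg
    by_contra hcon
    push Not at hcon
    obtain ⟨r0, hr0, hrel0, B0, hB0⟩ := hcon
    have hne : I.Nonempty := by
      rw [← Finset.card_pos]; omega
    obtain ⟨A, hA, hAmax⟩ := Finset.exists_max_image I List.length hne
    have key : ∀ r : List (ℕ × E) → Polynomial K, (∀ B, B ∉ I → r B = 0) →
        (∑ B ∈ I, (r B : PowerSeries K) * F B = 0) → r A = 0 → ∀ B, r B = 0 := by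
      intro r hr hrel hrA
      apply ih (I.erase A)
      · rw [Finset.card_erase_of_mem hA, hcard]; rfl
      · exact fun B hB => hP B (Finset.mem_of_mem_erase hB)
      · intro B a hBa
        rw [Finset.mem_erase] at hBa ⊢
        refine ⟨?_, hI _ _ hBa.2⟩
        rintro rfl
        have := hAmax _ hBa.2
        simp at this
      · intro B a hBa
        exact hg B a (Finset.mem_of_mem_erase hBa)
      · intro B hB
        by_cases h : B = A
        · rw [h, hrA]
        · exact hr B fun h' => hB (Finset.mem_erase.2 ⟨h, h'⟩)
      · rw [← hrel, ← Finset.add_sum_erase I _ hA, hrA]; simp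
    -- the ideal
    let J : Ideal (Polynomial K) :=
      { carrier := {p | ∃ r : List (ℕ × E) → Polynomial K, (∀ B, B ∉ I → r B = 0) ∧
          (∑ B ∈ I, (r B : PowerSeries K) * F B = 0) ∧ r A = p}
        add_mem' := by
          rintro _ _ ⟨r, h1, h2, rfl⟩ ⟨r', h1', h2', rfl⟩
          refine ⟨fun B => r B + r' B, fun B hB => by simp [h1 B hB, h1' B hB], ?_, rfl⟩
          simp only [Polynomial.coe_add, add_mul, Finset.sum_add_distrib, h2, h2', add_zero]
        zero_mem' := ⟨fun _ => 0, by simp, by simp, rfl⟩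
        smul_mem' := by
          rintro c _ ⟨r, h1, h2, rfl⟩
          refine ⟨fun B => c * r B, fun B hB => by simp [h1 B hB], ?_, rfl⟩
          simp only [Polynomial.coe_mul, mul_assoc, ← Finset.mul_sum, h2, mul_zero] }
    obtain ⟨g, hg'⟩ := (IsPrincipalIdealRing.principal J).principal
    have hgJ : g ∈ J := by rw [hg']; exact Submodule.mem_span_singleton_self g
    obtain ⟨r, hr, hrel, hrA⟩ := hgJ
    have hmul : ∀ r' : List (ℕ × E) → Polynomial K, (∀ B, B ∉ I → r' B = 0) →
        (∑ B ∈ I, (r' B : PowerSeries K) * F B = 0) → ∃ μ, ∀ B, r' B = μ * r B := by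
      intro r' h1 h2
      have : r' A ∈ J := ⟨r', h1, h2, rfl⟩
      rw [hg', Submodule.mem_span_singleton] at this
      obtain ⟨μ, hμ⟩ := this
      refine ⟨μ, fun B => sub_eq_zero.1 (key (fun B => r' B - μ * r B) ?_ ?_ ?_ B)⟩
      · intro B hB; simp [h1 B hB, hr B hB]
      · simp only [Polynomial.coe_sub, Polynomial.coe_mul, sub_mul, Finset.sum_sub_distrib, h2,
          mul_assoc, ← Finset.mul_sum, hrel]; simp
      · rw [← hμ, hrA, smul_eq_mul, sub_self]
    have hrA0 : r A ≠ 0 := by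
      intro h
      obtain ⟨μ, hμ⟩ := hmul r0 hr0 hrel0
      apply hB0
      rw [hμ, key r hr hrel h, mul_zero]
    -- c
    let c : List (ℕ × E) → Polynomial K := fun B => r B + ∑ C ∈ chd I B, r C
    let T : List (ℕ × E) → Polynomial K := fun B => Polynomial.C (ch B) * Polynomial.X ^ (q * lwt B)
    have hTc : ∑ B ∈ I, ((T B * c B : Polynomial K) : PowerSeries K) *
        PowerSeries.expand q (by omega) (F B) = 0 := by
      rw [← hrel]
      have e1 : ∀ B ∈ I, (r B : PowerSeries K) * F B = (r B : PowerSeries K) * (T B : PowerSeries K) *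
          PowerSeries.expand q (by omega) (F B) + (if B = [] then 0 else
          (r B : PowerSeries K) * (T B.dropLast : PowerSeries K) *
          PowerSeries.expand q (by omega) (F B.dropLast)) := by
        intro B hB
        conv_lhs => rw [hF B (hP B hB)]
        by_cases h : B = [] <;> simp [h, T] <;> ring
      rw [Finset.sum_congr rfl e1, Finset.sum_add_distrib]
      have e2 := sum_chd I hI (fun C B => if C = [] then 0 else
          (r C : PowerSeries K) * (T B : PowerSeries K) *
          PowerSeries.expand q (by omega) (F B)) (fun B => by simp)
      rw [e2, ← Finset.sum_add_distrib]
      refine Finset.sum_congr rfl fun B _ => ?_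
      have e3 : ∑ C ∈ chd I B, (if C = [] then 0 else
          (r C : PowerSeries K) * (T B : PowerSeries K) *
          PowerSeries.expand q (by omega) (F B)) = ∑ C ∈ chd I B, 
          (r C : PowerSeries K) * ((T B : PowerSeries K) *
          PowerSeries.expand q (by omega) (F B)) := by
        refine Finset.sum_congr rfl fun C hC => ?_
        obtain ⟨_, a, rfl⟩ := mem_chd.1 hC
        rw [if_neg (by simp), mul_assoc]
      rw [e3, ← Finset.sum_mul]
      have e4 : ((T B * c B : Polynomial K) : PowerSeries K) = (T B : PowerSeries K) *
          ((r B : PowerSeries K) + ∑ C ∈ chd I B, (r C : PowerSeries K)) := by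
        rw [Polynomial.coe_mul]
        simp only [c, Polynomial.coe_add]
        congr 2
        exact map_sum (Polynomial.coeToPowerSeries.ringHom (R := K)) r _
      rw [e4]; ring
    have hcart : ∀ i, i < q → ∑ B ∈ I, (cart q i (T B * c B) : PowerSeries K) * F B = 0 := by
      have e1 : ∑ i ∈ Finset.range q, PowerSeries.X ^ i * PowerSeries.expand q (by omega)
          (∑ B ∈ I, (cart q i (T B * c B) : PowerSeries K) * F B) = 0 := by
        rw [← hTc]
        simp_rw [map_sum, map_mul, Finset.mul_sum]
        rw [Finset.sum_comm]
        refine Finset.sum_congr rfl fun B _ => ?_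
        conv_rhs => rw [cart_decomp hq (T B * c B), Finset.sum_mul]
        refine Finset.sum_congr rfl fun i _ => ?_
        ring
      intro i hi
      ext n
      rw [← coeff_cartsum (q := q) (by omega)
        (fun i => ∑ B ∈ I, (cart q i (T B * c B) : PowerSeries K) * F B) n i hi, e1]
      simp
    have hTc0 : ∀ B, B ∉ I → c B = 0 := by
      intro B hB
      simp only [c]
      rw [hr B hB, Finset.sum_eq_zero, add_zero]
      intro C hC
      obtain ⟨h1, a, rfl⟩ := mem_chd.1 hC
      exact absurd (hI _ _ h1) hB
    have hmu : ∀ i, ∃ μ, i < q → ∀ B, cart q i (T B * c B) = μ * r B := by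
      intro i
      by_cases hi : i < q
      · obtain ⟨μ, hμ⟩ := hmul (fun B => cart q i (T B * c B))
          (fun B hB => by simp [hTc0 B hB, cart]) (hcart i hi)
        exact ⟨μ, fun _ => hμ⟩
      · exact ⟨0, fun h => absurd h hi⟩
    choose μ' hμ' using hmu
    let μ : Polynomial K := ∑ i ∈ Finset.range q, Polynomial.X ^ i * Polynomial.expand K q (μ' i)
    have hcoe : ∀ p : Polynomial K, ((Polynomial.expand K q p : Polynomial K) : PowerSeries K) =
        PowerSeries.expand q (by omega) (p : PowerSeries K) := by
      intro p
      ext n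
      rw [Polynomial.coeff_coe, Polynomial.coeff_expand (by omega), PowerSeries.coeff_expand,
        Polynomial.coeff_coe]
    have EE : ∀ B, T B * c B = μ * Polynomial.expand K q (r B) := by
      intro B
      apply Polynomial.coe_injective
      rw [cart_decomp hq (T B * c B), Polynomial.coe_mul]
      have e1 : (μ : PowerSeries K) = ∑ i ∈ Finset.range q, PowerSeries.X ^ i *
          PowerSeries.expand q (by omega) (μ' i : PowerSeries K) := by
        refine (map_sum (Polynomial.coeToPowerSeries.ringHom (R := K))
          (fun i => Polynomial.X ^ i * Polynomial.expand K q (μ' i)) (Finset.range q)).trans ?_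
        refine Finset.sum_congr rfl fun i _ => ?_
        simp [hcoe]
      rw [e1, Finset.sum_mul]
      refine Finset.sum_congr rfl fun i hi => ?_
      rw [hμ' i (Finset.mem_range.1 hi), Polynomial.coe_mul, map_mul, hcoe, mul_assoc]
    have hcA : c A = r A := by
      simp only [c]
      rw [Finset.sum_eq_zero, add_zero]
      intro C hC
      obtain ⟨h1, a, rfl⟩ := mem_chd.1 hC
      have := hAmax _ h1
      simp at this
    obtain ⟨κ, e, hκ, hμκ⟩ := monomial_of_expand hq (r A) μ hrA0 (ch A) (hch A) (q * lwt A)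
      (by rw [← EE A, hcA])
    have hco : ∀ B n, (if q * lwt B ≤ n then ch B * (c B).coeff (n - q * lwt B) else 0) =
        if e ≤ n then (if q ∣ n - e then κ * (r B).coeff ((n - e) / q) else 0) else 0 := by
      intro B n
      have := congrArg (fun p => Polynomial.coeff p n) (EE B)
      simp only [T, hμκ] at this
      rw [← Polynomial.C_mul_X_pow_eq_monomial, mul_assoc, mul_assoc, Polynomial.coeff_C_mul,
        Polynomial.coeff_C_mul, Polynomial.coeff_X_pow_mul', Polynomial.coeff_X_pow_mul',
        Polynomial.coeff_expand (by omega)] at this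
      simpa only [mul_ite, mul_zero] using this
    have fin := func_comb q hq ch hch hinj I hg r c hr
      (fun B j => by simp [c, Polynomial.finsetSum_coeff]) e κ hκ ?_ ?_
    · have hrB : ∀ B, B ≠ [] → r B = 0 := by
        intro B hB
        ext i
        by_contra h
        exact hB (fin B i h).1
      have hAn : A = [] := by
        by_contra h
        exact hrA0 (hrB A h)
      rw [Finset.sum_eq_single [] (fun B _ hB => by simp [hrB B hB])
        (fun h => absurd (hAn ▸ hA) h), hF0, mul_one] at hrel
      rw [hAn] at hrA0
      exact hrA0 (Polynomial.coe_injective K (by rw [hrel]; simp))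
    · intro B j hj
      have := hco B (q * lwt B + j)
      rw [if_pos (by omega), Nat.add_sub_cancel_left] at this
      split_ifs at this with h1 h2
      · obtain ⟨i, hi⟩ := h2
        refine ⟨i, by omega, ?_⟩
        rw [this, hi, Nat.mul_div_cancel_left _ (by omega)]
      · exact absurd this (mul_ne_zero (hch B) hj)
      · exact absurd this (mul_ne_zero (hch B) hj)
    · intro B i hi
      have := hco B (q * i + e)
      rw [if_pos (by omega : e ≤ _), Nat.add_sub_cancel, if_pos (Dvd.intro _ rfl),
        Nat.mul_div_cancel_left _ (by omega)] at this
      split_ifs at this with h1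
      · exact ⟨_, by omega, this.symm⟩
      · exact absurd this.symm (mul_ne_zero hκ hi)

/-- iterated sums; the head of the list carries the largest index -/
def isum {A R : Type*} [CommSemiring R] (φ : A → ℕ → R) : List A → ℕ → R
  | [], _ => 1
  | a :: l, m => ∑ d ∈ Finset.range m, φ a d * isum φ l d

section isum
variable {A R S : Type*} [CommSemiring R] [CommSemiring S] (φ : A → ℕ → R)

@[simp] lemma isum_nil (m : ℕ) : isum φ [] m = 1 := rfl

lemma isum_cons (a : A) (l : List A) (m : ℕ) :
    isum φ (a :: l) m = ∑ d ∈ Finset.range m, φ a d * isum φ l d := rfl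

lemma isum_cons_succ (a : A) (l : List A) (m : ℕ) :
    isum φ (a :: l) (m + 1) = isum φ (a :: l) m + φ a m * isum φ l m := by
  rw [isum_cons, Finset.sum_range_succ, ← isum_cons]

lemma isum_concat_zero (l : List A) (a : A) : isum φ (l ++ [a]) 0 = 0 := by
  cases l <;> simp [isum_cons]

lemma isum_concat_succ (l : List A) (a : A) (m : ℕ) :
    isum φ (l ++ [a]) (m + 1) = isum (fun a d => φ a (d + 1)) (l ++ [a]) m +
      φ a 0 * isum (fun a d => φ a (d + 1)) l m := by
  induction l generalizing m with
  | nil => simp [isum_cons, Finset.sum_range_succ']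
  | cons b l ih =>
    simp only [List.cons_append, isum_cons]
    rw [Finset.sum_range_succ', isum_concat_zero, mul_zero, add_zero, Finset.mul_sum,
      ← Finset.sum_add_distrib]
    refine Finset.sum_congr rfl fun d _ => ?_
    rw [ih]; ring

lemma isum_map (f : R →+* S) (l : List A) (m : ℕ) :
    isum (fun a d => f (φ a d)) l m = f (isum φ l m) := by
  induction l generalizing m with
  | nil => simp
  | cons b l ih => simp [isum_cons, ih]

lemma isum_smul (u : A → R) (l : List A) (m : ℕ) :
    isum (fun a d => u a * φ a d) l m = (l.map u).prod * isum φ l m := by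
  induction l generalizing m with
  | nil => simp
  | cons b l ih =>
    simp only [isum_cons, ih, List.map_cons, List.prod_cons, Finset.mul_sum]
    refine Finset.sum_congr rfl fun d _ => ?_
    ring

end isum

section Flim
variable {R S : Type*} [CommRing R] [CommRing S]

/-- limit of a sequence of power series -/
def Flim (f : ℕ → PowerSeries R) : PowerSeries R :=
  PowerSeries.mk fun i => PowerSeries.coeff i (f (i + 1))

lemma Flim_spec (f : ℕ → PowerSeries R) (hf : ∀ m, PowerSeries.X ^ m ∣ f (m + 1) - f m) (m : ℕ) :
    PowerSeries.X ^ m ∣ Flim f - f m := by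
  have h1 : ∀ n i, PowerSeries.X ^ n ∣ f (n + i) - f n := by
    intro n i
    induction i with
    | zero => simp
    | succ i ih =>
      have := (pow_dvd_pow PowerSeries.X (Nat.le_add_right n i)).trans (hf (n + i))
      have := dvd_add this ih
      rwa [sub_add_sub_cancel] at this
  rw [PowerSeries.X_pow_dvd_iff]
  intro i hi
  obtain ⟨j, rfl⟩ : ∃ j, m = i + 1 + j := ⟨m - (i + 1), by omega⟩
  have := PowerSeries.X_pow_dvd_iff.1 (h1 (i + 1) j) i (by omega)
  rw [map_sub, sub_eq_zero] at this
  simp [Flim, this]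

lemma ps_eq_of_dvd {F G : PowerSeries R} (h : ∀ m, PowerSeries.X ^ m ∣ F - G) : F = G := by
  rw [← sub_eq_zero]
  ext i
  simpa using PowerSeries.X_pow_dvd_iff.1 (h (i + 1)) i (by omega)

lemma X_dvd_isum {A : Type*} (φ : A → ℕ → PowerSeries R) (l : List A)
    (hφ : ∀ a ∈ l, ∀ d, PowerSeries.X ^ d ∣ φ a d) (m : ℕ) :
    PowerSeries.X ^ m ∣ isum φ l (m + 1) - isum φ l m := by
  cases l with
  | nil => simp
  | cons a l =>
    rw [isum_cons_succ, add_sub_cancel_left]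
    exact (hφ a (by simp) m).mul_right _

end Flim

section FF
variable {E k : Type*} [Field k] (q : ℕ) (ev : E → k)

/-- reduced letters -/
def psi0 (a : ℕ × E) (d : ℕ) : PowerSeries k :=
  PowerSeries.C (ev a.2) ^ d * (∏ j ∈ Finset.range d, (-(PowerSeries.X ^ q ^ (j + 1)))) ^ a.1

/-- `(t - x^{q^j})⁻¹` -/
def GG (j : ℕ) : PowerSeries (Polynomial k) :=
  -(PowerSeries.X ^ q ^ j) *
    PowerSeries.invOfUnit (1 - PowerSeries.C Polynomial.X * PowerSeries.X ^ q ^ j) 1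

/-- letters -/
def psi (a : ℕ × E) (d : ℕ) : PowerSeries (Polynomial k) :=
  PowerSeries.C (Polynomial.C (ev a.2)) ^ d * (∏ j ∈ Finset.range d, GG q (j + 1)) ^ a.1

/-- the character attached to letters -/
def cha (a : ℕ × E) : k := ev a.2 * (-1) ^ a.1

variable {q}

lemma GG_spec (hq : 2 ≤ q) (j : ℕ) :
    (1 - PowerSeries.C Polynomial.X * PowerSeries.X ^ q ^ j) * GG q j =
      -(PowerSeries.X ^ q ^ j : PowerSeries (Polynomial k)) := by
  have : (1 - PowerSeries.C Polynomial.X * PowerSeries.X ^ q ^ j : PowerSeries (Polynomial k)) *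
      PowerSeries.invOfUnit (1 - PowerSeries.C Polynomial.X * PowerSeries.X ^ q ^ j) 1 = 1 := by
    apply PowerSeries.mul_invOfUnit
    simp [show q ≠ 0 by omega]
  rw [GG, mul_left_comm, this, mul_one]

lemma X_dvd_GG (hq : 2 ≤ q) (j : ℕ) : PowerSeries.X ∣ GG (k := k) q j := by
  rw [GG]
  exact ((dvd_pow_self _ (by positivity)).neg_right).mul_right _

lemma X_dvd_psi (hq : 2 ≤ q) (a : ℕ × E) (ha : 0 < a.1) (d : ℕ) :
    PowerSeries.X ^ d ∣ psi q ev a d := by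
  apply Dvd.dvd.mul_left
  apply dvd_trans _ (dvd_pow_self _ ha.ne')
  rw [← Finset.card_range d, ← Finset.prod_const, Finset.card_range]
  exact Finset.prod_dvd_prod_of_dvd _ _ fun i _ => X_dvd_GG hq _

/-- reduction modulo `t` -/
abbrev redt : PowerSeries (Polynomial k) →+* PowerSeries k :=
  PowerSeries.map (Polynomial.evalRingHom 0)

lemma redt_psi (hq : 2 ≤ q) (a : ℕ × E) (d : ℕ) : redt (psi q ev a d) = psi0 q ev a d := by
  have h1 : ∀ j, redt (GG (k := k) q j) = -(PowerSeries.X ^ q ^ j) := by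
    intro j
    have := congrArg redt (GG_spec (k := k) hq j)
    simpa using this
  simp [psi, psi0, h1]

/-- generating series -/
def FF (q : ℕ) (ev : E → k) (B : List (ℕ × E)) : PowerSeries (Polynomial k) := Flim (isum (psi q ev) B)

lemma FF_spec (hq : 2 ≤ q) (B : List (ℕ × E)) (hB : ∀ a ∈ B, 0 < a.1) (m : ℕ) :
    PowerSeries.X ^ m ∣ FF q ev B - isum (psi q ev) B m :=
  Flim_spec _ (X_dvd_isum _ _ fun a ha d => X_dvd_psi ev hq a (hB a ha) d) m

/-- reduced generating series -/
def F0 (q : ℕ) (ev : E → k) (B : List (ℕ × E)) : PowerSeries k := redt (FF q ev B)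

lemma F0_spec (hq : 2 ≤ q) (B : List (ℕ × E)) (hB : ∀ a ∈ B, 0 < a.1) (m : ℕ) :
    PowerSeries.X ^ m ∣ F0 q ev B - isum (psi0 q ev) B m := by
  have := map_dvd (redt (k := k)) (FF_spec ev hq B hB m)
  rw [map_pow, PowerSeries.map_X, map_sub, ← isum_map] at this
  simp only [redt_psi ev hq] at this
  exact this

lemma prod_cha (q : ℕ) (B : List (ℕ × E)) :
    (B.map fun a => PowerSeries.C (ev a.2) * (-(PowerSeries.X ^ q)) ^ a.1).prod =
    PowerSeries.C (B.map (cha ev)).prod * PowerSeries.X ^ (q * lwt B) := by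
  induction B with
  | nil => simp [lwt]
  | cons a B ih =>
    rw [List.map_cons, List.prod_cons, ih, List.map_cons, List.prod_cons, lwt_cons, cha]
    rw [map_mul, map_mul, mul_add, pow_add, pow_mul, neg_pow]
    simp; ring

lemma F0_fun (hq : 2 ≤ q) (B : List (ℕ × E)) (hB : ∀ a ∈ B, 0 < a.1) :
    F0 q ev B = PowerSeries.C (B.map (cha ev)).prod * PowerSeries.X ^ (q * lwt B) *
          PowerSeries.expand q (by omega) (F0 q ev B) +
        if B = [] then 0 else PowerSeries.C (B.dropLast.map (cha ev)).prod *
          PowerSeries.X ^ (q * lwt B.dropLast) *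
          PowerSeries.expand q (by omega) (F0 q ev B.dropLast) := by
  have hsh : ∀ (B : List (ℕ × E)) m, isum (fun a d => psi0 q ev a (d + 1)) B m =
      PowerSeries.C (B.map (cha ev)).prod * PowerSeries.X ^ (q * lwt B) *
          PowerSeries.expand q (by omega) (isum (psi0 q ev) B m) := by
    intro B m
    have h1 : (fun a d => psi0 q ev a (d + 1)) = fun (a : ℕ × E) d =>
        (PowerSeries.C (ev a.2) * (-(PowerSeries.X ^ q)) ^ a.1) *
        ((PowerSeries.expand q (by omega) : PowerSeries k →ₐ[k] PowerSeries k) :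
          PowerSeries k →+* PowerSeries k) (psi0 q ev a d) := by
      funext a d
      simp only [psi0, RingHom.coe_coe, map_mul, map_pow, map_prod, map_neg,
        PowerSeries.expand_X, PowerSeries.expand_C, Finset.prod_range_succ', pow_succ, mul_pow,
        ← pow_mul]
      simp; ring_nf
    rw [h1, isum_smul, isum_map, prod_cha]
    rfl
  have hexp : ∀ (B : List (ℕ × E)) (hB : ∀ a ∈ B, 0 < a.1) m, PowerSeries.X ^ m ∣
      PowerSeries.expand q (by omega) (F0 q ev B) -
        PowerSeries.expand q (by omega) (isum (psi0 q ev) B m) := by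
    intro B hB m
    rw [← map_sub]
    have := map_dvd (PowerSeries.expand q (by omega) : PowerSeries k →ₐ[k] PowerSeries k)
      (F0_spec ev hq B hB m)
    rw [map_pow, PowerSeries.expand_X, ← pow_mul] at this
    exact (pow_dvd_pow _ (by nlinarith)).trans this
  have h00 : F0 q ev [] = 1 := by
    apply ps_eq_of_dvd
    intro m
    simpa using F0_spec ev hq [] (by simp) m
  rcases List.eq_nil_or_concat' B with rfl | ⟨l, a, rfl⟩
  · simp [h00, lwt]
  have hl : ∀ a ∈ l, 0 < a.1 := fun a ha => hB a (by simp [ha])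
  rw [if_neg (by simp), List.dropLast_concat]
  apply ps_eq_of_dvd
  intro m
  have h1 := F0_spec ev hq _ hB (m + 1)
  rw [isum_concat_succ, hsh, hsh] at h1
  have h2 : psi0 q ev a 0 = 1 := by simp [psi0]
  rw [h2, one_mul] at h1
  have h1' := (pow_dvd_pow _ (Nat.le_succ m)).trans h1
  have := dvd_sub (dvd_sub h1' ((hexp _ hB m).mul_left (PowerSeries.C ((l ++ [a]).map (cha ev)).prod *
    PowerSeries.X ^ (q * lwt (l ++ [a]))))) ((hexp _ hl m).mul_left (PowerSeries.C (l.map (cha ev)).prod *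
    PowerSeries.X ^ (q * lwt l)))
  convert this using 1
  ring

lemma F0_nil (hq : 2 ≤ q) : F0 q ev [] = 1 := by
  apply ps_eq_of_dvd
  intro m
  simpa using F0_spec ev hq [] (by simp) m

/-- functional independence over `k[t][y]` -/
theorem FF_indep (hq : 2 ≤ q) (hev : Function.Injective ev) (hev0 : ∀ a, ev a ≠ 0)
    (I : Finset (List (ℕ × E))) (hP : ∀ B ∈ I, ∀ a ∈ B, 0 < a.1 ∧ ¬ q ∣ a.1)
    (hI : ∀ B a, B ++ [a] ∈ I → B ∈ I)
    (r : List (ℕ × E) → Polynomial (Polynomial k)) (hr : ∀ B, B ∉ I → r B = 0)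
    (hrel : ∑ B ∈ I, (r B : PowerSeries (Polynomial k)) * FF q ev B = 0) (B) : r B = 0 := by
  have hcha : ∀ a, cha ev a ≠ 0 := fun a => mul_ne_zero (hev0 _) (by simp)
  have step : ∀ r : List (ℕ × E) → Polynomial (Polynomial k), (∀ B, B ∉ I → r B = 0) →
      (∑ B ∈ I, (r B : PowerSeries (Polynomial k)) * FF q ev B = 0) →
      ∀ B, (r B).map (Polynomial.evalRingHom 0) = 0 := by
    intro r hr hrel
    apply func_indep q hq (fun B => (B.map (cha ev)).prod) ?_ ?_ (F0 q ev) (F0_nil ev hq)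
      (fun B => ∀ a ∈ B, 0 < a.1) (F0_fun ev hq) _ I rfl (fun B hB a ha => (hP B hB a ha).1) hI
    · intro B a hB; exact hP _ hB a (by simp)
    · intro B hB; simp [hr B hB]
    · have := congrArg redt hrel
      simpa only [map_sum, map_mul, map_zero, Polynomial.polynomial_map_coe, F0] using this
    · intro B
      refine List.prod_ne_zero ?_
      simp only [List.mem_map, not_exists, not_and]
      exact fun a _ => hcha a
    · intro B a b hab h
      have hB : (B.map (cha ev)).prod ≠ 0 := by
        refine List.prod_ne_zero ?_
        simp only [List.mem_map, not_exists, not_and]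
        exact fun a _ => hcha a
      simp only [List.map_append, List.prod_append, List.map_cons, List.map_nil,
        List.prod_singleton] at h
      have h2 := mul_left_cancel₀ hB h
      simp only [cha, hab] at h2
      exact Prod.ext hab (hev (mul_right_cancel₀ (by simp) h2))
  have all : ∀ n, ∀ r : List (ℕ × E) → Polynomial (Polynomial k), (∀ B, B ∉ I → r B = 0) →
      (∑ B ∈ I, (r B : PowerSeries (Polynomial k)) * FF q ev B = 0) →
      ∀ B i, Polynomial.X ^ n ∣ (r B).coeff i := by
    intro n
    induction n with
    | zero => simp
    | succ n ih =>
      intro r hr hrel B i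
      have h1 : ∀ B, ∃ p, r B = Polynomial.C Polynomial.X * p := by
        intro B
        have h2 := step r hr hrel B
        rw [← dvd_def, Polynomial.C_dvd_iff_dvd_coeff]
        intro j
        have := congrArg (fun p => Polynomial.coeff p j) h2
        simp only [Polynomial.coeff_map, Polynomial.coeff_zero] at this
        rw [Polynomial.X_dvd_iff, Polynomial.coeff_zero_eq_eval_zero]
        exact this
      choose p hp using h1
      have hX : Polynomial.C Polynomial.X ≠ (0 : Polynomial (Polynomial k)) := by
        simp
      have h3 := ih p ?_ ?_ B i
      · rw [hp B, Polynomial.coeff_C_mul, pow_succ, mul_comm]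
        exact mul_dvd_mul_left _ h3
      · intro B hB
        have := hp B
        rw [hr B hB] at this
        exact (mul_eq_zero.1 this.symm).resolve_left hX
      · simp only [hp, Polynomial.coe_mul, mul_assoc, ← Finset.mul_sum] at hrel
        refine (mul_eq_zero.1 hrel).resolve_left ?_
        exact fun h => hX (Polynomial.coe_injective _ (by rw [h]; simp))
  ext1 i
  rw [Polynomial.coeff_zero]
  by_contra h
  have := Polynomial.natDegree_le_of_dvd (all ((r B).coeff i).natDegree.succ r hr hrel B i) h
  simp at this

end FF

section og
variable {k : Type*} [Field k]

/-- order at least `n` -/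
def og (n : ℤ) (f : LaurentSeries k) : Prop := ∀ i < n, f.coeff i = 0

lemma og_mono {n m : ℤ} {f : LaurentSeries k} (h : og n f) (hm : m ≤ n) : og m f :=
  fun i hi => h i (by omega)

lemma og_zero (n : ℤ) : og n (0 : LaurentSeries k) := fun _ _ => rfl

lemma og_add {n : ℤ} {f g : LaurentSeries k} (hf : og n f) (hg : og n g) : og n (f + g) :=
  fun i hi => by rw [HahnSeries.coeff_add, hf i hi, hg i hi, add_zero]

lemma og_neg {n : ℤ} {f : LaurentSeries k} (hf : og n f) : og n (-f) :=
  fun i hi => by rw [HahnSeries.coeff_neg, hf i hi, neg_zero]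

lemma og_sub {n : ℤ} {f g : LaurentSeries k} (hf : og n f) (hg : og n g) : og n (f - g) := by
  rw [sub_eq_add_neg]; exact og_add hf (og_neg hg)

lemma og_sum {ι : Type*} (s : Finset ι) {n : ℤ} {f : ι → LaurentSeries k} (hf : ∀ i ∈ s, og n (f i)) :
    og n (∑ i ∈ s, f i) := by
  induction s using Finset.induction_on with
  | empty => simpa using og_zero n
  | insert a s ha ih =>
    rw [Finset.sum_insert ha]
    exact og_add (hf a (by simp)) (ih fun i hi => hf i (by simp [hi]))

lemma og_mul {n m : ℤ} {f g : LaurentSeries k} (hf : og n f) (hg : og m g) : og (n + m) (f * g) := by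
  intro i hi
  rw [HahnSeries.coeff_mul]
  refine Finset.sum_eq_zero fun x hx => ?_
  rw [Finset.mem_antidiagonal] at hx
  by_cases h : x.1 < n
  · rw [hf _ h, zero_mul]
  · rw [hg _ (by omega), mul_zero]

lemma og_single {n m : ℤ} (h : n ≤ m) (c : k) : og n (HahnSeries.single m c : LaurentSeries k) :=
  fun i hi => HahnSeries.coeff_single_of_ne (by omega)

lemma og_C (c : k) : og 0 (HahnSeries.C c : LaurentSeries k) := og_single le_rfl c

lemma og_one : og 0 (1 : LaurentSeries k) := og_C 1

lemma og_pow {f : LaurentSeries k} {n : ℤ} (hf : og n f) (m : ℕ) : og (m * n) (f ^ m) := by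
  induction m with
  | zero => simpa using og_one
  | succ m ih =>
    rw [pow_succ]
    exact og_mono (og_mul ih hf) (by push_cast; linarith)

lemma og_pow0 {f : LaurentSeries k} (hf : og 0 f) (m : ℕ) : og 0 (f ^ m) := by
  simpa using og_pow hf m

lemma og_prod0 {ι : Type*} (s : Finset ι) {f : ι → LaurentSeries k} (hf : ∀ i ∈ s, og 0 (f i)) :
    og 0 (∏ i ∈ s, f i) := by
  induction s using Finset.induction_on with
  | empty => simpa using og_one
  | insert a s ha ih =>
    rw [Finset.prod_insert ha]
    simpa using og_mul (hf a (by simp)) (ih fun i hi => hf i (by simp [hi]))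

lemma og_mul0 {n : ℤ} {f g : LaurentSeries k} (hf : og 0 f) (hg : og n g) : og n (f * g) := by
  simpa using og_mul hf hg

lemma exists_og (f : LaurentSeries k) : ∃ m, og m f := by
  refine ⟨f.order, fun i hi => HahnSeries.coeff_eq_zero_of_lt_order hi⟩

lemma eq_zero_of_og {f : LaurentSeries k} (h : ∀ m : ℕ, og m f) : f = 0 := by
  ext i
  exact h (i.toNat + 1) i (by omega)

lemma og_of_unit {u x z : LaurentSeries k} {n : ℤ} (hu : og 1 u) (hz : og n z)
    (h : (1 + u) * x = z) : og n x := by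
  obtain ⟨m, hm⟩ := exists_og x
  have hx : x = z - u * x := by rw [← h]; ring
  have : ∀ j : ℕ, og (min n (m + j)) x := by
    intro j
    induction j with
    | zero => exact og_mono hm (by simp)
    | succ j ih =>
      rw [hx]
      refine og_sub (og_mono hz (by simp)) (og_mono (og_mul hu ih) ?_)
      push_cast
      omega
  exact og_mono (this (n - m).toNat) (by omega)

/-- formal limits -/
lemma exists_hlim (f : ℕ → LaurentSeries k) (hf : ∀ m : ℕ, og m (f (m + 1) - f m)) :
    ∃ F, ∀ m : ℕ, og m (F - f m) := by
  have h1 : ∀ n i : ℕ, og n (f (n + i) - f n) := by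
    intro n i
    induction i with
    | zero => simpa using og_zero _
    | succ i ih =>
      have := og_add (og_mono (hf (n + i)) (by push_cast; omega : (n : ℤ) ≤ _)) ih
      rwa [sub_add_sub_cancel] at this
  obtain ⟨b, hb⟩ := exists_og (f 1)
  refine ⟨HahnSeries.ofSuppBddBelow (fun i : ℤ => (f (i.toNat + 1)).coeff i) ⟨min b 0, ?_⟩, ?_⟩
  · intro i hi
    by_contra h
    push Not at h
    apply hi
    have : i.toNat = 0 := by omega
    simp only [this]
    exact hb i (by omega)
  · intro m i hi
    rw [HahnSeries.coeff_sub]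
    simp only [HahnSeries.ofSuppBddBelow]
    rcases m with _ | m
    · have h2 : i.toNat = 0 := by omega
      have := hf 0 i hi
      rw [HahnSeries.coeff_sub] at this
      simpa [h2] using this
    · have := h1 (i.toNat + 1) (m + 1 - (i.toNat + 1)) i (by omega)
      rw [HahnSeries.coeff_sub, sub_eq_zero] at this
      rw [sub_eq_zero]
      rw [← this]
      congr 2
      omega

end og
section Hser
variable {k E : Type*} [Field k]

/-- `θ` -/
abbrev th : LaurentSeries k := HahnSeries.single (-1 : ℤ) 1

lemma th_pow (n : ℕ) : (th : LaurentSeries k) ^ n = HahnSeries.single (-(n : ℤ)) 1 := by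
  simp [th, HahnSeries.single_pow]

lemma og_th_pow (n : ℕ) : og (-n) ((th : LaurentSeries k) ^ n) := by
  rw [th_pow]; exact og_single le_rfl _

lemma th_sub_ne {n m : ℕ} (h : n ≠ m) : (th : LaurentSeries k) ^ n - th ^ m ≠ 0 := by
  intro h0
  have := congrArg (fun f => HahnSeries.coeff f (-(n : ℤ))) h0
  simp only [th_pow, HahnSeries.coeff_sub, HahnSeries.coeff_single_same, HahnSeries.coeff_zero] at this
  rw [HahnSeries.coeff_single_of_ne (by omega)] at this
  simp at this

/-- `(θ - θ^Q)⁻¹` -/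
def gq (Q : ℕ) : LaurentSeries k := (th - th ^ Q)⁻¹

lemma gq_mul {Q : ℕ} (hQ : 2 ≤ Q) : (th - th ^ Q) * gq Q = (1 : LaurentSeries k) := by
  have := th_sub_ne (k := k) (n := 1) (m := Q) (by omega)
  rw [pow_one] at this
  exact mul_inv_cancel₀ this

/-- `θ^{-n}` -/
abbrev yy (n : ℕ) : LaurentSeries k := HahnSeries.single (n : ℤ) 1

lemma th_yy (n : ℕ) : (th : LaurentSeries k) ^ n * yy n = 1 := by
  rw [th_pow, HahnSeries.single_mul_single]; simp

lemma yy_pow (n m : ℕ) : (yy n : LaurentSeries k) ^ m = yy (m * n) := by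
  simp [yy, HahnSeries.single_pow]

lemma gq_mul' {Q : ℕ} (hQ : 2 ≤ Q) : (1 - th * yy Q) * gq Q = -(yy Q : LaurentSeries k) := by
  have h1 := gq_mul (k := k) hQ
  have h2 := th_yy (k := k) Q
  linear_combination (-yy Q) * h1 + (gq Q) * (-1) * h2

lemma og_gq {Q : ℕ} (hQ : 2 ≤ Q) : og Q (gq Q : LaurentSeries k) := by
  refine og_of_unit (u := -(th * yy Q)) (z := -(yy Q)) ?_ (og_neg (og_single le_rfl _)) ?_
  · refine og_neg ?_
    rw [HahnSeries.single_mul_single]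
    exact og_single (by omega) _
  · rw [← gq_mul' hQ]; ring

/-- shifted letters -/
def phik (q : ℕ) (ev : E → k) (κ : ℕ) (a : ℕ × E) (d : ℕ) : LaurentSeries k :=
  HahnSeries.C (ev a.2) ^ d * (∏ j ∈ Finset.range d, gq (q ^ (κ + j + 1))) ^ a.1

variable {q : ℕ} (ev : E → k)

lemma two_le_qpow (hq : 2 ≤ q) (n : ℕ) : 2 ≤ q ^ (n + 1) := by
  calc 2 ≤ q := hq
    _ = q ^ 1 := by simp
    _ ≤ _ := Nat.pow_le_pow_right (by omega) (by omega)

lemma og_phik0 (hq : 2 ≤ q) (κ : ℕ) (a : ℕ × E) (d : ℕ) : og 0 (phik q ev κ a d) := by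
  refine og_mul0 (og_pow0 (og_C _) _) (og_pow0 (og_prod0 _ fun j _ => ?_) _)
  exact og_mono (og_gq (two_le_qpow hq _)) (by positivity)

lemma og_phik (hq : 2 ≤ q) (κ : ℕ) (a : ℕ × E) (ha : 0 < a.1) (d : ℕ) :
    og (if d = 0 then 0 else (q : ℤ) ^ (κ + d)) (phik q ev κ a d) := by
  split_ifs with hd
  · exact og_phik0 ev hq κ a d
  obtain ⟨d, rfl⟩ : ∃ d', d = d' + 1 := ⟨d - 1, by omega⟩
  refine og_mul0 (og_pow0 (og_C _) _) ?_
  have h0 : ∀ j, og 0 (gq (q ^ (κ + j + 1)) : LaurentSeries k) := fun j =>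
    og_mono (og_gq (two_le_qpow hq _)) (by positivity)
  have h1 : og ((q : ℤ) ^ (κ + (d + 1))) (∏ j ∈ Finset.range (d + 1), (gq (q ^ (κ + j + 1)) : LaurentSeries k)) := by
    rw [Finset.prod_range_succ]
    refine og_mul0 (og_prod0 _ fun j _ => h0 j) ?_
    have := og_gq (k := k) (two_le_qpow hq (κ + d))
    push_cast at this
    exact og_mono this (by rw [add_assoc])
  refine og_mono (og_pow h1 a.1) ?_
  have : (1 : ℤ) ≤ a.1 := by exact_mod_cast ha
  have h2 : (0 : ℤ) ≤ (q : ℤ) ^ (κ + (d + 1)) := by positivity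
  nlinarith

lemma og_isum (hq : 2 ≤ q) (κ : ℕ) (l : List (ℕ × E)) (m : ℕ) : og 0 (isum (phik q ev κ) l m) := by
  induction l generalizing m with
  | nil => exact og_one
  | cons a l ih => exact og_sum _ fun d _ => og_mul0 (og_phik0 ev hq κ a d) (ih d)

lemma og_isum_step (hq : 2 ≤ q) (κ : ℕ) (l : List (ℕ × E)) (hl : ∀ a ∈ l, 0 < a.1) (m : ℕ) :
    og (if m = 0 then 0 else (q : ℤ) ^ (κ + m)) (isum (phik q ev κ) l (m + 1) - isum (phik q ev κ) l m) := by
  cases l with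
  | nil => simpa using og_zero _
  | cons a l =>
    rw [isum_cons_succ, add_sub_cancel_left, mul_comm]
    exact og_mul0 (og_isum ev hq κ l m) (og_phik ev hq κ a (hl a (by simp)) m)

lemma le_qpow (hq : 2 ≤ q) (κ m : ℕ) : (m : ℤ) ≤ if m = 0 then 0 else (q : ℤ) ^ (κ + m) := by
  split_ifs with h
  · simp [h]
  · have : m ≤ q ^ (κ + m) :=
      (Nat.lt_pow_self (by omega)).le.trans (Nat.pow_le_pow_right (by omega) (by omega))
    exact_mod_cast this

lemma exists_Lik (hq : 2 ≤ q) (κ : ℕ) (l : List (ℕ × E)) (hl : ∀ a ∈ l, 0 < a.1) :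
    ∃ F, ∀ m : ℕ, og m (F - isum (phik q ev κ) l m) :=
  exists_hlim _ fun m => og_mono (og_isum_step ev hq κ l hl m) (le_qpow hq κ m)

/-- shifted polylogarithms -/
def Lik (q : ℕ) (ev : E → k) (κ : ℕ) (l : List (ℕ × E)) : LaurentSeries k :=
  if h : ∃ F, ∀ m : ℕ, og m (F - isum (phik q ev κ) l m) then h.choose else 0

lemma Lik_spec (hq : 2 ≤ q) (κ : ℕ) (l : List (ℕ × E)) (hl : ∀ a ∈ l, 0 < a.1) (m : ℕ) :
    og m (Lik q ev κ l - isum (phik q ev κ) l m) := by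
  have h := exists_Lik ev hq κ l hl
  rw [Lik, dif_pos h]
  exact h.choose_spec m

lemma Lik_spec' (hq : 2 ≤ q) (κ : ℕ) (l : List (ℕ × E)) (hl : ∀ a ∈ l, 0 < a.1) (m : ℕ) (hm : m ≠ 0) :
    og ((q : ℤ) ^ (κ + m)) (Lik q ev κ l - isum (phik q ev κ) l m) := by
  have h1 : ∀ i, og ((q : ℤ) ^ (κ + m)) (isum (phik q ev κ) l (m + i) - isum (phik q ev κ) l m) := by
    intro i
    induction i with
    | zero => simpa using og_zero _
    | succ i ih =>
      have h2 := og_isum_step ev hq κ l hl (m + i)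
      rw [if_neg (by omega)] at h2
      have h3 : (q : ℤ) ^ (κ + m) ≤ (q : ℤ) ^ (κ + (m + i)) := by
        exact_mod_cast Nat.pow_le_pow_right (by omega) (by omega)
      have := og_add (og_mono h2 h3) ih
      rwa [sub_add_sub_cancel] at this
  have h2 := Lik_spec ev hq κ l hl (m + q ^ (κ + m))
  have := og_add (og_mono h2 (by push_cast; omega)) (h1 (q ^ (κ + m)))
  rwa [sub_add_sub_cancel] at this

lemma Lik_nil (hq : 2 ≤ q) (κ : ℕ) : Lik q ev κ [] = 1 := by
  rw [← sub_eq_zero]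
  exact eq_zero_of_og fun m => Lik_spec ev hq κ [] (by simp) m

/-- product of characters -/
def chi (l : List (ℕ × E)) : k := (l.map fun a => ev a.2).prod

lemma prod_chi (g : LaurentSeries k) (B : List (ℕ × E)) :
    (B.map fun a => HahnSeries.C (ev a.2) * g ^ a.1).prod = HahnSeries.C (chi ev B) * g ^ lwt B := by
  induction B with
  | nil => simp [lwt, chi]
  | cons a B ih =>
    rw [List.map_cons, List.prod_cons, ih, lwt_cons, pow_add]
    simp only [chi, List.map_cons, List.prod_cons, map_mul]; ring

lemma Lik_fun (hq : 2 ≤ q) (κ : ℕ) (B : List (ℕ × E)) (hB : ∀ a ∈ B, 0 < a.1) :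
    Lik q ev κ B = HahnSeries.C (chi ev B) * gq (q ^ (κ + 1)) ^ lwt B * Lik q ev (κ + 1) B +
        if B = [] then 0 else HahnSeries.C (chi ev B.dropLast) * gq (q ^ (κ + 1)) ^ lwt B.dropLast *
          Lik q ev (κ + 1) B.dropLast := by
  have hsh : ∀ (B : List (ℕ × E)) m, isum (fun a d => phik q ev κ a (d + 1)) B m =
      HahnSeries.C (chi ev B) * gq (q ^ (κ + 1)) ^ lwt B * isum (phik q ev (κ + 1)) B m := by
    intro B m
    have h1 : (fun a d => phik q ev κ a (d + 1)) = fun (a : ℕ × E) d =>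
        (HahnSeries.C (ev a.2) * gq (q ^ (κ + 1)) ^ a.1) * phik q ev (κ + 1) a d := by
      funext a d
      have : ∀ j, κ + 1 + j + 1 = κ + (j + 1) + 1 := fun j => by ring
      simp only [phik, Finset.prod_range_succ', mul_pow, this, add_zero]
      rw [pow_succ (HahnSeries.C (ev a.2))]
      ring
    rw [h1, isum_smul, prod_chi]
  rcases List.eq_nil_or_concat' B with rfl | ⟨l, a, rfl⟩
  · simp [Lik_nil ev hq, lwt, chi]
  have hl : ∀ a ∈ l, 0 < a.1 := fun a ha => hB a (by simp [ha])
  rw [if_neg (by simp), List.dropLast_concat, ← sub_eq_zero]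
  apply eq_zero_of_og
  intro m
  have h1 := Lik_spec ev hq κ _ hB (m + 1)
  rw [isum_concat_succ, hsh, hsh] at h1
  have h2 : phik q ev κ a 0 = 1 := by simp [phik]
  rw [h2, one_mul] at h1
  have h1' := og_mono h1 (by push_cast; omega : (m : ℤ) ≤ _)
  have hc : ∀ B : List (ℕ × E), og 0 (HahnSeries.C (chi ev B) * gq (q ^ (κ + 1)) ^ lwt B) := fun B =>
    og_mul0 (og_C _) (og_pow0 (og_mono (og_gq (two_le_qpow hq _)) (by positivity)) _)
  have := og_sub (og_sub h1' (og_mul0 (hc (l ++ [a])) (Lik_spec ev hq (κ + 1) _ hB m)))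
    (og_mul0 (hc l) (Lik_spec ev hq (κ + 1) _ hl m))
  convert this using 1
  ring

end Hser

section lift
variable {k E : Type*} [Field k]

/-- evaluation at `θ` -/
def pe : Polynomial k →+* LaurentSeries k := Polynomial.eval₂RingHom HahnSeries.C th

lemma pe_eq (p : Polynomial k) :
    pe p = ∑ i ∈ Finset.range (p.natDegree + 1), HahnSeries.single (-(i : ℤ)) (p.coeff i) := by
  rw [pe, Polynomial.coe_eval₂RingHom, Polynomial.eval₂_eq_sum_range]
  refine Finset.sum_congr rfl fun i _ => ?_
  rw [th_pow, HahnSeries.C_apply, HahnSeries.single_mul_single]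
  simp

lemma og_pe (p : Polynomial k) : og (-(p.natDegree : ℤ)) (pe p) := by
  rw [pe_eq]
  refine og_sum _ fun i hi => og_single ?_ _
  rw [Finset.mem_range] at hi
  omega

lemma coeff_pe (p : Polynomial k) (n : ℕ) : (pe p).coeff (-(n : ℤ)) = p.coeff n := by
  rw [pe_eq, HahnSeries.coeff_sum]
  rw [Finset.sum_eq_single n]
  · simp
  · intro i _ hi
    rw [HahnSeries.coeff_single_of_ne (by omega)]
  · intro h
    rw [Finset.mem_range] at h
    rw [Polynomial.coeff_eq_zero_of_natDegree_lt (by omega)]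
    simp

lemma pe_zero_of_og {p : Polynomial k} (h : og 1 (pe p)) : p = 0 := by
  ext n
  rw [← coeff_pe, h _ (by omega), Polynomial.coeff_zero]

@[simp] lemma pe_X : pe (Polynomial.X : Polynomial k) = th := by simp [pe]
@[simp] lemma pe_C (c : k) : pe (Polynomial.C c) = HahnSeries.C c := by simp [pe]

/-- evaluation at `t = θ`, `y = θ^{-q^κ}` -/
def evk (q κ : ℕ) : Polynomial (Polynomial k) →+* LaurentSeries k :=
  Polynomial.eval₂RingHom pe (yy (q ^ κ))

@[simp] lemma evk_X (q κ : ℕ) : evk (k := k) q κ Polynomial.X = yy (q ^ κ) := by simp [evk]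
@[simp] lemma evk_C (q κ : ℕ) (p : Polynomial k) : evk q κ (Polynomial.C p) = pe p := by simp [evk]

lemma og_evk (q : ℕ) (u : Polynomial (Polynomial k)) : ∃ c : ℕ, ∀ κ, og (-(c : ℤ)) (evk q κ u) := by
  refine ⟨(Finset.range (u.natDegree + 1)).sup fun i => (u.coeff i).natDegree, fun κ => ?_⟩
  rw [evk, Polynomial.coe_eval₂RingHom, Polynomial.eval₂_eq_sum_range]
  refine og_sum _ fun i hi => ?_
  rw [mul_comm]
  refine og_mul0 (og_pow0 (og_single (by positivity) _) _) (og_mono (og_pe _) ?_)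
  have := Finset.le_sup (f := fun i => (u.coeff i).natDegree) hi
  omega

lemma og_evk_sub (q : ℕ) (u : Polynomial (Polynomial k)) :
    ∃ c : ℕ, ∀ κ, og ((q : ℤ) ^ κ - c) (evk q κ u - pe (u.coeff 0)) := by
  obtain ⟨c, hc⟩ := og_evk q u.divX
  refine ⟨c, fun κ => ?_⟩
  have h := congrArg (evk q κ) (Polynomial.divX_mul_X_add u)
  rw [map_add, map_mul, evk_X, evk_C] at h
  rw [← h, add_sub_cancel_right]
  refine og_mono (og_mul (hc κ) (og_single le_rfl _)) ?_
  push_cast; omega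

lemma large_pow {q : ℕ} (hq : 2 ≤ q) (c : ℕ) : ∃ κ0, ∀ κ ≥ κ0, (c : ℤ) < (q : ℤ) ^ κ := by
  refine ⟨c, fun κ h => ?_⟩
  have : c < q ^ κ := (Nat.lt_pow_self (by omega)).trans_le (Nat.pow_le_pow_right (by omega) h)
  exact_mod_cast this

lemma evk_ne_zero {q : ℕ} (hq : 2 ≤ q) (u : Polynomial (Polynomial k)) (hu : u ≠ 0) :
    ∃ κ0, ∀ κ ≥ κ0, evk q κ u ≠ 0 := by
  obtain ⟨v, hv, hX⟩ := Polynomial.exists_eq_pow_rootMultiplicity_mul_and_not_dvd u hu 0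
  rw [map_zero, sub_zero] at hv hX
  rw [Polynomial.X_dvd_iff] at hX
  obtain ⟨c, hc⟩ := og_evk_sub q v
  obtain ⟨κ0, h0⟩ := large_pow hq c
  refine ⟨κ0, fun κ hκ h => ?_⟩
  rw [hv, map_mul, map_pow, evk_X] at h
  have h1 : evk q κ v = 0 := by
    refine (mul_eq_zero.1 h).resolve_left (pow_ne_zero _ ?_)
    simp
  have h2 := hc κ
  rw [h1, zero_sub] at h2
  have h3 := og_mono (og_neg h2) (by have := h0 κ hκ; omega : (1 : ℤ) ≤ _)
  rw [neg_neg] at h3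
  exact hX (pe_zero_of_og h3)

lemma th_evk (q : ℕ) {n : ℕ} (u : Polynomial (Polynomial k)) (hu : u.natDegree ≤ n) (κ : ℕ) :
    ∃ p, th ^ (n * q ^ κ) * evk q κ u = pe p := by
  refine ⟨∑ i ∈ Finset.range (n + 1), u.coeff i * Polynomial.X ^ ((n - i) * q ^ κ), ?_⟩
  rw [evk, Polynomial.coe_eval₂RingHom, Polynomial.eval₂_eq_sum_range' _ (Nat.lt_succ_of_le hu),
    map_sum, Finset.mul_sum]
  refine Finset.sum_congr rfl fun i hi => ?_
  rw [Finset.mem_range] at hi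
  rw [map_mul, map_pow, pe_X, yy_pow]
  have : n * q ^ κ = (n - i) * q ^ κ + i * q ^ κ := by
    rw [← Nat.add_mul]; congr 1; omega
  rw [this, pow_add]
  have := th_yy (k := k) (i * q ^ κ)
  linear_combination (th ^ ((n - i) * q ^ κ) * pe (u.coeff i)) * this

/-- rational power series with their evaluations -/
def RatEv (q : ℕ) (G : PowerSeries (Polynomial k)) (v : ℕ → LaurentSeries k) : Prop :=
  ∃ D P : Polynomial (Polynomial k), D.coeff 0 = 1 ∧ (D : PowerSeries (Polynomial k)) * G = P ∧
    ∀ κ, evk q κ D * v κ = evk q κ P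

lemma RatEv.add {q : ℕ} {G G' : PowerSeries (Polynomial k)} {v v' : ℕ → LaurentSeries k}
    (h : RatEv q G v) (h' : RatEv q G' v') : RatEv q (G + G') fun κ => v κ + v' κ := by
  obtain ⟨D, P, h1, h2, h3⟩ := h
  obtain ⟨D', P', h1', h2', h3'⟩ := h'
  refine ⟨D * D', P * D' + P' * D, by simp [Polynomial.mul_coeff_zero, h1, h1'], ?_, fun κ => ?_⟩
  · simp only [Polynomial.coe_mul, Polynomial.coe_add, ← h2, ← h2']; ring
  · simp only [map_mul, map_add, ← h3, ← h3']; ring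

lemma RatEv.mul {q : ℕ} {G G' : PowerSeries (Polynomial k)} {v v' : ℕ → LaurentSeries k}
    (h : RatEv q G v) (h' : RatEv q G' v') : RatEv q (G * G') fun κ => v κ * v' κ := by
  obtain ⟨D, P, h1, h2, h3⟩ := h
  obtain ⟨D', P', h1', h2', h3'⟩ := h'
  refine ⟨D * D', P * P', by simp [Polynomial.mul_coeff_zero, h1, h1'], ?_, fun κ => ?_⟩
  · simp only [Polynomial.coe_mul, ← h2, ← h2']; ring
  · simp only [map_mul, ← h3, ← h3']; ring

lemma RatEv.poly (q : ℕ) (p : Polynomial (Polynomial k)) : RatEv q (p : PowerSeries (Polynomial k))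
    fun κ => evk q κ p :=
  ⟨1, p, by simp, by simp, by simp⟩

lemma RatEv.one (q : ℕ) : RatEv q (1 : PowerSeries (Polynomial k)) fun _ => 1 :=
  ⟨1, 1, by simp, by simp, by simp⟩

lemma RatEv.zero (q : ℕ) : RatEv q (0 : PowerSeries (Polynomial k)) fun _ => 0 :=
  ⟨1, 0, by simp, by simp, by simp⟩

lemma RatEv.pow {q : ℕ} {G : PowerSeries (Polynomial k)} {v : ℕ → LaurentSeries k}
    (h : RatEv q G v) (n : ℕ) : RatEv q (G ^ n) fun κ => v κ ^ n := by
  induction n with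
  | zero => simpa using RatEv.one q
  | succ n ih => simpa only [pow_succ] using ih.mul h

lemma RatEv.prodr {q : ℕ} {G : ℕ → PowerSeries (Polynomial k)} {v : ℕ → ℕ → LaurentSeries k}
    (h : ∀ j, RatEv q (G j) (v j)) (n : ℕ) :
    RatEv q (∏ j ∈ Finset.range n, G j) fun κ => ∏ j ∈ Finset.range n, v j κ := by
  induction n with
  | zero => simpa using RatEv.one q
  | succ n ih => simpa only [Finset.prod_range_succ] using ih.mul (h n)

lemma RatEv.sumr {q : ℕ} {G : ℕ → PowerSeries (Polynomial k)} {v : ℕ → ℕ → LaurentSeries k}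
    (h : ∀ j, RatEv q (G j) (v j)) (n : ℕ) :
    RatEv q (∑ j ∈ Finset.range n, G j) fun κ => ∑ j ∈ Finset.range n, v j κ := by
  induction n with
  | zero => simpa using RatEv.zero q
  | succ n ih => simpa only [Finset.sum_range_succ] using ih.add (h n)

variable {q : ℕ} (ev : E → k)

lemma RatEv_GG (hq : 2 ≤ q) (j : ℕ) : RatEv q (GG q (j + 1)) fun κ => gq (q ^ (κ + j + 1)) (k := k) := by
  refine ⟨1 - Polynomial.C Polynomial.X * Polynomial.X ^ q ^ (j + 1), -(Polynomial.X ^ q ^ (j + 1)), ?_, ?_, ?_⟩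
  · have : q ≠ 0 := by omega
    simp [Polynomial.mul_coeff_zero, this, (pow_ne_zero (j + 1) this).symm]
  · have := GG_spec (k := k) hq (j + 1)
    simpa using this
  · intro κ
    have := gq_mul' (k := k) (two_le_qpow hq (κ + j))
    simp only [map_sub, map_mul, map_one, map_pow, map_neg, evk_X, evk_C, pe_X, yy_pow]
    have h2 : q ^ (j + 1) * q ^ κ = q ^ (κ + j + 1) := by ring
    rw [h2]; exact this

lemma RatEv_psi (hq : 2 ≤ q) (a : ℕ × E) (d : ℕ) : RatEv q (psi q ev a d) fun κ => phik q ev κ a d := by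
  refine RatEv.mul (RatEv.pow ?_ d) (RatEv.pow (RatEv.prodr (RatEv_GG hq) d) a.1)
  have := RatEv.poly q (Polynomial.C (Polynomial.C (ev a.2)))
  simpa using this

lemma RatEv_isum (hq : 2 ≤ q) (l : List (ℕ × E)) (m : ℕ) :
    RatEv q (isum (psi q ev) l m) fun κ => isum (phik q ev κ) l m := by
  induction l generalizing m with
  | nil => exact RatEv.one q
  | cons a l ih => exact RatEv.sumr (fun d => (RatEv_psi ev hq a d).mul (ih d)) m

lemma approx (hq : 2 ≤ q) (B : List (ℕ × E)) (hB : ∀ a ∈ B, 0 < a.1)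
    (u p : Polynomial (Polynomial k)) (M : ℕ) (hM : M ≠ 0)
    (h : PowerSeries.X ^ M ∣ (u : PowerSeries (Polynomial k)) * FF q ev B - (p : PowerSeries (Polynomial k))) :
    ∃ c κ0 : ℕ, ∀ κ ≥ κ0, og (M * (q : ℤ) ^ κ - c) (evk q κ u * Lik q ev κ B - evk q κ p) := by
  obtain ⟨D, P, h1, h2, h3⟩ := RatEv_isum ev hq B M
  have h4 : PowerSeries.X ^ M ∣ ((u * P - p * D : Polynomial (Polynomial k)) : PowerSeries (Polynomial k)) := by
    have h5 := dvd_sub h ((FF_spec ev hq B hB M).mul_left (u : PowerSeries (Polynomial k)))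
    have h6 := h5.mul_left (D : PowerSeries (Polynomial k))
    convert h6 using 1
    rw [Polynomial.coe_sub, Polynomial.coe_mul, Polynomial.coe_mul, ← h2]
    ring
  have h5 : Polynomial.X ^ M ∣ u * P - p * D := by
    rw [Polynomial.X_pow_dvd_iff]
    intro i hi
    have := PowerSeries.X_pow_dvd_iff.1 h4 i hi
    rwa [Polynomial.coeff_coe] at this
  obtain ⟨r, hr⟩ := h5
  obtain ⟨c1, hc1⟩ := og_evk q r
  obtain ⟨c2, hc2⟩ := og_evk q u
  obtain ⟨c3, hc3⟩ := og_evk_sub q D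
  obtain ⟨κ0, h0⟩ := large_pow hq c3
  refine ⟨c1 + c2, κ0, fun κ hκ => ?_⟩
  have e1 : evk q κ u * Lik q ev κ B - evk q κ p =
      evk q κ u * (Lik q ev κ B - isum (phik q ev κ) B M) +
      (evk q κ u * isum (phik q ev κ) B M - evk q κ p) := by ring
  rw [e1]
  refine og_add ?_ ?_
  · refine og_mono (og_mul (hc2 κ) (Lik_spec' ev hq κ B hB M hM)) ?_
    have : M * q ^ κ ≤ q ^ (κ + M) := by
      rw [pow_add, mul_comm]
      exact Nat.mul_le_mul_left _ (Nat.lt_pow_self (by omega)).le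
    have : (M : ℤ) * (q : ℤ) ^ κ ≤ (q : ℤ) ^ (κ + M) := by exact_mod_cast this
    push_cast
    linarith
  · refine og_of_unit (u := evk q κ D - 1) (z := evk q κ (Polynomial.X ^ M * r)) ?_ ?_ ?_
    · have := hc3 κ
      rw [h1, map_one] at this
      exact og_mono this (by have := h0 κ hκ; omega)
    · rw [map_mul, map_pow, evk_X, yy_pow]
      refine og_mono (og_mul (og_single le_rfl _) (hc1 κ)) ?_
      push_cast
      linarith
    · rw [← hr, map_sub, map_mul, map_mul, ← h3]
      ring

end lift

section lift2

lemma dual_clear {R ι : Type*} [CommRing R] [IsDomain R] [Fintype ι] [DecidableEq ι] (P : Submodule R (ι → R)) (i0 : ι)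
    (h : ∀ Δ : R, Δ ≠ 0 → Pi.single i0 Δ ∉ P) :
    ∃ r : ι → R, r i0 ≠ 0 ∧ ∀ u ∈ P, ∑ i, r i * u i = 0 := by
  let L := FractionRing R
  let Z : Submodule L (ι → L) :=
    { carrier := {v | ∃ Δ : R, Δ ≠ 0 ∧ ∃ u ∈ P, ∀ i, algebraMap R L (u i) = algebraMap R L Δ * v i}
      zero_mem' := ⟨1, one_ne_zero, 0, P.zero_mem, by simp⟩
      add_mem' := by
        rintro v v' ⟨Δ, hΔ, u, hu, h1⟩ ⟨Δ', hΔ', u', hu', h1'⟩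
        refine ⟨Δ * Δ', mul_ne_zero hΔ hΔ', Δ' • u + Δ • u',
          P.add_mem (P.smul_mem _ hu) (P.smul_mem _ hu'), fun i => ?_⟩
        simp only [Pi.add_apply, Pi.smul_apply, smul_eq_mul, map_add, map_mul, h1, h1']
        ring
      smul_mem' := by
        rintro c v ⟨Δ, hΔ, u, hu, h1⟩
        obtain ⟨a, b, hb, rfl⟩ := IsFractionRing.div_surjective (A := R) c
        have hb0 : b ≠ 0 := nonZeroDivisors.ne_zero hb
        refine ⟨b * Δ, mul_ne_zero hb0 hΔ, a • u, P.smul_mem _ hu, fun i => ?_⟩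
        have hb1 : algebraMap R L b ≠ 0 := by
          simpa using hb0
        simp only [Pi.smul_apply, smul_eq_mul, map_mul, h1]
        rw [div_mul_eq_mul_div, mul_div_assoc', eq_div_iff hb1]; ring }
  have hZ : (Pi.single i0 1 : ι → L) ∉ Z := by
    rintro ⟨Δ, hΔ, u, hu, h1⟩
    apply h Δ hΔ
    convert hu using 1
    funext i
    apply IsFractionRing.injective R L
    rw [h1]
    by_cases hi : i = i0
    · subst hi; simp
    · simp [hi]
  obtain ⟨f, hf, hf2⟩ := Submodule.exists_dual_map_eq_bot_of_notMem hZ inferInstance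
  obtain ⟨b, hb⟩ := IsLocalization.exist_integer_multiples_of_finite (nonZeroDivisors R)
    (fun i => f (Pi.single i 1))
  choose r hr using hb
  have hb1 : algebraMap R L b ≠ 0 := by
    simpa using nonZeroDivisors.ne_zero b.2
  refine ⟨r, fun h0 => ?_, fun u hu => ?_⟩
  · have := hr i0
    rw [h0, map_zero, Algebra.smul_def] at this
    exact hf ((mul_eq_zero.1 this.symm).resolve_left hb1)
  · have h3 : f (fun i => algebraMap R L (u i)) = 0 := by
      have : (fun i => algebraMap R L (u i)) ∈ Z := ⟨1, one_ne_zero, u, hu, by simp⟩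
      have := Submodule.mem_map_of_mem (f := f) this
      rw [hf2] at this
      exact this
    apply IsFractionRing.injective R L
    rw [map_sum, map_zero]
    rw [f.pi_apply_eq_sum_univ] at h3
    have h4 : ∀ i, algebraMap R L (r i * u i) = algebraMap R L b * (algebraMap R L (u i) • f (Pi.single i 1)) := by
      intro i
      rw [map_mul, hr, Algebra.smul_def, smul_eq_mul]; ring
    simp only [h4, ← Finset.mul_sum]
    rw [mul_eq_zero]; right
    convert h3 using 4 with i
    funext j
    simp [Pi.single_apply, eq_comm]

lemma siegel {R ι : Type*} [CommRing R] [IsDomain R] [Fintype ι] (F : ι → PowerSeries R) (b E : ℕ) :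
    ∃ u : Polynomial R, u ≠ 0 ∧ u.natDegree ≤ Fintype.card ι * b ∧ ∀ i, ∃ p : Polynomial R,
      p.natDegree ≤ E ∧ PowerSeries.X ^ (E + b + 1) ∣ (u : PowerSeries R) * F i - (p : PowerSeries R) := by
  set D := Fintype.card ι * b with hD
  let T : Polynomial R →ₗ[R] (ι × Fin b → R) :=
    LinearMap.pi fun x => (PowerSeries.coeff (E + 1 + x.2)).comp
      ((LinearMap.mulRight R (F x.1)).comp (Polynomial.coeToPowerSeries.algHom R).toLinearMap)
  have hT : ∀ (u : Polynomial R) x, T u x = PowerSeries.coeff (E + 1 + x.2) ((u : PowerSeries R) * F x.1) := by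
    intro u x
    simp [T]
  let T' := T.comp ((Polynomial.degreeLT R (D + 1)).subtype.comp
    (Polynomial.degreeLTEquiv R (D + 1)).symm.toLinearMap)
  have hni : ¬ Function.Injective T' := by
    intro h
    have := card_le_of_injective R T' h
    simp [← hD] at this
  rw [← LinearMap.ker_eq_bot, LinearMap.ker_eq_bot'] at hni
  push Not at hni
  obtain ⟨c, hc, hc0⟩ := hni
  set v := (Polynomial.degreeLTEquiv R (D + 1)).symm c with hv
  have hv0 : v ≠ 0 := by
    rw [hv]; simpa using hc0
  have hv1 : (v : Polynomial R) ≠ 0 := by simpa using hv0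
  refine ⟨v, hv1, ?_, fun i => ⟨PowerSeries.trunc (E + 1) ((v : Polynomial R) * F i), ?_, ?_⟩⟩
  · have := Polynomial.mem_degreeLT.1 v.2
    rw [Polynomial.degree_eq_natDegree hv1] at this
    have : (v : Polynomial R).natDegree < D + 1 := by exact_mod_cast this
    omega
  · exact Nat.lt_succ_iff.1 (PowerSeries.natDegree_trunc_lt _ _)
  · rw [PowerSeries.X_pow_dvd_iff]
    intro m hm
    rw [map_sub, Polynomial.coeff_coe, PowerSeries.coeff_trunc]
    split_ifs with h1
    · simp
    · have h2 := congrFun hc (i, ⟨m - (E + 1), by omega⟩)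
      have h3 : T' c = T v := rfl
      rw [h3, hT] at h2
      simp only at h2
      rw [show E + 1 + (m - (E + 1)) = m by omega] at h2
      rw [h2]; simp

variable {k E : Type*} [Field k] {q : ℕ} (ev : E → k)

/-- the iterated coefficients -/
def UU (q : ℕ) (ev : E → k) (I : Finset (List (ℕ × E))) (w : ℕ) (a : List (ℕ × E) → Polynomial k) :
    ℕ → List (ℕ × E) → Polynomial k
  | 0 => a
  | κ + 1 => fun B => Polynomial.C (chi ev B) * (Polynomial.X - Polynomial.X ^ q ^ (κ + 1)) ^ (w - lwt B) *
      (UU q ev I w a κ B + ∑ C ∈ chd I B, UU q ev I w a κ C)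

lemma UU_rel (hq : 2 ≤ q) (I : Finset (List (ℕ × E))) (hI : ∀ B a, B ++ [a] ∈ I → B ∈ I)
    (hpos : ∀ B ∈ I, ∀ a ∈ B, 0 < a.1) (w : ℕ) (hw : ∀ B ∈ I, lwt B ≤ w)
    (a : List (ℕ × E) → Polynomial k)
    (h : ∑ B ∈ I, pe (a B) * Lik q ev 0 B = 0) (κ : ℕ) :
    ∑ B ∈ I, pe (UU q ev I w a κ B) * Lik q ev κ B = 0 := by
  induction κ with
  | zero => exact h
  | succ κ ih =>
    set g : LaurentSeries k := th - th ^ q ^ (κ + 1)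
    set G : LaurentSeries k := gq (q ^ (κ + 1))
    have hg : g * G = 1 := gq_mul (two_le_qpow hq κ)
    let c : List (ℕ × E) → LaurentSeries k := fun B => HahnSeries.C (chi ev B) * G ^ lwt B * Lik q ev (κ + 1) B
    have h1 : ∀ B ∈ I, pe (UU q ev I w a κ B) * Lik q ev κ B = pe (UU q ev I w a κ B) * c B +
        if B = [] then 0 else pe (UU q ev I w a κ B) * c B.dropLast := by
      intro B hB
      rw [Lik_fun ev hq κ B (hpos B hB), mul_add]
      congr 1
      split_ifs <;> simp [c, G]
    rw [Finset.sum_congr rfl h1, Finset.sum_add_distrib,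
      sum_chd I hI (fun B C => if B = [] then 0 else pe (UU q ev I w a κ B) * c C) (by simp)] at ih
    have h2 : ∀ B ∈ I, pe (UU q ev I w a (κ + 1) B) * Lik q ev (κ + 1) B = g ^ w *
      (pe (UU q ev I w a κ B) * c B + ∑ C ∈ chd I B, if C = [] then 0 else pe (UU q ev I w a κ C) * c B) := by
      intro B hB
      have h3 : ∀ C ∈ chd I B, (if C = [] then 0 else pe (UU q ev I w a κ C) * c B) = pe (UU q ev I w a κ C) * c B := by
        intro C hC
        obtain ⟨_, a, rfl⟩ := mem_chd.1 hC
        simp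
      rw [Finset.sum_congr rfl h3, ← Finset.sum_mul, ← add_mul]
      simp only [UU, map_mul, map_add, map_sum, map_pow, map_sub, pe_X, pe_C, c]
      have h4 : g ^ w * G ^ lwt B = g ^ (w - lwt B) := by
        conv_lhs => rw [show w = (w - lwt B) + lwt B from (Nat.sub_add_cancel (hw B hB)).symm, pow_add,
          mul_assoc, ← mul_pow, hg]
        simp
      rw [← h4]; ring
    rw [Finset.sum_congr rfl h2, ← Finset.mul_sum, Finset.sum_add_distrib, ih, mul_zero]

lemma UU_deg (hq : 2 ≤ q) (I : Finset (List (ℕ × E))) (w c : ℕ)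
    (a : List (ℕ × E) → Polynomial k) (h : ∀ B, (a B).natDegree ≤ c) (κ : ℕ) :
    ∀ B, (UU q ev I w a κ B).natDegree ≤ c + 2 * w * q ^ κ := by
  induction κ with
  | zero => exact fun B => (h B).trans (by omega)
  | succ κ ih =>
    intro B
    simp only [UU]
    have h1 : (Polynomial.X - Polynomial.X ^ q ^ (κ + 1) : Polynomial k).natDegree ≤ q ^ (κ + 1) := by
      refine (Polynomial.natDegree_sub_le _ _).trans ?_
      have := two_le_qpow hq κ
      simp; omega
    have h2 : (UU q ev I w a κ B + ∑ C ∈ chd I B, UU q ev I w a κ C).natDegree ≤ c + 2 * w * q ^ κ :=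
      (Polynomial.natDegree_add_le _ _).trans (max_le (ih B)
        (Polynomial.natDegree_sum_le_of_forall_le _ _ fun C _ => ih C))
    refine Polynomial.natDegree_mul_le.trans ((add_le_add ((Polynomial.natDegree_C_mul_le _ _).trans
      (Polynomial.natDegree_pow_le_of_le _ h1)) h2).trans ?_)
    have h3 : (w - lwt B) * q ^ (κ + 1) ≤ w * q ^ (κ + 1) := Nat.mul_le_mul_right _ (Nat.sub_le _ _)
    have h4 : 2 * q ^ κ ≤ q ^ (κ + 1) := by rw [pow_succ, mul_comm]; exact Nat.mul_le_mul_left _ hq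
    nlinarith

lemma UU_top (I : Finset (List (ℕ × E))) 
    (hpos : ∀ B ∈ I, ∀ a ∈ B, 0 < a.1) (w : ℕ) (hw : ∀ B ∈ I, lwt B ≤ w)
    (a : List (ℕ × E) → Polynomial k) (A : List (ℕ × E)) (hA : lwt A = w) (κ : ℕ) :
    UU q ev I w a κ A = Polynomial.C (chi ev A) ^ κ * a A := by
  have hc : chd I A = ∅ := by
    rw [Finset.eq_empty_iff_forall_notMem]
    intro C hC
    obtain ⟨hC, b, rfl⟩ := mem_chd.1 hC
    have h1 := hw _ hC
    have h2 := hpos _ hC b (by simp)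
    rw [lwt_append, lwt_single] at h1
    omega
  induction κ with
  | zero => simp [UU]
  | succ κ ih => simp only [UU, hc, ih, hA]; simp; ring

lemma chi_ne_zero (hev0 : ∀ a, ev a ≠ 0) (A : List (ℕ × E)) : chi ev A ≠ 0 := by
  simp [chi, List.prod_eq_zero_iff, hev0]

theorem lift_thm (hq : 2 ≤ q) (hev : Function.Injective ev) (hev0 : ∀ a, ev a ≠ 0)
    (I : Finset (List (ℕ × E))) (hP : ∀ B ∈ I, ∀ a ∈ B, 0 < a.1 ∧ ¬ q ∣ a.1)
    (hI : ∀ B a, B ++ [a] ∈ I → B ∈ I) (w : ℕ) (hw : ∀ B ∈ I, lwt B ≤ w)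
    (a : List (ℕ × E) → Polynomial k) (ha : ∀ B ∉ I, a B = 0)
    (h : ∑ B ∈ I, pe (a B) * Lik q ev 0 B = 0) (A : List (ℕ × E)) (hAI : A ∈ I) (hA : lwt A = w) :
    a A = 0 := by
  by_contra haA
  have hpos : ∀ B ∈ I, ∀ a ∈ B, 0 < a.1 := fun B hB a ha => (hP B hB a ha).1
  set V : ℕ → List (ℕ × E) → Polynomial k := UU q ev I w a with hV
  let P : Submodule (Polynomial (Polynomial k)) (I → Polynomial (Polynomial k)) :=
    { carrier := {u | ∃ κ0, ∀ κ ≥ κ0, ∑ B : I, pe (V κ B) * evk q κ (u B) = 0}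
      zero_mem' := ⟨0, by simp⟩
      add_mem' := by
        rintro u u' ⟨n, hn⟩ ⟨n', hn'⟩
        refine ⟨max n n', fun κ hκ => ?_⟩
        simp only [Pi.add_apply, map_add, mul_add, Finset.sum_add_distrib,
          hn κ (le_of_max_le_left hκ), hn' κ (le_of_max_le_right hκ), add_zero]
      smul_mem' := by
        rintro c u ⟨n, hn⟩
        refine ⟨n, fun κ hκ => ?_⟩
        simp only [Pi.smul_apply, smul_eq_mul, map_mul, mul_left_comm _ (evk q κ c), ← Finset.mul_sum,
          hn κ hκ, mul_zero] }
  obtain ⟨c0, hc0⟩ : ∃ c, ∀ B, (a B).natDegree ≤ c := by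
    refine ⟨I.sup fun B => (a B).natDegree, fun B => ?_⟩
    by_cases hB : B ∈ I
    · exact Finset.le_sup (f := fun B => (a B).natDegree) hB
    · simp [ha B hB]
  have hdeg := UU_deg ev hq I w c0 a hc0
  have hrel := UU_rel ev hq I hI hpos w hw a h
  obtain ⟨r, hr0, hr⟩ := dual_clear P ⟨A, hAI⟩ (by
    rintro Δ hΔ ⟨κ0, h1⟩
    obtain ⟨κ1, h2⟩ := evk_ne_zero hq Δ hΔ
    have h3 := h1 (max κ0 κ1) (le_max_left _ _)
    rw [Finset.sum_eq_single ⟨A, hAI⟩ (by intro b _ hb; simp [hb]) (by simp)] at h3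
    rw [Pi.single_eq_same, mul_eq_zero] at h3
    rcases h3 with h3 | h3
    · rw [hV, UU_top ev I hpos w hw a A hA, map_mul, map_pow, pe_C, mul_eq_zero] at h3
      rcases h3 with h3 | h3
      · simp [chi_ne_zero ev hev0] at h3
      · exact haA (pe_zero_of_og (by rw [h3]; exact og_zero _))
    · exact h2 _ (le_max_right _ _) h3)
  have key : ∀ E0 : ℕ, ∃ u : Polynomial (Polynomial k), u ≠ 0 ∧ u.natDegree ≤ Fintype.card I * (2 * w) ∧
      PowerSeries.X ^ (E0 + 1) ∣ (u : PowerSeries (Polynomial k)) * ∑ B : I, (r B : PowerSeries (Polynomial k)) * FF q ev B := by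
    intro E0
    obtain ⟨u, hu0, hu1, hu2⟩ := siegel (fun B : I => FF q ev B) (2 * w) E0
    choose p hp1 hp2 using hu2
    refine ⟨u, hu0, hu1, ?_⟩
    have hpP : p ∈ P := by
      have h5 := fun B : I => approx ev hq B (hpos B B.2) u (p B) _ (by omega) (hp2 B)
      choose c κ0 h5 using h5
      obtain ⟨κ1, hκ1⟩ := large_pow hq (c0 + ∑ B, c B)
      refine ⟨κ1 + ∑ B, κ0 B, fun κ hκ => ?_⟩
      have hκ2 : ∀ B, κ0 B ≤ κ := fun B =>
        (Finset.single_le_sum (f := κ0) (fun _ _ => Nat.zero_le _) (Finset.mem_univ B)).trans (by omega)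
      have hcB : ∀ B, c B ≤ ∑ B, c B := fun B =>
        (Finset.single_le_sum (f := c) (fun _ _ => Nat.zero_le _) (Finset.mem_univ B))
      have h6 : ∀ B : I, ∃ s, th ^ (E0 * q ^ κ) * evk q κ (p B) = pe s := fun B => th_evk q (p B) (hp1 B) κ
      choose s hs using h6
      have h7 : th ^ (E0 * q ^ κ) * ∑ B : I, pe (V κ B) * evk q κ (p B) = pe (∑ B : I, V κ B * s B) := by
        rw [Finset.mul_sum, map_sum]
        refine Finset.sum_congr rfl fun B _ => ?_
        rw [map_mul, ← hs]; ring
      have h8 : ∑ B : I, pe (V κ B) * Lik q ev κ B = 0 := by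
        rw [Finset.sum_coe_sort I fun B => pe (V κ B) * Lik q ev κ B]; exact hrel κ
      have h9 : th ^ (E0 * q ^ κ) * ∑ B : I, pe (V κ B) * evk q κ (p B) =
          ∑ B : I, -(th ^ (E0 * q ^ κ) * (pe (V κ B) * (evk q κ u * Lik q ev κ B - evk q κ (p B)))) := by
        rw [Finset.sum_neg_distrib, ← Finset.mul_sum]
        simp only [mul_sub, Finset.sum_sub_distrib, mul_left_comm _ (evk q κ u), ← Finset.mul_sum, h8]
        ring
      have h10 : og 1 (pe (∑ B : I, V κ B * s B)) := by
        rw [← h7, h9]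
        refine og_sum _ fun B _ => og_neg ?_
        refine og_mono (og_mul (og_th_pow _) (og_mul (og_mono (og_pe _) (?_ : -((c0 + 2 * w * q ^ κ : ℕ) : ℤ) ≤ _)) (h5 B κ (hκ2 B)))) ?_
        · have := hdeg κ B
          rw [← hV] at this
          omega
        · have e1 := hκ1 κ (by omega)
          have e2 := hcB B
          push_cast at e1 ⊢
          have e2' : (c B : ℤ) ≤ ∑ B, (c B : ℤ) := by exact_mod_cast e2
          nlinarith
      have h11 := pe_zero_of_og h10
      rw [h11, map_zero] at h7
      refine (mul_eq_zero.1 h7).resolve_left (pow_ne_zero _ ?_)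
      simp [th]
    have h12 := hr p hpP
    have h13 : (u : PowerSeries (Polynomial k)) * ∑ B : I, (r B : PowerSeries (Polynomial k)) * FF q ev B =
        ∑ B : I, (r B : PowerSeries (Polynomial k)) * ((u : PowerSeries (Polynomial k)) * FF q ev B - (p B : PowerSeries (Polynomial k))) := by
      have h14 := congrArg (Polynomial.coeToPowerSeries.ringHom (R := Polynomial k)) h12
      rw [map_sum, map_zero] at h14
      simp only [map_mul, Polynomial.coeToPowerSeries.ringHom_apply] at h14
      simp only [mul_sub, Finset.sum_sub_distrib, h14, Finset.mul_sum, sub_zero]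
      exact Finset.sum_congr rfl fun B _ => by ring
    rw [h13]
    exact Finset.dvd_sum fun B _ => ((pow_dvd_pow _ (by omega)).trans (hp2 B)).mul_left _
  have hzero : ∑ B : I, (r B : PowerSeries (Polynomial k)) * FF q ev B = 0 := by
    by_contra hne
    set S := ∑ B : I, (r B : PowerSeries (Polynomial k)) * FF q ev B
    obtain ⟨m, hm⟩ : ∃ m, PowerSeries.coeff m S ≠ 0 := by
      by_contra hh; push Not at hh; exact hne (PowerSeries.ext hh)
    obtain ⟨u, hu0, hu1, hu2⟩ := key (m + Fintype.card I * (2 * w))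
    have hu3 : (u : PowerSeries (Polynomial k)) ≠ 0 := by simpa using hu0
    replace hu2 := PowerSeries.le_order _ ((m + Fintype.card I * (2 * w) + 1 : ℕ) : ℕ∞) fun i hi => PowerSeries.X_pow_dvd_iff.1 hu2 i (by exact_mod_cast hi)
    rw [PowerSeries.order_mul] at hu2
    have o1 := PowerSeries.order_le m hm
    have o2 : (u : PowerSeries (Polynomial k)).order ≤ u.natDegree := by
      refine PowerSeries.order_le _ ?_
      rw [Polynomial.coeff_coe]; simpa using hu0
    have := hu2.trans (add_le_add o2 o1)
    have : m + Fintype.card I * (2 * w) + 1 ≤ u.natDegree + m := by exact_mod_cast this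
    omega
  let r' : List (ℕ × E) → Polynomial (Polynomial k) := fun B => if hB : B ∈ I then r ⟨B, hB⟩ else 0
  have := FF_indep ev hq hev hev0 I hP hI r' (fun B hB => by simp [r', hB]) (by
    rw [← Finset.sum_coe_sort I, ← hzero]
    refine Finset.sum_congr rfl fun B _ => ?_
    simp [r']) A
  simp only [r', hAI, dif_pos] at this
  exact hr0 this

end lift2

section linind
variable {k E : Type*} [Field k] {q : ℕ} (ev : E → k)

/-- good words of weight `w` -/
def good (E : Type*) (q w : ℕ) : Set (List (ℕ × E)) := {l | (∀ a ∈ l, 0 < a.1 ∧ ¬ q ∣ a.1) ∧ lwt l = w}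

/-- elements represented by rational functions -/
def isRat (x : LaurentSeries k) : Prop := ∃ p r : Polynomial k, pe r ≠ 0 ∧ x * pe r = pe p

lemma Lik_linInd (hq : 2 ≤ q) (hev : Function.Injective ev) (hev0 : ∀ a, ev a ≠ 0) (w : ℕ)
    (F : Subfield (LaurentSeries k)) (hF : ∀ x ∈ F, isRat x) :
    LinearIndependent F (fun B : good E q w => Lik q ev 0 B.1) := by
  rw [linearIndependent_iff']
  intro s g hg i hi
  choose p r hr hpr using fun B : good E q w => hF (g B) (g B).2
  let a : List (ℕ × E) → Polynomial k := fun B => if hB : B ∈ good E q w then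
    if (⟨B, hB⟩ : good E q w) ∈ s then p ⟨B, hB⟩ * ∏ j ∈ s.erase ⟨B, hB⟩, r j else 0 else 0
  have haB : ∀ B ∈ s, a B.1 = p B * ∏ j ∈ s.erase B, r j := by
    intro B hB
    simp only [a, B.2, dif_pos, Subtype.coe_eta, hB, if_pos]
  let I : Finset (List (ℕ × E)) := s.biUnion fun B => B.1.inits.toFinset
  have hmem : ∀ B, B ∈ I ↔ ∃ C ∈ s, B <+: C.1 := by
    intro B; simp [I, -Subtype.exists]
  have h0 : a i.1 = 0 := by
    refine lift_thm ev hq hev hev0 I ?_ ?_ w ?_ a ?_ ?_ i.1 ?_ i.2.2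
    · intro B hB x hx
      obtain ⟨C, _, hC⟩ := (hmem B).1 hB
      exact C.2.1 x (hC.subset hx)
    · intro B x hB
      obtain ⟨C, hCs, hC⟩ := (hmem _).1 hB
      exact (hmem _).2 ⟨C, hCs, (List.prefix_append _ _).trans hC⟩
    · intro B hB
      obtain ⟨C, _, t, hC⟩ := (hmem B).1 hB
      have := C.2.2
      rw [← hC, lwt_append] at this
      omega
    · intro B hB
      simp only [a]
      split_ifs with h1 h2
      · exact absurd ((hmem B).2 ⟨_, h2, List.prefix_refl _⟩) hB
      · rfl
      · rfl
    · have e1 : ∑ B ∈ I, pe (a B) * Lik q ev 0 B = ∑ B ∈ s.map (Function.Embedding.subtype _), pe (a B) * Lik q ev 0 B := by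
        symm
        apply Finset.sum_subset
        · intro B hB
          rw [Finset.mem_map] at hB
          obtain ⟨C, hC, rfl⟩ := hB
          exact (hmem _).2 ⟨C, hC, List.prefix_refl _⟩
        · intro B _ hB
          have : a B = 0 := by
            simp only [a]
            split_ifs with h1 h2
            · exact absurd (Finset.mem_map.2 ⟨_, h2, rfl⟩) hB
            · rfl
            · rfl
          rw [this, map_zero, zero_mul]
      rw [e1, Finset.sum_map]
      have e2 : ∀ B ∈ s, pe (a B.1) * Lik q ev 0 B.1 = (∏ j ∈ s, pe (r j)) * (g B • Lik q ev 0 B.1) := by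
        intro B hB
        rw [haB B hB, map_mul, ← hpr, map_prod, Subfield.smul_def, smul_eq_mul,
          ← Finset.mul_prod_erase s _ hB]
        ring
      simp only [Function.Embedding.subtype_apply]
      rw [Finset.sum_congr rfl e2, ← Finset.mul_sum, hg, mul_zero]
    · exact (hmem _).2 ⟨i, hi, List.prefix_refl _⟩
  rw [haB i hi, mul_eq_zero] at h0
  have hr0 : ∀ j, r j ≠ 0 := fun j h => hr j (by rw [h, map_zero])
  have h1 : p i = 0 := h0.resolve_right (Finset.prod_ne_zero_iff.2 fun j _ => hr0 j)
  have h2 := hpr i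
  rw [h1, map_zero] at h2
  exact Subtype.ext ((mul_eq_zero.1 h2).resolve_right (hr i))

lemma isRat_closure (S : Set (LaurentSeries k)) (hS : ∀ x ∈ S, isRat x) (x : LaurentSeries k)
    (hx : x ∈ Subfield.closure S) : isRat x := by
  induction hx using Subfield.closure_induction with
  | mem x hx => exact hS x hx
  | one => exact ⟨1, 1, by simp, by simp⟩
  | add x y _ _ hx hy =>
    obtain ⟨p, r, hr, h⟩ := hx
    obtain ⟨p', r', hr', h'⟩ := hy
    refine ⟨p * r' + p' * r, r * r', by simp [hr, hr'], ?_⟩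
    simp only [map_mul, map_add, ← h, ← h']; ring
  | neg x _ hx =>
    obtain ⟨p, r, hr, h⟩ := hx
    exact ⟨-p, r, hr, by simp [← h]⟩
  | inv x _ hx =>
    obtain ⟨p, r, hr, h⟩ := hx
    by_cases hx0 : x = 0
    · exact ⟨0, 1, by simp, by simp [hx0]⟩
    · refine ⟨r, p, by rw [← h]; exact mul_ne_zero hx0 hr, ?_⟩
      rw [← h]; field_simp
  | mul x y _ _ hx hy =>
    obtain ⟨p, r, hr, h⟩ := hx
    obtain ⟨p', r', hr', h'⟩ := hy
    refine ⟨p * p', r * r', by simp [hr, hr'], ?_⟩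
    simp only [map_mul, ← h, ← h']; ring

end linind

lemma KNf_isRat (N : ℕ) (x : Kinf Fq) (hx : x ∈ KNf Fq N) : isRat x := by
  refine isRat_closure _ ?_ x hx
  rintro x (⟨c, _, rfl⟩ | rfl)
  · exact ⟨Polynomial.C c, 1, by simp, by simp [cst]⟩
  · exact ⟨Polynomial.X, 1, by simp, by simp [theta, th]⟩

section spans
set_option linter.unusedSectionVars false

/-- product of letters -/
def pmul {E : Type*} [Mul E] (a b : ℕ × E) : ℕ × E := (a.1 + b.1, a.2 * b.2)

lemma pmul_fst {E : Type*} [Mul E] (a b : ℕ × E) : (pmul a b).1 = a.1 + b.1 := rfl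

/-- positive words -/
def posw {E : Type*} (l : List (ℕ × E)) : Prop := ∀ a ∈ l, 0 < a.1

lemma posw_nil {E : Type*} : posw ([] : List (ℕ × E)) := by simp [posw]
lemma posw_cons {E : Type*} {a : ℕ × E} {l : List (ℕ × E)} : posw (a :: l) ↔ 0 < a.1 ∧ posw l := by simp [posw]
lemma posw_append {E : Type*} {l m : List (ℕ × E)} : posw (l ++ m) ↔ posw l ∧ posw m := by
  simp only [posw, List.mem_append]; exact ⟨fun h => ⟨fun a ha => h a (.inl ha), fun a ha => h a (.inr ha)⟩,
    fun h a ha => ha.elim (h.1 a) (h.2 a)⟩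

lemma lwt_pos {E : Type*} {l : List (ℕ × E)} (hl : posw l) (h0 : l ≠ []) : 0 < lwt l := by
  cases l with
  | nil => exact absurd rfl h0
  | cons a l => rw [lwt_cons]; have := (posw_cons.1 hl).1; omega

/-- summation operator -/
def sop (R0 : Type*) {K : Type*} [CommRing R0] [CommRing K] [Algebra R0 K] : (ℕ → K) →ₗ[R0] (ℕ → K) where
  toFun f m := ∑ d ∈ Finset.range m, f d
  map_add' f g := by funext m; simp [Finset.sum_add_distrib]
  map_smul' c f := by funext m; simp [Finset.smul_sum]

variable (R0 : Type*) {K E : Type*} [CommRing R0] [CommRing K] [Algebra R0 K] [CommGroup E] (φ : ℕ × E → ℕ → K)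

/-- one-layer sequences -/
def fsq (a : ℕ × E) (l : List (ℕ × E)) : ℕ → K := fun d => φ a d * isum φ l d

def SS (w : ℕ) : Submodule R0 (ℕ → K) := Submodule.span R0 {f | ∃ l, posw l ∧ lwt l = w ∧ f = isum φ l}
def DD (w : ℕ) : Submodule R0 (ℕ → K) :=
  Submodule.span R0 {f | ∃ a l, posw (a :: l) ∧ lwt (a :: l) = w ∧ f = fsq φ a l}
def DD2 (w : ℕ) : Submodule R0 (ℕ → K) :=
  Submodule.span R0 {f | ∃ a l, posw (a :: l) ∧ l ≠ [] ∧ lwt (a :: l) = w ∧ f = fsq φ a l}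

variable {R0 φ}

lemma sop_fsq (a : ℕ × E) (l) : sop R0 (fsq φ a l) = isum φ (a :: l) := by
  funext m; simp [sop, fsq, isum_cons]

lemma SS_mem {l : List (ℕ × E)} (h : posw l) : isum φ l ∈ SS R0 φ (lwt l) :=
  Submodule.subset_span ⟨l, h, rfl, rfl⟩
lemma DD_mem {a} {l : List (ℕ × E)} (h : posw (a :: l)) : fsq φ a l ∈ DD R0 φ (a.1 + lwt l) :=
  Submodule.subset_span ⟨a, l, h, lwt_cons a l, rfl⟩
lemma DD2_mem {a} {l : List (ℕ × E)} (h : posw (a :: l)) (h0 : l ≠ []) : fsq φ a l ∈ DD2 R0 φ (a.1 + lwt l) :=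
  Submodule.subset_span ⟨a, l, h, h0, lwt_cons a l, rfl⟩

lemma DD2_le (w : ℕ) : DD2 R0 φ w ≤ DD R0 φ w := by
  apply Submodule.span_mono
  rintro f ⟨a, l, h1, _, h2, h3⟩
  exact ⟨a, l, h1, h2, h3⟩

lemma one_mem_SS : (1 : ℕ → K) ∈ SS R0 φ 0 := by
  have := SS_mem (R0 := R0) (φ := φ) posw_nil
  rwa [lwt_nil] at this

lemma sop_DD {w : ℕ} {f : ℕ → K} (hf : f ∈ DD R0 φ w) : sop R0 f ∈ SS R0 φ w := by
  induction hf using Submodule.span_induction with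
  | mem f hf =>
    obtain ⟨a, l, h1, rfl, rfl⟩ := hf
    rw [sop_fsq]; exact SS_mem h1
  | zero => simp
  | add f g _ _ hf hg => rw [map_add]; exact Submodule.add_mem _ hf hg
  | smul c f _ hf => rw [map_smul]; exact Submodule.smul_mem _ _ hf

lemma phi_SS {v : ℕ} {f : ℕ → K} (hf : f ∈ SS R0 φ v) {a : ℕ × E} (ha : 0 < a.1) :
    φ a * f ∈ DD R0 φ (a.1 + v) := by
  induction hf using Submodule.span_induction with
  | mem f hf =>
    obtain ⟨l, h1, rfl, rfl⟩ := hf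
    exact DD_mem (posw_cons.2 ⟨ha, h1⟩)
  | zero => simp
  | add f g _ _ hf hg => rw [mul_add]; exact Submodule.add_mem _ hf hg
  | smul c f _ hf => rw [mul_smul_comm]; exact Submodule.smul_mem _ _ hf

lemma phi_SS2 {v : ℕ} (hv : 0 < v) {f : ℕ → K} (hf : f ∈ SS R0 φ v) {a : ℕ × E} (ha : 0 < a.1) :
    φ a * f ∈ DD2 R0 φ (a.1 + v) := by
  induction hf using Submodule.span_induction with
  | mem f hf =>
    obtain ⟨l, h1, rfl, rfl⟩ := hf
    refine DD2_mem (posw_cons.2 ⟨ha, h1⟩) ?_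
    rintro rfl; simp [lwt_nil] at hv
  | zero => simp
  | add f g _ _ hf hg => rw [mul_add]; exact Submodule.add_mem _ hf hg
  | smul c f _ hf => rw [mul_smul_comm]; exact Submodule.smul_mem _ _ hf

lemma sop_mul (f g : ℕ → K) : sop R0 f * sop R0 g = sop R0 (f * sop R0 g) + sop R0 (sop R0 f * g) + sop R0 (f * g) := by
  funext m
  simp only [sop, Pi.mul_apply, Pi.add_apply, LinearMap.coe_mk, AddHom.coe_mk]
  induction m with
  | zero => simp
  | succ m ih => simp only [Finset.sum_range_succ]; linear_combination ih

/-- bilinear span argument -/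
lemma span_mul {S T : Set (ℕ → K)} {P : Submodule R0 (ℕ → K)} (h : ∀ f ∈ S, ∀ g ∈ T, f * g ∈ P)
    {f g : ℕ → K} (hf : f ∈ Submodule.span R0 S) (hg : g ∈ Submodule.span R0 T) : f * g ∈ P := by
  have h1 := Submodule.mul_mem_mul hf hg
  rw [Submodule.span_mul_span] at h1
  refine Submodule.span_le.2 ?_ h1
  rintro _ ⟨f, hf, g, hg, rfl⟩
  exact h f hf g hg

section
variable (hφ : ∀ a b, φ (pmul a b) = φ a * φ b)
include hφ

lemma isum_mul_mem (n : ℕ) : ∀ l m : List (ℕ × E), l.length + m.length ≤ n → posw l → posw m →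
    isum φ l * isum φ m ∈ SS R0 φ (lwt l + lwt m) := by
  induction n with
  | zero =>
    intro l m h hl hm
    obtain rfl : l = [] := by rw [← List.length_eq_zero_iff]; omega
    obtain rfl : m = [] := by rw [← List.length_eq_zero_iff]; omega
    have := one_mem_SS (R0 := R0) (φ := φ)
    rw [lwt_nil]
    convert this using 1
    funext d; simp
  | succ n ih =>
    intro l m h hl hm
    rcases l with _ | ⟨a, l⟩
    · have : isum φ ([] : List (ℕ × E)) * isum φ m = isum φ m := by funext d; simp
      rw [this, lwt_nil, zero_add]; exact SS_mem hm
    rcases m with _ | ⟨b, m⟩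
    · have : isum φ (a :: l) * isum φ ([] : List (ℕ × E)) = isum φ (a :: l) := by funext d; simp
      rw [this, lwt_nil, add_zero]; exact SS_mem hl
    simp only [List.length_cons] at h
    have ⟨ha, hl'⟩ := posw_cons.1 hl
    have ⟨hb, hm'⟩ := posw_cons.1 hm
    rw [← sop_fsq (R0 := R0), ← sop_fsq (R0 := R0), sop_mul]
    refine Submodule.add_mem _ (Submodule.add_mem _ ?_ ?_) ?_
    · apply sop_DD
      have := phi_SS (ih l (b :: m) (by simp only [List.length_cons]; omega) hl' hm) ha
      rw [sop_fsq, lwt_cons, add_assoc]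
      convert this using 1
      funext d; simp [fsq, mul_assoc]
    · apply sop_DD
      have := phi_SS (ih (a :: l) m (by simp only [List.length_cons]; omega) hl hm') hb
      rw [sop_fsq, lwt_cons b, add_left_comm]
      convert this using 1
      funext d; simp [fsq, mul_left_comm]
    · apply sop_DD
      have := phi_SS (ih l m (by omega) hl' hm') (a := pmul a b) (by simp [pmul, ha])
      rw [hφ] at this
      simp only [pmul] at this
      rw [lwt_cons a, lwt_cons b, add_add_add_comm]
      convert this using 1
      funext d; simp only [fsq, Pi.mul_apply]; ring

lemma SS_mul {v w : ℕ} {f g : ℕ → K} (hf : f ∈ SS R0 φ v) (hg : g ∈ SS R0 φ w) : f * g ∈ SS R0 φ (v + w) := by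
  refine span_mul ?_ hf hg
  rintro _ ⟨l, hl, rfl, rfl⟩ _ ⟨m, hm, rfl, rfl⟩
  exact isum_mul_mem hφ _ l m le_rfl hl hm

lemma SS_pow {v : ℕ} {f : ℕ → K} (hf : f ∈ SS R0 φ v) (n : ℕ) : f ^ n ∈ SS R0 φ (n * v) := by
  induction n with
  | zero => simpa using one_mem_SS
  | succ n ih => rw [pow_succ, Nat.succ_mul]; exact SS_mul hφ ih hf

lemma DD_mul {v w : ℕ} {f g : ℕ → K} (hf : f ∈ DD R0 φ v) (hg : g ∈ DD R0 φ w) : f * g ∈ DD R0 φ (v + w) := by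
  refine span_mul ?_ hf hg
  rintro _ ⟨a, l, hl, rfl, rfl⟩ _ ⟨b, m, hm, rfl, rfl⟩
  have ⟨ha, hl'⟩ := posw_cons.1 hl
  have ⟨hb, hm'⟩ := posw_cons.1 hm
  have := phi_SS (SS_mul hφ (SS_mem (R0 := R0) hl') (SS_mem hm')) (a := pmul a b) (by simp [pmul, ha])
  rw [hφ] at this
  rw [pmul_fst] at this
  rw [lwt_cons a, lwt_cons b, add_add_add_comm]
  convert this using 1
  funext d; simp only [fsq, Pi.mul_apply]; ring

lemma DD_mul2 {v w : ℕ} {f g : ℕ → K} (hf : f ∈ DD R0 φ v) (hg : g ∈ DD2 R0 φ w) : f * g ∈ DD2 R0 φ (v + w) := by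
  refine span_mul ?_ hf hg
  rintro _ ⟨a, l, hl, rfl, rfl⟩ _ ⟨b, m, hm, h0, rfl, rfl⟩
  have ⟨ha, hl'⟩ := posw_cons.1 hl
  have ⟨hb, hm'⟩ := posw_cons.1 hm
  have := phi_SS2 (by have := lwt_pos hm' h0; omega)
    (SS_mul hφ (SS_mem (R0 := R0) hl') (SS_mem hm')) (a := pmul a b) (by simp [pmul, ha])
  rw [hφ] at this
  rw [pmul_fst] at this
  rw [lwt_cons a, lwt_cons b, add_add_add_comm]
  convert this using 1
  funext d; simp only [fsq, Pi.mul_apply]; ring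

lemma SS_mul_DD {v w : ℕ} {f g : ℕ → K} (hf : f ∈ SS R0 φ v) (hg : g ∈ DD R0 φ w) : f * g ∈ DD R0 φ (v + w) := by
  refine span_mul ?_ hf hg
  rintro _ ⟨l, hl, rfl, rfl⟩ _ ⟨b, m, hm, rfl, rfl⟩
  have ⟨hb, hm'⟩ := posw_cons.1 hm
  have := phi_SS (SS_mul hφ (SS_mem (R0 := R0) hl) (SS_mem hm')) hb
  rw [lwt_cons b, add_left_comm]
  convert this using 1
  funext d; simp only [fsq, Pi.mul_apply]; ring

lemma phi_DD {v : ℕ} {f : ℕ → K} (hf : f ∈ DD R0 φ v) (a : ℕ × E) :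
    φ a * f ∈ DD R0 φ (a.1 + v) := by
  induction hf using Submodule.span_induction with
  | mem f hf =>
    obtain ⟨b, l, h1, rfl, rfl⟩ := hf
    have ⟨hb, hl⟩ := posw_cons.1 h1
    have := DD_mem (R0 := R0) (φ := φ) (a := pmul a b) (posw_cons.2 ⟨by simp only [pmul]; omega, hl⟩)
    rw [pmul_fst] at this
    rw [lwt_cons, ← add_assoc]
    convert this using 1
    funext d; simp only [fsq, Pi.mul_apply, hφ]; ring
  | zero => simp
  | add f g _ _ hf hg => rw [mul_add]; exact Submodule.add_mem _ hf hg
  | smul c f _ hf => rw [mul_smul_comm]; exact Submodule.smul_mem _ _ hf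

lemma phi_DD2 {v : ℕ} {f : ℕ → K} (hf : f ∈ DD2 R0 φ v) (a : ℕ × E) :
    φ a * f ∈ DD2 R0 φ (a.1 + v) := by
  induction hf using Submodule.span_induction with
  | mem f hf =>
    obtain ⟨b, l, h1, h0, rfl, rfl⟩ := hf
    have ⟨hb, hl⟩ := posw_cons.1 h1
    have := DD2_mem (R0 := R0) (φ := φ) (a := pmul a b) (posw_cons.2 ⟨by simp only [pmul]; omega, hl⟩) h0
    rw [pmul_fst] at this
    rw [lwt_cons, ← add_assoc]
    convert this using 1
    funext d; simp only [fsq, Pi.mul_apply, hφ]; ring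
  | zero => simp
  | add f g _ _ hf hg => rw [mul_add]; exact Submodule.add_mem _ hf hg
  | smul c f _ hf => rw [mul_smul_comm]; exact Submodule.smul_mem _ _ hf

end
end spans

section sys
set_option linter.unusedSectionVars false
variable {R0 : Type*} {K E : Type*} [CommRing R0] [CommRing K] [Algebra R0 K] [CommGroup E]

/-- the abstract properties of the weights used below -/
structure Sys (φ : ℕ × E → ℕ → K) (q : ℕ) (D : R0) (ι : E →* R0) : Prop where
  hq : 2 ≤ q
  mul : ∀ a b, φ (pmul a b) = φ a * φ b
  eps : ∀ e d, φ (0, e) d = algebraMap R0 K (ι e ^ d)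
  rr : ∀ d, φ (q, 1) d = algebraMap R0 K (-D) * (φ (1, 1) (d + 1) * isum φ [(q - 1, 1)] (d + 1))
  frob : ∀ x y : K, (x + y) ^ q = x ^ q + y ^ q

variable {φ : ℕ × E → ℕ → K} {q : ℕ} {D : R0} {ι : E →* R0}

lemma Sys.phi_one (H : Sys φ q D ι) : φ (0, 1) = 1 := by
  funext d; simp [H.eps]

lemma Sys.phi_pow (H : Sys φ q D ι) (a : ℕ × E) (n : ℕ) : φ (n * a.1, a.2 ^ n) = φ a ^ n := by
  induction n with
  | zero => simp [H.phi_one]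
  | succ n ih =>
    rw [pow_succ (φ a), ← ih, ← H.mul]
    simp only [pmul, pow_succ, Nat.succ_mul]

lemma Sys.phi_split (H : Sys φ q D ι) (s n : ℕ) (e : E) (d : ℕ) :
    φ (n * s, e) d = φ (s, 1) d ^ n * algebraMap R0 K (ι e ^ d) := by
  have h1 := H.phi_pow (s, 1) n
  have h2 := congrFun (H.mul (n * s, 1) (0, e)) d
  simp only [one_pow] at h1
  rw [h1, Pi.mul_apply, H.eps] at h2
  simpa [pmul] using h2

/-- merged one-layer sequence -/
def fmrg (φ : ℕ × E → ℕ → K) (a : ℕ × E) : List (ℕ × E) → ℕ → K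
  | [] => 0
  | b :: Y => fsq φ (pmul a b) Y

/-- merged iterated sum -/
def imrg (φ : ℕ × E → ℕ → K) (X : List (ℕ × E)) (a : ℕ × E) : List (ℕ × E) → ℕ → K
  | [] => 0
  | b :: Y => isum φ (X ++ pmul a b :: Y)

lemma Sys.KL (H : Sys φ q D ι) {m : ℕ} (hm : 0 < m) (e : E) {Y : List (ℕ × E)} (hY : posw Y) :
    ∃ g ∈ DD2 R0 φ (q * m + lwt Y), ∀ d, fsq φ (q * m, e) Y d = (D • g) (d + 1) - fmrg φ (q * m, e) Y d := by
  have hq := H.hq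
  have hP : isum φ [(q - 1, 1)] ∈ SS R0 φ (q - 1) := by
    have := SS_mem (R0 := R0) (φ := φ) (l := [(q - 1, 1)]) (by simp [posw]; omega)
    rwa [lwt_single] at this
  have hh := SS_mul H.mul (SS_pow H.mul hP m) (SS_mem (R0 := R0) (φ := φ) hY)
  have hg := phi_SS2 (by have := Nat.mul_pos hm (by omega : 0 < q - 1); omega) hh (a := (m, e)) hm
  have hwt : (m, e).1 + (m * (q - 1) + lwt Y) = q * m + lwt Y := by
    obtain ⟨r, rfl⟩ : ∃ r, q = r + 1 := ⟨q - 1, by omega⟩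
    simp; ring
  rw [hwt] at hg
  refine ⟨_, Submodule.smul_mem _ (ι e⁻¹ * (-1) ^ m * D ^ (m - 1)) hg, fun d => ?_⟩
  have e1 : isum φ Y (d + 1) * φ (q * m, e) d = fsq φ (q * m, e) Y d + fmrg φ (q * m, e) Y d := by
    cases Y with
    | nil => simp [fmrg, fsq]
    | cons b Y =>
      rw [isum_cons_succ]
      simp only [fmrg, fsq, H.mul, Pi.mul_apply]
      ring
  rw [eq_sub_iff_add_eq, ← e1]
  have e2 := H.phi_split q m e d
  have e3 := H.phi_split 1 m e (d + 1)
  rw [mul_one] at e3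
  simp only [Pi.smul_apply, Pi.mul_apply, Pi.pow_apply]
  rw [mul_comm q m, e2, e3, H.rr]
  have e4 : D * (ι e⁻¹ * (-1) ^ m * D ^ (m - 1)) * ι e ^ (d + 1) = (-D) ^ m * ι e ^ d := by
    have : ι e⁻¹ * ι e = 1 := by rw [← map_mul]; simp
    obtain ⟨n, rfl⟩ : ∃ n, m = n + 1 := ⟨m - 1, by omega⟩
    simp only [Nat.add_sub_cancel]
    rw [neg_pow D]
    linear_combination ((-1) ^ (n + 1) * D ^ (n + 1) * ι e ^ d) * this
  have e5 := congrArg (algebraMap R0 K) e4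
  rw [smul_smul, Algebra.smul_def]
  simp only [map_mul, map_pow] at e5 ⊢
  simp only [mul_pow]
  linear_combination (-(isum φ Y (d + 1) * φ (1, 1) (d + 1) ^ m * isum φ [(q - 1, 1)] (d + 1) ^ m)) * e5

lemma isum_zero {l : List (ℕ × E)} (h : l ≠ []) : isum φ l 0 = 0 := by
  cases l with
  | nil => exact absurd rfl h
  | cons a l => simp [isum_cons]

lemma DD2_zero {w : ℕ} {f : ℕ → K} (hf : f ∈ DD2 R0 φ w) : f 0 = 0 := by
  induction hf using Submodule.span_induction with
  | mem f hf =>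
    obtain ⟨a, l, _, h, _, rfl⟩ := hf
    simp [fsq, isum_zero h]
  | zero => rfl
  | add f g _ _ hf hg => simp [hf, hg]
  | smul c f _ hf => simp [hf]

/-- the shift -/
def shf (R0 : Type*) {K : Type*} [CommRing R0] [CommRing K] [Algebra R0 K] : (ℕ → K) →ₗ[R0] (ℕ → K) where
  toFun f d := if d = 0 then 0 else f (d - 1)
  map_add' f g := by funext d; by_cases h : d = 0 <;> simp [h]
  map_smul' c f := by funext d; by_cases h : d = 0 <;> simp [h]

lemma Sys.shf_mem (H : Sys φ q D ι) (Y : List (ℕ × E)) : ∀ {m : ℕ} (_ : 0 < m) (e : E), posw Y →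
    (∀ b ∈ Y, q ∣ b.1) → shf R0 (fsq φ (q * m, e) Y) ∈ DD2 R0 φ (q * m + lwt Y) := by
  induction Y with
  | nil =>
    intro m hm e hY _
    obtain ⟨g, hg, h⟩ := H.KL hm e hY
    have : shf R0 (fsq φ (q * m, e) []) = D • g := by
      funext d
      rcases d with _ | d
      · simp [shf, DD2_zero hg]
      · simp [shf, h, fmrg]
    rw [this]; exact Submodule.smul_mem _ _ hg
  | cons b Y ih =>
    intro m hm e hY hd
    obtain ⟨g, hg, h⟩ := H.KL hm e hY
    obtain ⟨n, hn⟩ := hd b (by simp)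
    have ⟨hb, hY'⟩ := posw_cons.1 hY
    have h2 := ih (m := m + n) (by omega) (e * b.2) hY' fun b hb => hd b (by simp [hb])
    have : shf R0 (fsq φ (q * m, e) (b :: Y)) = D • g - shf R0 (fsq φ (q * (m + n), e * b.2) Y) := by
      funext d
      rcases d with _ | d
      · simp [shf, DD2_zero hg]
      · simp [shf, h, fmrg, pmul, hn, mul_add]
    rw [this]
    refine Submodule.sub_mem _ (Submodule.smul_mem _ _ hg) ?_
    rw [lwt_cons, hn, ← add_assoc, ← mul_add]
    exact h2

/-- Frobenius on letters -/
def frq (q : ℕ) (a : ℕ × E) : ℕ × E := (q * a.1, a.2 ^ q)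

lemma Sys.isum_frob (H : Sys φ q D ι) (l : List (ℕ × E)) (d : ℕ) : isum φ (l.map (frq q)) d = isum φ l d ^ q := by
  have hq := H.hq
  let f : K →+* K :=
    { toFun := fun x => x ^ q, map_one' := one_pow _, map_mul' := fun x y => mul_pow x y q,
      map_zero' := zero_pow (by omega), map_add' := H.frob }
  have h2 : ∀ d, isum φ (l.map (frq q)) d = isum (fun a d => f (φ a d)) l d := by
    induction l with
    | nil => intro d; simp
    | cons a l ih =>
      intro d
      simp only [List.map_cons, isum_cons, ih]
      refine Finset.sum_congr rfl fun i _ => ?_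
      have := congrFun (H.phi_pow a q) i
      rw [frq, this]; rfl
  rw [h2, isum_map φ f l d]; rfl

lemma Sys.shf_frob (H : Sys φ q D ι) {w : ℕ} {f : ℕ → K} (hf : f ∈ DD R0 φ w) :
    shf R0 (f ^ q) ∈ DD2 R0 φ (q * w) := by
  have hq := H.hq
  induction hf using Submodule.span_induction with
  | mem f hf =>
    obtain ⟨a, l, h1, rfl, rfl⟩ := hf
    have ⟨ha, hl⟩ := posw_cons.1 h1
    have h2 := H.shf_mem (l.map (frq q)) ha (a.2 ^ q) (by
      intro b hb
      obtain ⟨c, hc, rfl⟩ := List.mem_map.1 hb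
      exact Nat.mul_pos (by omega) (hl c hc)) (by
      intro b hb
      obtain ⟨c, hc, rfl⟩ := List.mem_map.1 hb
      exact Dvd.intro _ rfl)
    have h3 : lwt (l.map (frq q)) = q * lwt l := by
      clear h2 h1 hl
      induction l with
      | nil => simp [lwt]
      | cons b l ih => rw [List.map_cons, lwt_cons, ih, lwt_cons, frq, mul_add]
    rw [h3, ← mul_add, ← lwt_cons] at h2
    convert h2 using 2
    funext d
    have := congrFun (H.phi_pow a q) d
    simp only [fsq, Pi.pow_apply, mul_pow, H.isum_frob]
    rw [this]; rfl
  | zero => rw [zero_pow (by omega), map_zero]; exact Submodule.zero_mem _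
  | add f g _ _ hf hg =>
    have : (f + g) ^ q = f ^ q + g ^ q := by funext d; exact H.frob _ _
    rw [this, map_add]; exact Submodule.add_mem _ hf hg
  | smul c f _ hf => rw [smul_pow, map_smul]; exact Submodule.smul_mem _ _ hf

lemma Sys.merge (H : Sys φ q D ι) {m : ℕ} (hm : 0 < m) (e : E) {Y : List (ℕ × E)} (hY : posw Y)
    (X : List (ℕ × E)) (hX : posw X) :
    ∃ h ∈ SS R0 φ (lwt X + (q * m + lwt Y)) ⊔ DD R0 φ (lwt X + (q * m + lwt Y)),
      isum φ (X ++ (q * m, e) :: Y) + imrg φ X (q * m, e) Y = D • h := by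
  induction X with
  | nil =>
    obtain ⟨g, hg, h⟩ := H.KL hm e hY
    rw [lwt_nil, zero_add]
    refine ⟨sop R0 g + g, Submodule.add_mem_sup (sop_DD (DD2_le _ hg)) (DD2_le _ hg), ?_⟩
    have e1 : imrg φ [] (q * m, e) Y = sop R0 (fmrg φ (q * m, e) Y) := by
      cases Y with
      | nil => simp only [imrg, fmrg, map_zero]
      | cons b Y => simp only [imrg, fmrg, List.nil_append, sop_fsq]
    rw [List.nil_append, ← sop_fsq (R0 := R0), e1, ← map_add]
    funext M
    have e2 : ∀ d, (fsq φ (q * m, e) Y + fmrg φ (q * m, e) Y) d = (D • g) (d + 1) := by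
      intro d; rw [Pi.add_apply, h]; ring
    simp only [sop, LinearMap.coe_mk, AddHom.coe_mk, e2, Pi.smul_apply, Pi.add_apply]
    rw [← Finset.smul_sum, ← Finset.sum_range_succ, Finset.sum_range_succ', DD2_zero hg, add_zero]
  | cons x X ih =>
    have ⟨hx, hX'⟩ := posw_cons.1 hX
    obtain ⟨h, hh, h1⟩ := ih hX'
    refine ⟨sop R0 (φ x * h), Submodule.mem_sup_left (sop_DD ?_), ?_⟩
    · obtain ⟨f, hf, g, hg, rfl⟩ := Submodule.mem_sup.1 hh
      rw [mul_add, lwt_cons, add_assoc]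
      exact Submodule.add_mem _ (phi_SS hf hx) (phi_DD H.mul hg x)
    · rw [← map_smul, ← mul_smul_comm, ← h1, mul_add, map_add]
      have e1 : ∀ l : List (ℕ × E), φ x * isum φ l = fsq φ x l := fun l => rfl
      congr 1
      cases Y with
        | nil => simp only [imrg, mul_zero, map_zero]
        | cons b Y => simp only [imrg, e1, sop_fsq, List.cons_append]

end sys

section trans
set_option linter.unusedSectionVars false
variable {R0 : Type*} {K E : Type*} [CommRing R0] [CommRing K] [Algebra R0 K] [CommGroup E]
variable {φ φS : ℕ × E → ℕ → K} (hφ : ∀ a b, φ (pmul a b) = φ a * φ b)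
  (hS : ∀ a : ℕ × E, 0 < a.1 → φS a - φ a ∈ DD2 R0 φ a.1)
include hφ hS

lemma trans2 (l : List (ℕ × E)) (hl : posw l) : isum φS l ∈ SS R0 φ (lwt l) := by
  induction l with
  | nil =>
    have := SS_mem (R0 := R0) (φ := φ) posw_nil
    exact this
  | cons a l ih =>
    have ⟨ha, hl'⟩ := posw_cons.1 hl
    rw [← sop_fsq (R0 := R0), lwt_cons, add_comm]
    apply sop_DD
    have h1 : φS a ∈ DD R0 φ a.1 := by
      have h2 := DD_mem (R0 := R0) (φ := φ) (a := a) (l := []) (by simpa [posw] using ha)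
      have h3 : fsq φ a [] = φ a := by funext d; simp [fsq]
      rw [h3, lwt_nil, add_zero] at h2
      have := Submodule.add_mem _ (DD2_le _ (hS a ha)) h2
      rwa [sub_add_cancel] at this
    have := SS_mul_DD hφ (ih hl') h1
    rwa [mul_comm] at this

lemma trans3 (w : ℕ) : ∀ s, ∀ a : ℕ × E, a.1 = s → ∀ l, posw (a :: l) → lwt (a :: l) = w →
    fsq φ a l ∈ DD R0 φS w := by
  induction w using Nat.strong_induction_on with
  | _ w ihw =>
  intro s
  induction s using Nat.strong_induction_on with
  | _ s ihs =>
  intro a has l hl hw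
  have ⟨ha, hl'⟩ := posw_cons.1 hl
  have hl1 : isum φ l ∈ SS R0 φS (lwt l) := by
    cases l with
    | nil =>
      have := SS_mem (R0 := R0) (φ := φS) posw_nil
      exact this
    | cons c l =>
      rw [← sop_fsq (R0 := R0)]
      apply sop_DD
      refine ihw _ ?_ _ c rfl l hl' rfl
      rw [← hw, lwt_cons a]; omega
  have h1 := phi_SS hl1 ha
  rw [← lwt_cons, hw] at h1
  have h2 : (φS a - φ a) * isum φ l ∈ DD R0 φS w := by
    have h3 := hS a ha
    have h4 : isum φ l ∈ Submodule.span R0 {isum φ l} := Submodule.mem_span_singleton_self _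
    refine span_mul ?_ h3 h4
    rintro _ ⟨b, l', hbl, hl0, hwt, rfl⟩ _ rfl
    have ⟨hb, hbl'⟩ := posw_cons.1 hbl
    have h5 := SS_mul hφ (SS_mem (R0 := R0) hbl') (SS_mem hl')
    have h6 := lwt_pos hbl' hl0
    rw [lwt_cons] at hwt hw
    have h7 : ∀ f ∈ SS R0 φ (lwt l' + lwt l), φ b * f ∈ DD R0 φS w := by
      intro f hf
      induction hf using Submodule.span_induction with
      | mem f hf =>
        obtain ⟨m, hm, hmw, rfl⟩ := hf
        refine ihs b.1 (by omega) b rfl m (posw_cons.2 ⟨hb, hm⟩) ?_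
        rw [lwt_cons]; omega
      | zero => simp
      | add f g _ _ hf hg => rw [mul_add]; exact Submodule.add_mem _ hf hg
      | smul c f _ hf => rw [mul_smul_comm]; exact Submodule.smul_mem _ _ hf
    have h8 := h7 _ h5
    rw [← mul_assoc] at h8
    exact h8
  have := Submodule.sub_mem _ h1 h2
  convert this using 1
  funext d
  simp only [fsq, Pi.sub_apply, Pi.mul_apply]; ring

lemma trans3' (l : List (ℕ × E)) (hl : posw l) : isum φ l ∈ SS R0 φS (lwt l) := by
  cases l with
  | nil =>
    have := SS_mem (R0 := R0) (φ := φS) posw_nil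
    exact this
  | cons a l =>
    rw [← sop_fsq (R0 := R0)]
    exact sop_DD (trans3 hφ hS _ _ a rfl l hl rfl)

end trans

section lim
set_option linter.unusedSectionVars false
variable {k : Type*} [Field k]

/-- convergence -/
def cvg (f : ℕ → LaurentSeries k) (x : LaurentSeries k) : Prop := ∀ n : ℕ, ∃ M, ∀ m ≥ M, og n (f m - x)

lemma cvg.add {f g : ℕ → LaurentSeries k} {x y} (hf : cvg f x) (hg : cvg g y) : cvg (f + g) (x + y) := by
  intro n
  obtain ⟨M, hM⟩ := hf n
  obtain ⟨M', hM'⟩ := hg n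
  refine ⟨max M M', fun m hm => ?_⟩
  have := og_add (hM m (le_of_max_le_left hm)) (hM' m (le_of_max_le_right hm))
  convert this using 1
  simp only [Pi.add_apply]; ring

lemma cvg.zero : cvg (0 : ℕ → LaurentSeries k) 0 := fun n => ⟨0, fun m _ => by simpa using og_zero _⟩

lemma cvg.mul {f : ℕ → LaurentSeries k} {x} (hf : cvg f x) (c : LaurentSeries k) :
    cvg (fun m => c * f m) (c * x) := by
  intro n
  obtain ⟨j, hj⟩ := exists_og c
  obtain ⟨M, hM⟩ := hf (n + j.natAbs)
  refine ⟨M, fun m hm => ?_⟩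
  rw [← mul_sub]
  refine og_mono (og_mul hj (hM m hm)) ?_
  push_cast; have := neg_abs_le j; omega

lemma cvg.uniq {f : ℕ → LaurentSeries k} {x y} (hf : cvg f x) (hg : cvg f y) : x = y := by
  rw [← sub_eq_zero]
  apply eq_zero_of_og
  intro n
  obtain ⟨M, hM⟩ := hf n
  obtain ⟨M', hM'⟩ := hg n
  have := og_sub (hM' (max M M') (le_max_right _ _)) (hM (max M M') (le_max_left _ _))
  convert this using 1
  ring

variable {R0 E : Type*} [CommRing R0] [Algebra R0 (LaurentSeries k)]

/-- limits of elements of a span -/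
lemma cvg_span {S : Set (ℕ → LaurentSeries k)} {P : Submodule R0 (LaurentSeries k)}
    (h : ∀ f ∈ S, ∃ x ∈ P, cvg f x) {f} (hf : f ∈ Submodule.span R0 S) : ∃ x ∈ P, cvg f x := by
  induction hf using Submodule.span_induction with
  | mem f hf => exact h f hf
  | zero => exact ⟨0, P.zero_mem, cvg.zero⟩
  | add f g _ _ hf hg =>
    obtain ⟨x, hx, h1⟩ := hf
    obtain ⟨y, hy, h2⟩ := hg
    exact ⟨x + y, P.add_mem hx hy, h1.add h2⟩
  | smul c f _ hf =>
    obtain ⟨x, hx, h1⟩ := hf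
    refine ⟨c • x, P.smul_mem c hx, ?_⟩
    have := h1.mul (algebraMap R0 _ c)
    simp only [← Algebra.smul_def] at this
    exact this

variable {q : ℕ} (ev : E → k)

lemma cvg_Lik (hq : 2 ≤ q) (l : List (ℕ × E)) (hl : posw l) : cvg (isum (phik q ev 0) l) (Lik q ev 0 l) := by
  intro n
  refine ⟨n, fun m hm => ?_⟩
  have := og_neg (og_mono (Lik_spec ev hq 0 l hl m) (by omega : (n : ℤ) ≤ m))
  rwa [neg_sub] at this

lemma cvg_fsq (hq : 2 ≤ q) (a : ℕ × E) (ha : 0 < a.1) (l : List (ℕ × E)) : cvg (fsq (phik q ev 0) a l) 0 := by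
  intro n
  refine ⟨n, fun m hm => ?_⟩
  rw [sub_zero, fsq, mul_comm]
  refine og_mul0 (og_isum ev hq 0 l m) (og_mono (og_phik ev hq 0 a ha m) ?_)
  have := le_qpow hq 0 m
  omega

/-- span of the polylogarithms of weight `w` -/
def MM (R0 : Type*) [CommRing R0] [Algebra R0 (LaurentSeries k)] (q : ℕ) (w : ℕ) : Submodule R0 (LaurentSeries k) :=
  Submodule.span R0 ((Lik q ev 0) '' {l | posw l ∧ lwt l = w})

/-- span of the good polylogarithms of weight `w` -/
def NN (R0 : Type*) [CommRing R0] [Algebra R0 (LaurentSeries k)] (q : ℕ) (w : ℕ) : Submodule R0 (LaurentSeries k) :=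
  Submodule.span R0 ((Lik q ev 0) '' good E q w)

lemma words_finite [Finite E] (w : ℕ) : {l : List (ℕ × E) | posw l ∧ lwt l = w}.Finite := by
  induction w using Nat.strong_induction_on with
  | _ w ih =>
  have : {l : List (ℕ × E) | posw l ∧ lwt l = w} ⊆ {[]} ∪
      ⋃ s ∈ Finset.range w, ⋃ e : E, (fun l => (w - s, e) :: l) '' {l | posw l ∧ lwt l = s} := by
    rintro l ⟨h1, h2⟩
    cases l with
    | nil => simp
    | cons a l =>
      right
      have ⟨ha, hl⟩ := posw_cons.1 h1
      rw [lwt_cons] at h2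
      simp only [Set.mem_iUnion, Finset.mem_range]
      refine ⟨lwt l, by omega, a.2, l, ⟨hl, rfl⟩, ?_⟩
      rw [← h2]; simp
  refine Set.Finite.subset (Set.Finite.union (Set.finite_singleton _) ?_) this
  refine Set.Finite.biUnion (Finset.finite_toSet _) fun s hs => Set.finite_iUnion fun e => ?_
  exact (ih s (by simpa using hs)).image _

lemma cvg_SSDD (hq : 2 ≤ q) (w : ℕ) {f} (hf : f ∈ SS R0 (phik q ev 0) w ⊔ DD R0 (phik q ev 0) w) :
    ∃ x ∈ MM ev R0 q w, cvg f x := by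
  rw [SS, DD, ← Submodule.span_union] at hf
  refine cvg_span ?_ hf
  rintro f (⟨l, h1, h2, rfl⟩ | ⟨a, l, h1, h2, rfl⟩)
  · exact ⟨_, Submodule.subset_span ⟨l, ⟨h1, h2⟩, rfl⟩, cvg_Lik ev hq l h1⟩
  · exact ⟨0, Submodule.zero_mem _, cvg_fsq ev hq a (posw_cons.1 h1).1 l⟩

variable [CommGroup E] {D : R0} {ι : E →* R0}

lemma naka_step (H : Sys (phik q ev 0) q D ι) (w n : ℕ) : ∀ l : List (ℕ × E), l.length ≤ n → posw l → lwt l = w →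
    Lik q ev 0 l ∈ NN ev R0 q w ⊔ Ideal.span {D} • MM ev R0 q w := by
  induction n with
  | zero =>
    intro l hl hp hw
    obtain rfl : l = [] := by rw [← List.length_eq_zero_iff]; omega
    exact Submodule.mem_sup_left (Submodule.subset_span ⟨[], ⟨by simp, hw⟩, rfl⟩)
  | succ n ih =>
    intro l hl hp hw
    by_cases hg : l ∈ good E q w
    · exact Submodule.mem_sup_left (Submodule.subset_span ⟨l, hg, rfl⟩)
    obtain ⟨a, hal, m, ham⟩ : ∃ a ∈ l, q ∣ a.1 := by
      by_contra hh
      push Not at hh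
      exact hg ⟨fun a ha => ⟨hp a ha, hh a ha⟩, hw⟩
    obtain ⟨X, Y, rfl⟩ := List.append_of_mem hal
    obtain ⟨s, e⟩ := a
    simp only at ham
    subst ham
    have hX := (posw_append.1 hp).1
    have ⟨hm, hY⟩ := posw_cons.1 (posw_append.1 hp).2
    have hm : 0 < m := Nat.pos_of_ne_zero (by rintro rfl; simp at hm)
    obtain ⟨h, hh, h1⟩ := H.merge hm e hY X hX
    have hwe : lwt X + (q * m + lwt Y) = w := by rw [← hw, lwt_append, lwt_cons]
    rw [hwe] at hh
    obtain ⟨x, hx, hx1⟩ := cvg_SSDD ev H.hq w hh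
    have hx2 := hx1.mul (algebraMap R0 _ D)
    have hDx : D • x ∈ Ideal.span {D} • MM ev R0 q w :=
      Submodule.smul_mem_smul (Ideal.mem_span_singleton_self D) hx
    have h2 : (fun m => algebraMap R0 _ D * h m) = D • h := by
      funext m; rw [Pi.smul_apply, Algebra.smul_def]
    rw [h2, ← h1, ← Algebra.smul_def] at hx2
    have h3 := cvg_Lik ev H.hq _ hp
    cases Y with
    | nil =>
      rw [imrg, add_zero] at hx2
      rw [h3.uniq hx2]
      exact Submodule.mem_sup_right hDx
    | cons b Y =>
      have ⟨hb, hY'⟩ := posw_cons.1 hY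
      have hp' : posw (X ++ pmul (q * m, e) b :: Y) :=
        posw_append.2 ⟨hX, posw_cons.2 ⟨by rw [pmul_fst]; omega, hY'⟩⟩
      have h4 := (h3.add (cvg_Lik ev H.hq _ hp')).uniq hx2
      rw [eq_sub_of_add_eq h4]
      refine Submodule.sub_mem _ (Submodule.mem_sup_right hDx) (ih _ ?_ hp' ?_)
      · simp only [List.length_append, List.length_cons] at hl ⊢; omega
      · rw [← hwe, lwt_append, lwt_cons, lwt_cons, pmul_fst, add_assoc]

lemma naka [Finite E] (H : Sys (phik q ev 0) q D ι) (w : ℕ) :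
    ∃ r : R0, r - 1 ∈ Ideal.span {D} ∧ ∀ x ∈ MM ev R0 q w, r • x ∈ NN ev R0 q w := by
  have hfg : (MM ev R0 q w).FG := Submodule.fg_span ((words_finite w).image _)
  have hle : MM ev R0 q w ≤ NN ev R0 q w ⊔ Ideal.span {D} • MM ev R0 q w := by
    refine Submodule.span_le.2 ?_
    rintro _ ⟨l, ⟨h1, h2⟩, rfl⟩
    exact naka_step ev H w _ l le_rfl h1 h2
  obtain ⟨r, hr, h⟩ := Submodule.exists_sub_one_mem_and_smul_le_of_fg_of_le_sup hfg le_rfl hle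
  refine ⟨r, hr, fun x hx => h ?_⟩
  exact Submodule.smul_mem_pointwise_smul _ _ _ hx

end lim

section car

variable {K : Type*} [Field K] {q : ℕ} {t : K} {L : ℕ → K}

lemma L_ne (hL0 : L 0 = 1) (hL : ∀ d, L d = (t - t ^ q ^ (d + 1)) * L (d + 1)) (d : ℕ) : L d ≠ 0 := by
  induction d with
  | zero => rw [hL0]; exact one_ne_zero
  | succ d ih => rw [hL d] at ih; exact right_ne_zero_of_mul ih

lemma rr_aux (hq : 2 ≤ q) (frob : ∀ x y : K, (x + y) ^ q = x ^ q + y ^ q) (hneg : ∀ x : K, (-x) ^ q = -x ^ q)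
    (hL0 : L 0 = 1) (hL : ∀ d, L d = (t - t ^ q ^ (d + 1)) * L (d + 1)) (d : ℕ) :
    L d ^ q = (t - t ^ q) * (L (d + 1) * ∑ j ∈ Finset.range (d + 1), L j ^ (q - 1)) := by
  induction d with
  | zero =>
    have := hL 0
    rw [zero_add, pow_one, hL0] at this
    rw [hL0, Finset.sum_range_one, hL0, one_pow, one_pow, mul_one, zero_add]
    exact this
  | succ d ih =>
    have hne := L_ne hL0 hL (d + 1)
    have hp : L (d + 1) ^ q = L (d + 1) ^ (q - 1) * L (d + 1) := by
      rw [← pow_succ]; congr 1; omega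
    have h1 : (t - t ^ q ^ (d + 1)) ^ q = t ^ q - t ^ q ^ (d + 2) := by
      rw [sub_eq_add_neg, frob, hneg, ← pow_mul, ← pow_succ, ← sub_eq_add_neg]
    rw [hL d, mul_pow, h1, hp] at ih
    have h2 : (t ^ q - t ^ q ^ (d + 2)) * L (d + 1) ^ (q - 1) =
        (t - t ^ q) * ∑ j ∈ Finset.range (d + 1), L j ^ (q - 1) := by
      apply mul_right_cancel₀ hne
      linear_combination ih
    rw [Finset.sum_range_succ, hp]
    have h3 := hL (d + 1)
    linear_combination L (d + 1) ^ (q - 1) * h3 + L (d + 1 + 1) * h2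

/-- `[n]` -/
def brk (q : ℕ) (t : K) (n : ℕ) : K := t ^ q ^ n - t

/-- Carlitz coefficients -/
def ec (q : ℕ) (t : K) (L : ℕ → K) : ℕ → ℕ → K
  | d, 0 => L d
  | 0, _ + 1 => 0
  | d + 1, j + 1 => ec q t L d j ^ q / brk q t (j + 1)

lemma ec_zero (d : ℕ) : ec q t L d 0 = L d := by cases d <;> rfl

lemma ec_lt (hq : 2 ≤ q) : ∀ d j, d < j → ec q t L d j = 0 := by
  intro d
  induction d with
  | zero => intro j hj; cases j with
    | zero => omega
    | succ j => rfl
  | succ d ih => intro j hj; cases j with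
    | zero => omega
    | succ j =>
      rw [ec, ih j (by omega), zero_pow (by omega), zero_div]

lemma ec_C (hq : 2 ≤ q) (frob : ∀ x y : K, (x + y) ^ q = x ^ q + y ^ q) (hneg : ∀ x : K, (-x) ^ q = -x ^ q)
    (hL : ∀ d, L d = (t - t ^ q ^ (d + 1)) * L (d + 1)) :
    ∀ d j, (brk q t (d + 1) - brk q t j) * ec q t L (d + 1) j = - ec q t L d j := by
  intro d
  induction d with
  | zero =>
    intro j
    rcases j with _ | _ | j
    · rw [ec_zero, ec_zero, hL 0, brk, brk]; ring
    · simp [ec]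
    · simp [ec, zero_pow (show q ≠ 0 by omega)]
  | succ d ih =>
    intro j
    rcases j with _ | j
    · rw [ec_zero, ec_zero, hL (d + 1), brk, brk]; ring
    · rw [ec, ec, ← mul_div_assoc, ← neg_div]
      congr 1
      rw [← hneg, ← ih j, mul_pow]
      congr 1
      have : brk q t (d + 1) - brk q t j = t ^ q ^ (d + 1) + - t ^ q ^ j := by rw [brk, brk]; ring
      rw [this, frob, hneg, ← pow_mul, ← pow_mul, ← pow_succ, ← pow_succ, brk, brk]; ring

/-- Carlitz polynomials -/
def Ec (q : ℕ) (t : K) (L : ℕ → K) (d : ℕ) (z : K) : K :=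
  ∑ j ∈ Finset.range (d + 1), ec q t L d j * z ^ q ^ j

lemma Ec_theta (hb : ∀ n, brk q t (n + 1) ≠ 0) (frob : ∀ x y : K, (x + y) ^ q = x ^ q + y ^ q) (hq : 2 ≤ q) (d : ℕ) (z : K) :
    Ec q t L (d + 1) (t * z) = t * Ec q t L (d + 1) z + Ec q t L d z ^ q := by
  have hs : ∀ n (f : ℕ → K), (∑ j ∈ Finset.range n, f j) ^ q = ∑ j ∈ Finset.range n, f j ^ q := by
    intro n f
    induction n with
    | zero => simp [show q ≠ 0 by omega]
    | succ n ih => rw [Finset.sum_range_succ, frob, ih, Finset.sum_range_succ]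
  rw [Ec, Ec, Ec, hs, Finset.sum_range_succ', Finset.sum_range_succ' _ (d + 1), mul_add, Finset.mul_sum,
    add_right_comm, ← Finset.sum_add_distrib]
  congr 1
  · refine Finset.sum_congr rfl fun j _ => ?_
    have h := hb j
    have h2 : t ^ q ^ (j + 1) = t + brk q t (j + 1) := by rw [brk]; ring
    rw [ec, mul_pow, mul_pow, h2, ← pow_mul, ← pow_succ]
    field_simp
  · rw [pow_zero, pow_one, pow_one]; ring

lemma Ec_one (hq : 2 ≤ q) (frob : ∀ x y : K, (x + y) ^ q = x ^ q + y ^ q) (hneg : ∀ x : K, (-x) ^ q = -x ^ q)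
    (hL0 : L 0 = 1) (hL : ∀ d, L d = (t - t ^ q ^ (d + 1)) * L (d + 1)) (hb : ∀ n, brk q t (n + 1) ≠ 0) (d : ℕ) :
    Ec q t L (d + 1) 1 = 0 := by
  have key : ∀ d, brk q t (d + 1) * Ec q t L (d + 1) 1 = Ec q t L d 1 ^ q - Ec q t L d 1 := by
    intro d
    have h := Ec_theta (L := L) hb frob hq d 1
    have h2 : Ec q t L (d + 1) (t * 1) = t * Ec q t L (d + 1) 1 + brk q t (d + 1) * Ec q t L (d + 1) 1 + Ec q t L d 1 := by
      have e : Ec q t L d 1 = ∑ j ∈ Finset.range (d + 1 + 1), ec q t L d j := by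
        rw [Finset.sum_range_succ, ec_lt hq d (d + 1) (by omega), add_zero, Ec]; simp
      rw [e, Ec, Ec, Finset.mul_sum, Finset.mul_sum, ← Finset.sum_add_distrib, ← Finset.sum_add_distrib]
      refine Finset.sum_congr rfl fun j _ => ?_
      have := ec_C hq frob hneg hL d j
      rw [one_pow, mul_one, mul_one]
      have h3 : t ^ q ^ j = t + brk q t j := by rw [brk]; ring
      rw [h3]
      linear_combination -this
    linear_combination h - h2
  have := key d
  have h01 : Ec q t L d 1 ^ q - Ec q t L d 1 = 0 := by
    induction d with
    | zero => simp [Ec, ec_zero, hL0]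
    | succ d ih =>
      have h4 := key d
      rw [ih h4, mul_eq_zero] at h4
      rw [h4.resolve_left (hb d), zero_pow (by omega), sub_zero]
  rw [h01, mul_eq_zero] at this
  exact this.resolve_left (hb d)

lemma Ec_pow (hq : 2 ≤ q) (frob : ∀ x y : K, (x + y) ^ q = x ^ q + y ^ q) (hneg : ∀ x : K, (-x) ^ q = -x ^ q)
    (hL0 : L 0 = 1) (hL : ∀ d, L d = (t - t ^ q ^ (d + 1)) * L (d + 1)) (hb : ∀ n, brk q t (n + 1) ≠ 0) (d : ℕ) :
    Ec q t L d (t ^ d) = 1 ∧ ∀ i < d, Ec q t L d (t ^ i) = 0 := by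
  have z : ∀ d i, i < d → Ec q t L d (t ^ i) = 0 := by
    intro d
    induction d with
    | zero => intro i hi; omega
    | succ d ih =>
      intro i
      induction i with
      | zero => intro _; rw [pow_zero]; exact Ec_one hq frob hneg hL0 hL hb d
      | succ i ihi =>
        intro hi
        rw [pow_succ', Ec_theta hb frob hq, ihi (by omega), ih i (by omega), zero_pow (by omega)]; ring
  refine ⟨?_, z d⟩
  induction d with
  | zero => simp [Ec, ec_zero, hL0]
  | succ d ih => rw [pow_succ', Ec_theta hb frob hq, z _ _ (Nat.lt_succ_self d), ih]; simp

lemma frob_pow (frob : ∀ x y : K, (x + y) ^ q = x ^ q + y ^ q) (j : ℕ) (x y : K) :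
    (x + y) ^ q ^ j = x ^ q ^ j + y ^ q ^ j := by
  induction j with
  | zero => simp
  | succ j ih => rw [pow_succ, pow_mul, ih, frob, ← pow_mul, ← pow_mul]

lemma Ec_add (frob : ∀ x y : K, (x + y) ^ q = x ^ q + y ^ q) (d : ℕ) (x y : K) :
    Ec q t L d (x + y) = Ec q t L d x + Ec q t L d y := by
  rw [Ec, Ec, Ec, ← Finset.sum_add_distrib]
  refine Finset.sum_congr rfl fun j _ => ?_
  rw [frob_pow frob]; ring

lemma Ec_smul (d : ℕ) (c : K) (hc : c ^ q = c) (y : K) :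
    Ec q t L d (c * y) = c * Ec q t L d y := by
  have hj : ∀ j, c ^ q ^ j = c := by
    intro j
    induction j with
    | zero => simp
    | succ j ih => rw [pow_succ, pow_mul, ih, hc]
  rw [Ec, Ec, Finset.mul_sum]
  refine Finset.sum_congr rfl fun j _ => ?_
  rw [mul_pow, hj]; ring

lemma Ec_mon {F : Type*} [Field F] (c : F → K) (hc : ∀ x, c x ^ q = c x)
    (hq : 2 ≤ q) (frob : ∀ x y : K, (x + y) ^ q = x ^ q + y ^ q) (hneg : ∀ x : K, (-x) ^ q = -x ^ q)
    (hL0 : L 0 = 1) (hL : ∀ d, L d = (t - t ^ q ^ (d + 1)) * L (d + 1)) (hb : ∀ n, brk q t (n + 1) ≠ 0) (d : ℕ)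
    (v : Fin d → F) : Ec q t L d (t ^ d + ∑ j, c (v j) * t ^ (j : ℕ)) = 1 := by
  have hs : ∀ s : Finset (Fin d), Ec q t L d (∑ j ∈ s, c (v j) * t ^ (j : ℕ)) = 0 := by
    intro s
    induction s using Finset.induction_on with
    | empty => 
      rw [Finset.sum_empty, Ec]
      exact Finset.sum_eq_zero fun j _ => by rw [zero_pow (pow_ne_zero _ (by omega)), mul_zero]
    | insert a s ha ih =>
      rw [Finset.sum_insert ha, Ec_add frob, ih, Ec_smul _ _ (hc _),
        (Ec_pow hq frob hneg hL0 hL hb d).2 a a.2]; simp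
  rw [Ec_add frob, hs, (Ec_pow hq frob hneg hL0 hL hb d).1, add_zero]

end car

section psum
open Polynomial in
lemma psum_rec {K I : Type*} [Field K] [Fintype I] {q d : ℕ} (hq : 2 ≤ q) (hq0 : (q : K) = 0) (a : I → K)
    (ha : Function.Injective a) (hI : Fintype.card I = q ^ d) (e : ℕ → K)
    (hE : ∀ i, ∑ j ∈ Finset.range (d + 1), e j * a i ^ q ^ j = 1) (s : ℕ) :
    ∑ i, (a i)⁻¹ ^ (s + 1) = (if s = 0 then e 0 else 0) +
      ∑ j ∈ Finset.range (d + 1), if q ^ j ≤ s then e j * ∑ i, (a i)⁻¹ ^ (s + 1 - q ^ j) else 0 := by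
  have ha0 : ∀ i, a i ≠ 0 := by
    intro i h
    have := hE i
    rw [h, Finset.sum_eq_zero] at this
    · exact zero_ne_one this
    · intro j _; rw [zero_pow (pow_ne_zero _ (by omega)), mul_zero]
  set P : K[X] := 1 - ∑ j ∈ Finset.range (d + 1), C (e j) * X ^ q ^ j with hP
  have hP0 : P ≠ 0 := by
    intro h
    have h2 : P.eval 0 = 1 := by
      rw [hP, eval_sub, eval_one, eval_finsetSum, Finset.sum_eq_zero, sub_zero]
      intro j _
      rw [eval_mul, eval_pow, eval_X, zero_pow (pow_ne_zero _ (by omega)), mul_zero]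
    rw [h, eval_zero] at h2
    exact zero_ne_one h2
  have hdeg : P.natDegree ≤ q ^ d := by
    refine (natDegree_sub_le _ _).trans (max_le (by simp) ?_)
    refine natDegree_sum_le_of_forall_le _ _ fun j hj => ?_
    refine (natDegree_C_mul_X_pow_le _ _).trans ?_
    exact Nat.pow_le_pow_right (by omega) (by have := Finset.mem_range.1 hj; omega)
  have hdvd : ∏ i, (X - C (a i)) ∣ P := by
    refine Finset.prod_dvd_of_coprime ?_ ?_
    · intro i _ j _ hij
      exact isCoprime_X_sub_C_of_isUnit_sub (sub_ne_zero.2 (ha.ne hij)).isUnit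
    · intro i _
      rw [dvd_iff_isRoot, IsRoot, hP, eval_sub, eval_one, eval_finsetSum]
      simp only [eval_mul, eval_C, eval_pow, eval_X]
      rw [hE, sub_self]
  obtain ⟨R, hR⟩ := hdvd
  have hR0 : R ≠ 0 := by rintro rfl; exact hP0 (by rw [hR, mul_zero])
  have hpm : (∏ i, (X - C (a i))).Monic := monic_prod_of_monic _ _ fun i _ => monic_X_sub_C _
  have hRd : R.natDegree = 0 := by
    have h1 : P.natDegree = q ^ d + R.natDegree := by
      rw [hR, hpm.natDegree_mul' hR0, natDegree_prod_of_monic _ _ fun i _ => monic_X_sub_C _]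
      simp [hI]
    omega
  rw [natDegree_eq_zero] at hRd
  obtain ⟨κ, rfl⟩ := hRd
  have hder : derivative P = C (- e 0) := by
    rw [hP, derivative_sub, derivative_one, derivative_sum, Finset.sum_range_succ', Finset.sum_eq_zero]
    · simp
    · intro j _
      rw [derivative_C_mul, derivative_X_pow]
      push_cast
      rw [pow_succ, hq0]; simp
  have hder2 : derivative P = ∑ i, (∏ j ∈ Finset.univ.erase i, (X - C (a j))) * C κ := by
    rw [hR, derivative_mul, derivative_C, mul_zero, add_zero, derivative_prod_finset, Finset.sum_mul]
    refine Finset.sum_congr rfl fun i _ => ?_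
    simp
  let G : I → PowerSeries K := fun i => PowerSeries.mk fun s => (a i)⁻¹ ^ (s + 1)
  have hG : ∀ i, ((X - C (a i) : K[X]) : PowerSeries K) * G i = -1 := by
    intro i
    ext n
    rw [coe_sub, coe_X, coe_C, sub_mul, map_sub, PowerSeries.coeff_C_mul, PowerSeries.coeff_mk]
    cases n with
    | zero =>
      simp [ha0 i]
    | succ n =>
      rw [PowerSeries.coeff_succ_X_mul, PowerSeries.coeff_mk, map_neg, PowerSeries.coeff_one,
        if_neg (by omega), pow_succ' _ (n + 1), ← mul_assoc, mul_inv_cancel₀ (ha0 i)]; simp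
  have hPG : (P : PowerSeries K) * ∑ i, G i = PowerSeries.C (e 0) := by
    have h1 : ((derivative P : K[X]) : PowerSeries K) = PowerSeries.C (-e 0) := by rw [hder, coe_C]
    have h2 : (P : PowerSeries K) * ∑ i, G i = - ((derivative P : K[X]) : PowerSeries K) := by
      rw [hder2, ← coeToPowerSeries.ringHom_apply (φ := ∑ i, _), map_sum, Finset.mul_sum, ← Finset.sum_neg_distrib]
      refine Finset.sum_congr rfl fun i _ => ?_
      rw [coeToPowerSeries.ringHom_apply, hR, ← Finset.mul_prod_erase _ _ (Finset.mem_univ i), coe_mul, coe_mul, coe_mul]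
      linear_combination ((∏ j ∈ Finset.univ.erase i, (X - C (a j)) : K[X]) : PowerSeries K) * ((C κ : K[X]) : PowerSeries K) * hG i
    rw [h2, h1, map_neg, neg_neg]
  have hc := congrArg (PowerSeries.coeff s) hPG
  have hGs : ∀ n, PowerSeries.coeff n (∑ i, G i) = ∑ i, (a i)⁻¹ ^ (n + 1) := by
    intro n; rw [map_sum]; simp [G]
  have hPc : (P : PowerSeries K) = 1 - ∑ j ∈ Finset.range (d + 1), PowerSeries.C (e j) * PowerSeries.X ^ q ^ j := by
    rw [hP, ← coeToPowerSeries.ringHom_apply, map_sub, map_one, map_sum]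
    simp
  rw [hPc, sub_mul, one_mul, map_sub, hGs, PowerSeries.coeff_C, Finset.sum_mul, map_sum, sub_eq_iff_eq_add] at hc
  rw [hc]
  congr 1
  refine Finset.sum_congr rfl fun j _ => ?_
  rw [mul_assoc, PowerSeries.coeff_C_mul, PowerSeries.coeff_X_pow_mul']
  split_ifs with h
  · rw [hGs]; congr 3; funext i; congr 1; omega
  · simp
end psum

section conc

lemma two_le_qc : 2 ≤ qc Fq := Fintype.one_lt_card

/-- embedding of the finite field -/
def cc : Fq →+* Kinf Fq := (cst Fq).comp (algebraMap Fq (Fb Fq))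

lemma qc_frob (x y : Kinf Fq) : (x + y) ^ qc Fq = x ^ qc Fq + y ^ qc Fq := by
  obtain ⟨p, hp⟩ := CharP.exists Fq
  obtain ⟨n, hp1, hn⟩ := FiniteField.card Fq p
  have : Fact p.Prime := ⟨hp1⟩
  have : CharP (Kinf Fq) p := charP_of_injective_ringHom (cc Fq).injective p
  rw [qc, hn]
  exact add_pow_char_pow x y p n

lemma qc_cast : ((qc Fq : ℕ) : Kinf Fq) = 0 := by
  rw [qc, ← map_natCast (cc Fq), Nat.cast_card_eq_zero, map_zero]

lemma qc_neg (x : Kinf Fq) : (-x) ^ qc Fq = - x ^ qc Fq := by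
  have := qc_frob Fq x (-x)
  rw [add_neg_cancel, zero_pow (by have := two_le_qc Fq; omega)] at this
  exact (neg_eq_of_add_eq_zero_right this.symm).symm

/-- `1/ℓ_d` -/
def LL (d : ℕ) : Kinf Fq := ∏ j ∈ Finset.range d, gq (qc Fq ^ (0 + j + 1))

lemma LL_zero : LL Fq 0 = 1 := by simp [LL]
lemma LL_succ (d : ℕ) : LL Fq d = (th - th ^ qc Fq ^ (d + 1)) * LL Fq (d + 1) := by
  rw [LL, LL, Finset.prod_range_succ, zero_add, mul_comm, mul_assoc, mul_comm (gq _), gq_mul (two_le_qpow (two_le_qc Fq) d), mul_one]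

variable {Fq}
lemma mkSys {R0 E : Type*} [CommRing R0] [Algebra R0 (Kinf Fq)] [CommGroup E] (ev : E →* Fb Fq) (D : R0) (ι : E →* R0)
    (hD : algebraMap R0 (Kinf Fq) D = th ^ qc Fq - th) (hι : ∀ e, algebraMap R0 (Kinf Fq) (ι e) = HahnSeries.C (ev e)) :
    Sys (phik (qc Fq) ev 0) (qc Fq) D ι where
  hq := two_le_qc Fq
  mul a b := by
    funext d
    simp only [phik, pmul, Pi.mul_apply, map_mul, mul_pow, pow_add]; ring
  eps e d := by simp [phik, hι]
  rr d := by
    have h := rr_aux (two_le_qc Fq) (qc_frob Fq) (qc_neg Fq) (LL_zero Fq) (LL_succ Fq) d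
    simp only [phik, isum_cons, isum_nil, map_one, one_pow, one_mul, mul_one, map_neg, hD, pow_one]
    simp only [LL] at h
    rw [h]; ring
  frob x y := qc_frob Fq x y

end conc

set_option linter.unusedSectionVars false
section fin3
variable (N : ℕ)

/-- roots of unity -/
abbrev EE := rootsOfUnity N (Fb Fq)

/-- inclusion of the roots of unity -/
def evE : EE Fq N →* Fb Fq := (Units.coeHom (Fb Fq)).comp (rootsOfUnity N (Fb Fq)).subtype

lemma evE_pow (e : EE Fq N) : evE Fq N e ^ N = 1 := by
  have := (mem_rootsOfUnity' N _).1 e.2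
  exact this

lemma evE_inj : Function.Injective (evE Fq N) := by
  intro a b h
  exact Subtype.ext (Units.ext h)

lemma evE_ne (e : EE Fq N) : evE Fq N e ≠ 0 := (e : (Fb Fq)ˣ).ne_zero

lemma evE_surj (hN : 0 < N) (x : Fb Fq) (hx : x ^ N = 1) : ∃ e, evE Fq N e = x := by
  have : NeZero N := ⟨by omega⟩
  exact ⟨rootsOfUnity.mkOfPowEq x hx, rfl⟩

lemma cst_mem_AN (e : EE Fq N) : cst Fq (evE Fq N e) ∈ AN Fq N :=
  Subring.subset_closure (Or.inl ⟨_, Subfield.subset_closure (Or.inr (evE_pow Fq N e)), rfl⟩)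

lemma theta_mem_AN : theta Fq ∈ AN Fq N := Subring.subset_closure (Or.inr rfl)

lemma AN_le : AN Fq N ≤ (KNf Fq N).toSubring := by
  refine (Subring.closure_le).2 fun x hx => ?_
  exact Subfield.subset_closure hx

lemma cst_mem_KN (e : EE Fq N) : cst Fq (evE Fq N e) ∈ KNf Fq N := AN_le Fq N (cst_mem_AN Fq N e)
lemma theta_mem_KN : theta Fq ∈ KNf Fq N := AN_le Fq N (theta_mem_AN Fq N)

/-- roots of unity in `A_N` -/
def iA : EE Fq N →* AN Fq N where
  toFun e := ⟨cst Fq (evE Fq N e), cst_mem_AN Fq N e⟩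
  map_one' := by simp; rfl
  map_mul' a b := by simp

/-- roots of unity in `K_N` -/
def iK : EE Fq N →* KNf Fq N where
  toFun e := ⟨cst Fq (evE Fq N e), cst_mem_KN Fq N e⟩
  map_one' := by simp; rfl
  map_mul' a b := by simp

/-- `θ^q - θ` -/
def DA : AN Fq N := ⟨theta Fq, theta_mem_AN Fq N⟩ ^ qc Fq - ⟨theta Fq, theta_mem_AN Fq N⟩
/-- `θ^q - θ` -/
def DK : KNf Fq N := ⟨theta Fq, theta_mem_KN Fq N⟩ ^ qc Fq - ⟨theta Fq, theta_mem_KN Fq N⟩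

lemma sysA : Sys (phik (qc Fq) (evE Fq N) 0) (qc Fq) (DA Fq N) (iA Fq N) :=
  mkSys _ _ _ rfl (fun _ => rfl)

lemma sysK : Sys (phik (qc Fq) (evE Fq N) 0) (qc Fq) (DK Fq N) (iK Fq N) :=
  mkSys _ _ _ rfl (fun _ => rfl)

lemma AN_pe (x : Kinf Fq) (hx : x ∈ AN Fq N) : ∃ p : Polynomial (Fb Fq), pe p = x := by
  have : AN Fq N ≤ (pe (k := Fb Fq)).range := by
    refine (Subring.closure_le).2 ?_
    rintro x (⟨c, _, rfl⟩ | rfl)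
    · exact ⟨Polynomial.C c, by simp [cst]⟩
    · exact ⟨Polynomial.X, by simp [theta, th]⟩
  exact this hx

lemma MM_le_NN (hN : 0 < N) (w : ℕ) : MM (evE Fq N) (KNf Fq N) (qc Fq) w ≤ NN (evE Fq N) (KNf Fq N) (qc Fq) w := by
  have : NeZero N := ⟨by omega⟩
  obtain ⟨r, hr, h⟩ := naka (evE Fq N) (sysA Fq N) w
  have hr0 : r ≠ 0 := by
    rintro rfl
    rw [Ideal.mem_span_singleton] at hr
    obtain ⟨y, hy⟩ := hr
    obtain ⟨p, hp⟩ := AN_pe Fq N _ y.2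
    have h1 := congrArg (fun z : AN Fq N => (z : Kinf Fq)) hy
    have h2 : pe (-1 : Polynomial (Fb Fq)) = pe ((Polynomial.X ^ qc Fq - Polynomial.X) * p) := by
      rw [map_mul, map_sub, map_pow, pe_X, hp, map_neg, map_one]
      simpa [DA, theta, th] using h1
    have h3 : (-1 : Polynomial (Fb Fq)) - (Polynomial.X ^ qc Fq - Polynomial.X) * p = 0 := by
      apply pe_zero_of_og
      rw [map_sub, h2, sub_self]
      exact og_zero _
    have h4 := congrArg (Polynomial.eval 0) h3
    have := two_le_qc Fq
    simp [show qc Fq ≠ 0 by omega] at h4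
  refine Submodule.span_le.2 ?_
  rintro _ ⟨l, hl, rfl⟩
  have h1 := h _ (Submodule.subset_span ⟨l, hl, rfl⟩)
  have h2 : ∀ x ∈ NN (evE Fq N) (AN Fq N) (qc Fq) w, x ∈ NN (evE Fq N) (KNf Fq N) (qc Fq) w := by
    intro x hx
    induction hx using Submodule.span_induction with
    | mem x hx => exact Submodule.subset_span hx
    | zero => exact Submodule.zero_mem _
    | add x y _ _ h1 h2 => exact Submodule.add_mem _ h1 h2
    | smul c x _ h1 => exact Submodule.smul_mem _ (⟨c, AN_le Fq N c.2⟩ : KNf Fq N) h1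
  have h3 := Submodule.smul_mem _ (⟨r, AN_le Fq N r.2⟩ : KNf Fq N)⁻¹ (h2 _ h1)
  have h4 : (r : Kinf Fq) ≠ 0 := fun h => hr0 (Subtype.ext h)
  have h5 : (⟨r, AN_le Fq N r.2⟩ : KNf Fq N)⁻¹ • (r • Lik (qc Fq) (evE Fq N) 0 l) = Lik (qc Fq) (evE Fq N) 0 l := by
    rw [Subfield.smul_def, Subring.smul_def, smul_eq_mul, smul_eq_mul, ← mul_assoc]
    rw [show (((⟨r, AN_le Fq N r.2⟩ : KNf Fq N)⁻¹ : KNf Fq N) : Kinf Fq) = (r : Kinf Fq)⁻¹ from rfl, inv_mul_cancel₀ h4, one_mul]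
  rw [h5] at h3
  exact h3

lemma NN_le_MM (w : ℕ) : NN (evE Fq N) (KNf Fq N) (qc Fq) w ≤ MM (evE Fq N) (KNf Fq N) (qc Fq) w :=
  Submodule.span_mono (Set.image_mono fun l hl => ⟨fun a ha => (hl.1 a ha).1, hl.2⟩)

end fin3

set_option linter.unusedSectionVars false
section psS
open HahnSeries in
lemma monicVal_inj (d : ℕ) : Function.Injective (monicVal Fq d) := by
  intro c c' h
  funext i
  have h1 : ∀ c : Fin d → Fq, (monicVal Fq d c).coeff (-(i : ℤ)) = algebraMap Fq (Fb Fq) (c i) := by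
    intro c
    have ht : ∀ n : ℕ, theta Fq ^ n = HahnSeries.single (-(n : ℤ)) 1 := fun n => th_pow n
    have hi := i.2
    simp only [monicVal, ht, HahnSeries.coeff_add, cst, HahnSeries.coeff_sum]
    rw [HahnSeries.coeff_single_of_ne (by omega), zero_add, Finset.sum_eq_single i]
    · simp
    · intro b _ hb
      rw [HahnSeries.C_mul_eq_smul, HahnSeries.coeff_smul, HahnSeries.coeff_single_of_ne, smul_zero]
      intro h; apply hb; ext; omega
    · simp
  have h2 := h1 c
  rw [h, h1 c'] at h2
  exact ((algebraMap Fq (Fb Fq)).injective h2).symm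

/-- power sums -/
def Sdp (s d : ℕ) : Kinf Fq := ∑ c : Fin d → Fq, (monicVal Fq d c)⁻¹ ^ s

lemma brk_ne (n : ℕ) : brk (qc Fq) (th : Kinf Fq) (n + 1) ≠ 0 := by
  have h1 := two_le_qpow (two_le_qc Fq) n
  have := th_sub_ne (k := Fb Fq) (n := qc Fq ^ (n + 1)) (m := 1) (by omega)
  rwa [pow_one] at this

/-- Carlitz coefficient functions -/
def ecf (j : ℕ) : ℕ → Kinf Fq := fun d => ec (qc Fq) th (LL Fq) d j

lemma Sdp_rec (s : ℕ) : Sdp Fq (s + 1) = (if s = 0 then ecf Fq 0 else 0) +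
    ∑ j ∈ Finset.range (s + 1), if qc Fq ^ j ≤ s then ecf Fq j * Sdp Fq (s + 1 - qc Fq ^ j) else 0 := by
  funext d
  have hq := two_le_qc Fq
  have h := psum_rec (K := Kinf Fq) (d := d) hq (qc_cast Fq) (monicVal Fq d) (monicVal_inj Fq d) (by simp [qc])
    (fun j => ec (qc Fq) th (LL Fq) d j) (fun c => Ec_mon (cc Fq) (fun x => by
      rw [← map_pow, qc, FiniteField.pow_card]) hq (qc_frob Fq) (qc_neg Fq) (LL_zero Fq) (LL_succ Fq) (brk_ne Fq) d c) s
  rw [Sdp, h, Pi.add_apply, Finset.sum_apply]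
  congr 1
  · split_ifs <;> rfl
  rw [Finset.sum_subset (Finset.range_mono (show d + 1 ≤ d + 1 + s by omega)),
    Finset.sum_subset (Finset.range_mono (show s + 1 ≤ d + 1 + s by omega))]
  · refine Finset.sum_congr rfl fun j _ => ?_
    split_ifs <;> rfl
  · intro j _ hj
    rw [if_neg]; · rfl
    have := Nat.lt_pow_self (n := j) (a := qc Fq) (by omega)
    simp at hj; omega
  · intro j _ hj
    simp only [Finset.mem_range] at hj
    rw [ec_lt hq d j (by omega)]; simp

variable (N : ℕ)

/-- the functions for power sums -/
def phS (a : ℕ × EE Fq N) (d : ℕ) : Kinf Fq := HahnSeries.C (evE Fq N a.2) ^ d * Sdp Fq a.1 d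

/-- the function for polylogarithms -/
abbrev phE : ℕ × EE Fq N → ℕ → Kinf Fq := phik (qc Fq) (evE Fq N) 0

lemma phE_one : phE Fq N (1, 1) = LL Fq := by
  funext d; simp [phE, phik, LL]

lemma phi_mem_DD {a : ℕ × EE Fq N} (ha : 0 < a.1) : phE Fq N a ∈ DD (KNf Fq N) (phE Fq N) a.1 := by
  have := DD_mem (R0 := KNf Fq N) (φ := phE Fq N) (a := a) (l := []) (posw_cons.2 ⟨ha, posw_nil⟩)
  rw [lwt_nil, add_zero] at this
  convert this using 1
  funext d; simp [fsq]

lemma ecf_zero : ecf Fq 0 ∈ DD (KNf Fq N) (phE Fq N) 1 := by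
  have : ecf Fq 0 = phE Fq N (1, 1) := by
    rw [phE_one]; funext d; exact ec_zero d
  rw [this]; exact phi_mem_DD Fq N (a := (1, 1)) (by simp)

lemma brk_mem (n : ℕ) : brk (qc Fq) (th : Kinf Fq) n ∈ KNf Fq N :=
  sub_mem (pow_mem (theta_mem_KN Fq N) _) (theta_mem_KN Fq N)

lemma ecf_succ (j : ℕ) : ecf Fq (j + 1) ∈ DD2 (KNf Fq N) (phE Fq N) (qc Fq ^ (j + 1)) := by
  have step : ∀ j, ecf Fq j ∈ DD (KNf Fq N) (phE Fq N) (qc Fq ^ j) →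
      ecf Fq (j + 1) ∈ DD2 (KNf Fq N) (phE Fq N) (qc Fq ^ (j + 1)) := by
    intro j hj
    have h1 := (sysK Fq N).shf_frob hj
    rw [← pow_succ'] at h1
    have h2 := Submodule.smul_mem _ (⟨_, brk_mem Fq N (j + 1)⟩ : KNf Fq N)⁻¹ h1
    convert h2 using 1
    funext d
    rw [Pi.smul_apply, Subfield.smul_def, smul_eq_mul]
    cases d with
    | zero => simp [shf, ecf, ec]
    | succ d => 
      simp only [shf, ecf, ec, LinearMap.coe_mk, AddHom.coe_mk, Nat.add_eq_zero_iff, one_ne_zero, and_false, if_false]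
      rw [div_eq_inv_mul]; rfl
  induction j with
  | zero => exact step 0 (by rw [pow_zero]; exact ecf_zero Fq N)
  | succ j ih => exact step _ (DD2_le _ ih)

lemma Sdp_mem (s : ℕ) : 0 < s → Sdp Fq s - phE Fq N (s, 1) ∈ DD2 (KNf Fq N) (phE Fq N) s := by
  have hφ := (sysK Fq N).mul
  induction s using Nat.strong_induction_on with
  | _ s ih =>
  intro hs
  obtain ⟨s, rfl⟩ : ∃ n, s = n + 1 := ⟨s - 1, by omega⟩
  have hDD : ∀ m, 0 < m → m < s + 1 → Sdp Fq m ∈ DD (KNf Fq N) (phE Fq N) m := by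
    intro m h1 h2
    have := Submodule.add_mem _ (DD2_le _ (ih m h2 h1)) (phi_mem_DD Fq N (a := (m, 1)) h1)
    simpa using this
  rcases Nat.eq_zero_or_pos s with rfl | hs0
  · have : Sdp Fq (0 + 1) - phE Fq N (0 + 1, 1) = 0 := by
      rw [Sdp_rec, sub_eq_zero, zero_add, phE_one]
      simp; funext d; exact ec_zero d
    rw [this]; exact Submodule.zero_mem _
  rw [Sdp_rec, if_neg (by omega), zero_add, Finset.sum_range_succ', pow_zero, if_pos (by omega)]
  have h1 : phE Fq N (s + 1, 1) = ecf Fq 0 * phE Fq N (s, 1) := by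
    have : ecf Fq 0 = phE Fq N (1, 1) := by
      rw [phE_one]; funext d; exact ec_zero d
    rw [this, ← hφ]; simp [pmul, add_comm]
  rw [h1, add_tsub_cancel_right, add_sub_assoc, ← mul_sub]
  refine Submodule.add_mem _ (Submodule.sum_mem _ fun j _ => ?_) ?_
  · split_ifs with hj
    · rw [mul_comm]
      have h0 : 0 < qc Fq ^ (j + 1) := by have := two_le_qpow (two_le_qc Fq) j; omega
      have := DD_mul2 hφ (hDD (s + 1 - qc Fq ^ (j + 1)) (by omega) (by omega)) (ecf_succ Fq N j)
      rwa [Nat.sub_add_cancel (by omega)] at this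
    · exact Submodule.zero_mem _
  · have := DD_mul2 hφ (ecf_zero Fq N) (ih s (by omega) hs0)
    rwa [add_comm] at this

lemma phS_mem (a : ℕ × EE Fq N) (ha : 0 < a.1) : phS Fq N a - phE Fq N a ∈ DD2 (KNf Fq N) (phE Fq N) a.1 := by
  have hφ := (sysK Fq N).mul
  have h := phi_DD2 hφ (Sdp_mem Fq N a.1 ha) (0, a.2)
  rw [zero_add] at h
  convert h using 1
  rw [mul_sub, ← hφ, pmul, zero_add, mul_one]
  congr 1
  funext d
  simp [phS, phE, phik]

end psS

section tup

/-- decreasing tuples below `m` -/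
def FS : (n : ℕ) → ℕ → Finset (Fin n → ℕ)
  | 0, _ => {Fin.elim0}
  | n + 1, m => (Finset.range m).biUnion fun d => (FS n d).image (Fin.cons (α := fun _ => ℕ) d)

lemma strictAnti_cons {n : ℕ} (d : ℕ) (f : Fin n → ℕ) :
    StrictAnti (Fin.cons d f : Fin (n + 1) → ℕ) ↔ StrictAnti f ∧ ∀ i, f i < d := by
  constructor
  · intro h
    refine ⟨fun i j hij => ?_, fun i => ?_⟩
    · have := h (Fin.succ_lt_succ_iff.2 hij)
      simpa using this
    · have := h (Fin.succ_pos i)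
      simpa using this
  · rintro ⟨h1, h2⟩ i j hij
    induction j using Fin.cases with
    | zero => exact absurd hij (Fin.not_lt_zero i)
    | succ j =>
      induction i using Fin.cases with
      | zero => simpa using h2 j
      | succ i => simpa using h1 (Fin.succ_lt_succ_iff.1 hij)

lemma mem_FS {n : ℕ} : ∀ {m : ℕ} {f : Fin n → ℕ}, f ∈ FS n m ↔ StrictAnti f ∧ ∀ i, f i < m := by
  induction n with
  | zero =>
    intro m f
    simp only [FS, Finset.mem_singleton]
    exact ⟨fun _ => ⟨fun i => i.elim0, fun i => i.elim0⟩, fun _ => Subsingleton.elim (α := Fin 0 → ℕ) _ _⟩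
  | succ n ih =>
    intro m f
    simp only [FS, Finset.mem_biUnion, Finset.mem_range, Finset.mem_image]
    constructor
    · rintro ⟨d, hd, g, hg, rfl⟩
      have hg' := ih.1 hg
      refine ⟨(strictAnti_cons d g).2 hg', fun i => ?_⟩
      induction i using Fin.cases with
      | zero => simpa using hd
      | succ i => simpa using (hg'.2 i).trans hd
    · rintro ⟨h1, h2⟩
      rw [← Fin.cons_self_tail f] at h1
      exact ⟨f 0, h2 0, Fin.tail f, ih.2 ((strictAnti_cons _ _).1 h1), Fin.cons_self_tail f⟩

variable {A R : Type*} [CommSemiring R] (φ : A → ℕ → R)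

lemma sum_cons {n : ℕ} (d : ℕ) (T : Finset (Fin n → ℕ)) (w : Fin (n + 1) → A) :
    ∑ f ∈ T.image (Fin.cons (α := fun _ => ℕ) d), ∏ i, φ (w i) (f i) =
      φ (w 0) d * ∑ f ∈ T, ∏ i, φ (w i.succ) (f i) := by
  rw [Finset.sum_image (fun _ _ _ _ h => (Fin.cons_injective2 h).2), Finset.mul_sum]
  refine Finset.sum_congr rfl fun f _ => ?_
  rw [Fin.prod_univ_succ]
  simp

lemma sum_FS {n : ℕ} : ∀ (w : Fin n → A) (m : ℕ), ∑ f ∈ FS n m, ∏ i, φ (w i) (f i) = isum φ (List.ofFn w) m := by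
  induction n with
  | zero => intro w m; simp [FS]
  | succ n ih =>
    intro w m
    rw [FS, Finset.sum_biUnion, List.ofFn_succ, isum_cons]
    · refine Finset.sum_congr rfl fun d _ => ?_
      rw [sum_cons, ih]
    · intro a _ b _ hab
      rw [Function.onFun, Finset.disjoint_left]
      intro f h1 h2
      rw [Finset.mem_image] at h1 h2
      obtain ⟨g, _, rfl⟩ := h1
      obtain ⟨g', _, h⟩ := h2
      exact hab (Fin.cons_injective2 h).1.symm

lemma tsum_fin {α K : Type*} [AddCommMonoid K] [TopologicalSpace K] (P : α → Prop) (t : Finset α)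
    (h : ∀ a, P a ↔ a ∈ t) (f : α → K) : ∑' x : {a // P a}, f x.1 = ∑ x ∈ t, f x := by
  obtain rfl : P = (· ∈ t) := funext fun a => propext (h a)
  exact Finset.tsum_subtype t f

end tup

section top
variable {k : Type*} [Field k]

lemma hasSum_of_cvg {f : ℕ → LaurentSeries k} {x : LaurentSeries k}
    (h : cvg (fun m => ∑ d ∈ Finset.range m, f d) x) : HasSum f x := by
  have key : ∀ n : ℕ, ∃ M, ∀ s : Finset ℕ, Finset.range M ⊆ s → og n (∑ d ∈ s, f d - x) := by
    intro n
    obtain ⟨M, hM⟩ := h n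
    refine ⟨M, fun s hs => ?_⟩
    have h1 : ∀ d ≥ M, og n (f d) := by
      intro d hd
      have := og_sub (hM (d + 1) (by omega)) (hM d hd)
      simp only [Finset.sum_range_succ] at this
      convert this using 1; ring
    rw [← Finset.sum_sdiff hs, add_sub_assoc]
    refine og_add (og_sum _ fun d hd => h1 d ?_) (hM M le_rfl)
    simp at hd; exact hd.2
  rw [HasSum]
  intro U hU
  rw [Valued.mem_nhds] at hU
  obtain ⟨γ, hγ⟩ := hU
  obtain ⟨x0, hx0⟩ := MonoidWithZeroHom.ValueGroup₀.restrict₀_surjective _ γ.1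
  have hx1 : Valued.v.restrict x0 = γ.1 := hx0
  have hx2 : x0 ≠ 0 := by
    rintro rfl
    rw [map_zero] at hx1
    exact γ.ne_zero hx1.symm
  obtain ⟨i, hi⟩ : ∃ i, x0.coeff i ≠ 0 := by
    by_contra hh
    push Not at hh
    exact hx2 (HahnSeries.ext (funext hh))
  obtain ⟨M, hM⟩ := key (i + 1).toNat
  refine Filter.mem_map.2 (Filter.mem_of_superset (Filter.mem_atTop (Finset.range M)) fun s hs => hγ ?_)
  rw [Set.mem_ofPred_eq, ← hx1, Valuation.restrict_lt_iff]
  by_contra hlt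
  have h1 := (LaurentSeries.valuation_le_iff_coeff_lt_eq_zero k).2 (hM s hs)
  have h2 := (LaurentSeries.valuation_le_iff_coeff_lt_eq_zero k).1 ((not_lt.1 hlt).trans h1)
  exact hi (h2 i (by omega))
end top

set_option linter.unusedSectionVars false
section zet
variable (N : ℕ)

lemma Sd_eq (n : ℕ) (s : Fin (n + 1) → ℕ) (eps : Fin (n + 1) → Fb Fq) (e : Fin (n + 1) → EE Fq N)
    (he : ∀ i, evE Fq N (e i) = eps i) (d : ℕ) :
    Sd Fq (d : ℤ) ⟨n + 1, s, eps⟩ =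
      phS Fq N (s 0, e 0) d * isum (phS Fq N) (List.ofFn fun i : Fin n => (s i.succ, e i.succ)) d := by
  have h1 : ∀ f : Fin (n + 1) → ℕ,
      ∑ c : (∀ i, Fin (f i) → Fq), ∏ i, cst Fq (eps i ^ f i) / monicVal Fq (f i) (c i) ^ s i =
      ∏ i, phS Fq N (s i, e i) (f i) := by
    intro f
    simp only [phS, Sdp, Finset.mul_sum]
    rw [Finset.prod_univ_sum, Fintype.piFinset_univ]
    refine Finset.sum_congr rfl fun c _ => Finset.prod_congr rfl fun i _ => ?_
    rw [← he, div_eq_mul_inv, inv_pow, map_pow]; rfl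
  rw [Sd]
  simp only [h1]
  rw [tsum_fin (fun f : Fin (n + 1) → ℕ => StrictAnti f ∧ ∀ i : Fin (n + 1), i.val = 0 → (f i : ℤ) = d)
    ((FS n d).image (Fin.cons (α := fun _ => ℕ) d)) ?_ (fun f => ∏ i, phS Fq N (s i, e i) (f i))]
  · rw [sum_cons (phS Fq N) d (FS n d) (fun i => (s i, e i)), sum_FS (phS Fq N) (fun i => (s i.succ, e i.succ))]
  · intro f
    rw [Finset.mem_image]
    constructor
    · rintro ⟨h2, h3⟩
      have h4 : f 0 = d := by exact_mod_cast h3 0 rfl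
      have h5 : Fin.cons (α := fun _ => ℕ) d (Fin.tail f) = f := by rw [← h4]; exact Fin.cons_self_tail f
      rw [← h5] at h2
      exact ⟨Fin.tail f, mem_FS.2 ((strictAnti_cons _ _).1 h2), h5⟩
    · rintro ⟨g, hg, rfl⟩
      refine ⟨(strictAnti_cons _ _).2 (mem_FS.1 hg), fun i hi => ?_⟩
      obtain rfl : i = 0 := Fin.ext hi
      simp

lemma zeta_eq (n : ℕ) (s : Fin (n + 1) → ℕ) (eps : Fin (n + 1) → Fb Fq) (e : Fin (n + 1) → EE Fq N)
    (he : ∀ i, evE Fq N (e i) = eps i) {x} (hx : cvg (isum (phS Fq N) (List.ofFn fun i => (s i, e i))) x) :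
    zetaA Fq ⟨n + 1, s, eps⟩ = x := by
  refine HasSum.tsum_eq (hasSum_of_cvg ?_)
  convert hx using 1
  funext m
  rw [List.ofFn_succ, isum_cons]
  exact Finset.sum_congr rfl fun d _ => Sd_eq Fq N n s eps e he d

lemma lwt_ofFn {E : Type*} (n : ℕ) (v : Fin n → ℕ × E) : lwt (List.ofFn v) = ∑ i, (v i).1 := by
  rw [lwt, List.map_ofFn, List.sum_ofFn]; rfl

lemma CZ_le (hN : 0 < N) (w : ℕ) (hw : 0 < w) : CZ Fq N w ≤ MM (evE Fq N) (KNf Fq N) (qc Fq) w := by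
  refine Submodule.span_le.2 ?_
  rintro _ ⟨⟨n, s, eps⟩, ⟨h1, h2⟩, h3, rfl⟩
  simp only [PArr.wt] at h1 h2 h3
  choose e he using fun i => evE_surj Fq N hN (eps i) (h2 i)
  cases n with
  | zero => simp at h3; try omega
  | succ n =>
    have hl : posw (List.ofFn fun i => (s i, e i)) := by
      intro a ha
      obtain ⟨i, rfl⟩ := (List.mem_ofFn' _ _).1 ha
      exact h1 i
    have hlw : lwt (List.ofFn fun i => (s i, e i)) = w := by rw [lwt_ofFn, ← h3]
    have h4 := trans2 (R0 := KNf Fq N) (sysK Fq N).mul (phS_mem Fq N) _ hl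
    rw [hlw] at h4
    obtain ⟨x, hx, hx2⟩ := cvg_SSDD (evE Fq N) (two_le_qc Fq) w (Submodule.mem_sup_left h4)
    rw [zeta_eq Fq N n s eps e he hx2]
    exact hx

lemma MM_le (w : ℕ) (hw : 0 < w) : MM (evE Fq N) (KNf Fq N) (qc Fq) w ≤ CZ Fq N w := by
  refine Submodule.span_le.2 ?_
  rintro _ ⟨l, ⟨hl, hlw⟩, rfl⟩
  have h1 := trans3' (R0 := KNf Fq N) (sysK Fq N).mul (phS_mem Fq N) _ hl
  rw [hlw] at h1
  have key : ∀ f ∈ {f | ∃ l, posw l ∧ lwt l = w ∧ f = isum (phS Fq N) l}, ∃ x ∈ CZ Fq N w, cvg f x := by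
    rintro _ ⟨l, hl, hlw, rfl⟩
    have h4 := trans2 (R0 := KNf Fq N) (sysK Fq N).mul (phS_mem Fq N) _ hl
    obtain ⟨x, hx, hx2⟩ := cvg_SSDD (evE Fq N) (two_le_qc Fq) _ (Submodule.mem_sup_left h4)
    refine ⟨x, Submodule.subset_span ?_, hx2⟩
    obtain ⟨n, v, rfl⟩ : ∃ n, ∃ v : Fin n → ℕ × EE Fq N, l = List.ofFn v := ⟨_, l.get, (List.ofFn_get l).symm⟩
    cases n with
    | zero => exact absurd hlw (by simp [lwt]; omega)
    | succ n =>
      refine ⟨⟨n + 1, fun i => (v i).1, fun i => evE Fq N (v i).2⟩, ⟨fun i => ?_, fun i => evE_pow Fq N _⟩, ?_, ?_⟩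
      · exact hl _ ((List.mem_ofFn' _ _).2 ⟨i, rfl⟩)
      · rw [← hlw, lwt_ofFn]; rfl
      · exact (zeta_eq Fq N n _ _ (fun i => (v i).2) (fun _ => rfl) hx2).symm
  obtain ⟨x, hx, hx2⟩ := cvg_span key h1
  rw [(cvg_Lik (evE Fq N) (two_le_qc Fq) l hl).uniq hx2]
  exact hx

end zet

set_option linter.unusedSectionVars false
section count

lemma dN_eq (g : ℕ → ℕ) (γ q : ℕ) (hq : 2 ≤ q) (h0 : g 0 = 1)
    (hg : ∀ n, g (n + 1) = γ * ∑ j ∈ Finset.range (n + 1), if q ∣ j + 1 then 0 else g (n - j)) (w : ℕ) :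
    g w = dN γ q w := by
  have hsum : ∀ n, n < q → ∑ i ∈ Finset.range (n + 1), g i = (γ + 1) ^ n := by
    intro n
    induction n with
    | zero => intro _; simp [h0]
    | succ n ih =>
      intro hn
      rw [Finset.sum_range_succ, hg n, ih (by omega)]
      have : ∑ j ∈ Finset.range (n + 1), (if q ∣ j + 1 then 0 else g (n - j)) = (γ + 1) ^ n := by
        rw [← ih (by omega), ← Finset.sum_range_reflect]
        refine Finset.sum_congr rfl fun j hj => ?_
        have := Finset.mem_range.1 hj
        rw [if_neg]
        · congr 1; omega
        · intro hd; have := Nat.le_of_dvd (by omega) hd; omega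
      rw [this]; ring
  induction w using Nat.strong_induction_on with
  | _ w ih =>
  cases w with
  | zero => rw [h0, dN]
  | succ w =>
    rw [dN]
    split_ifs with h1 h2
    · have h3 := hsum (w + 1) h1
      rw [Finset.sum_range_succ, hsum w (by omega), pow_succ] at h3
      nlinarith
    · have hq1 : q - 1 = w := by omega
      rw [hg w, hq1, ← hsum w (by omega), Finset.sum_range_succ, Finset.sum_range_succ', if_pos (by rw [h2]), h0,
        ← Finset.sum_range_reflect]
      simp only [add_zero, add_tsub_cancel_right]
      congr 1
      refine Finset.sum_congr rfl fun j hj => ?_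
      have := Finset.mem_range.1 hj
      rw [if_neg]
      · congr 1; omega
      · intro hd; have := Nat.le_of_dvd (by omega) hd; omega
    · obtain ⟨m, rfl⟩ : ∃ m, w = q + m := ⟨w - q, by omega⟩
      have e1 : q + m - (q - 1) = m + 1 := by omega
      rw [e1, ← ih (m + 1) (by omega), hg (q + m), show q + m + 1 = q + (m + 1) by ring, Finset.sum_range_add, mul_add, hg m]
      congr 1
      · congr 1
        have e2 : q = q - 1 + 1 := by omega
        conv_lhs => rw [show Finset.range q = Finset.range (q - 1 + 1) by rw [← e2]]
        rw [Finset.sum_range_succ, if_pos (by rw [← e2]), add_zero]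
        refine Finset.sum_congr rfl fun j hj => ?_
        have := Finset.mem_range.1 hj
        rw [if_neg]
        · exact ih _ (by omega)
        · intro hd; have := Nat.le_of_dvd (by omega) hd; omega
      · congr 1
        refine Finset.sum_congr rfl fun j _ => ?_
        have e3 : (q ∣ q + j + 1) ↔ q ∣ j + 1 := by rw [add_assoc, Nat.dvd_add_right (dvd_refl q)]
        simp only [e3, Nat.add_sub_add_left]

variable {E : Type*} (q : ℕ)

lemma good_fin [Finite E] (w : ℕ) : (good E q w).Finite :=
  (words_finite w).subset fun l hl => ⟨fun a ha => (hl.1 a ha).1, hl.2⟩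

lemma good_rec [Fintype E] (n : ℕ) : Nat.card (good E q (n + 1)) =
    Fintype.card E * ∑ j ∈ Finset.range (n + 1), if q ∣ j + 1 then 0 else Nat.card (good E q (n - j)) := by
  let G : ℕ → Finset (List (ℕ × E)) := fun w => (good_fin (E := E) q w).toFinset
  have hG : ∀ w, Nat.card (good E q w) = (G w).card := fun w => by
    rw [Nat.card_coe_set_eq, Set.ncard_eq_toFinset_card _ (good_fin q w)]
  have hm : ∀ w l, l ∈ G w ↔ l ∈ good E q w := fun w l => Set.Finite.mem_toFinset _
  simp only [hG]
  have hU : G (n + 1) = (((Finset.range (n + 1)).filter fun j => ¬ q ∣ j + 1) ×ˢ (Finset.univ : Finset E)).biUnion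
      fun p => (G (n - p.1)).image (List.cons (p.1 + 1, p.2)) := by
    ext l
    simp only [hm, Finset.mem_biUnion, Finset.mem_product, Finset.mem_filter, Finset.mem_range, Finset.mem_univ, and_true,
      Finset.mem_image, Prod.exists]
    constructor
    · rintro ⟨h1, h2⟩
      cases l with
      | nil => simp [lwt] at h2
      | cons a l =>
        obtain ⟨s, e⟩ := a
        rw [lwt_cons] at h2
        have h3 := h1 _ List.mem_cons_self
        simp only at h2 h3
        refine ⟨s - 1, e, ⟨by omega, ?_⟩, l, ⟨fun a ha => h1 a (List.mem_cons_of_mem _ ha), by omega⟩, ?_⟩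
        · rw [Nat.sub_add_cancel h3.1]; exact h3.2
        · rw [Nat.sub_add_cancel h3.1]
    · rintro ⟨j, e, ⟨h1, h2⟩, l, ⟨h3, h4⟩, rfl⟩
      refine ⟨?_, ?_⟩
      · intro a ha
        rcases List.mem_cons.1 ha with rfl | ha
        · exact ⟨Nat.succ_pos _, h2⟩
        · exact h3 a ha
      · rw [lwt_cons, h4]; simp only; omega
  rw [hU, Finset.card_biUnion]
  · have this : ∀ p : ℕ × E, ((G (n - p.1)).image (List.cons (p.1 + 1, p.2))).card = (G (n - p.1)).card := fun p =>
      Finset.card_image_of_injective _ (List.cons_injective)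
    rw [Finset.sum_congr rfl (fun p _ => this p), Finset.sum_product]
    simp only [Finset.sum_const, Finset.card_univ, smul_eq_mul, ← Finset.mul_sum]
    rw [Finset.sum_filter]
    refine congrArg (fun z => Fintype.card E * z) (Finset.sum_congr rfl fun j _ => ?_)
    by_cases h : q ∣ j + 1 <;> simp [h]
  · intro a _ b _ hab
    rw [Function.onFun, Finset.disjoint_left]
    intro f h1 h2
    rw [Finset.mem_image] at h1 h2
    obtain ⟨g, _, rfl⟩ := h1
    obtain ⟨g', _, h⟩ := h2
    simp only [List.cons.injEq, Prod.mk.injEq, add_left_inj] at h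
    exact hab (Prod.ext h.1.1.symm h.1.2.symm)

lemma good_zero : Nat.card (good E q 0) = 1 := by
  have : good E q 0 = {[]} := by
    ext l
    constructor
    · rintro ⟨h1, h2⟩
      by_contra hl
      have := lwt_pos (fun a ha => (h1 a ha).1) hl
      omega
    · rintro rfl
      exact ⟨by simp, by simp [lwt]⟩
  rw [this]; simp

lemma good_card [Fintype E] (hq : 2 ≤ q) (w : ℕ) : Nat.card (good E q w) = dN (Fintype.card E) q w :=
  dN_eq (fun w => Nat.card (good E q w)) _ q hq (good_zero q) (good_rec q) w

end count

section final
lemma main_aux (N w : ℕ) (hN : 0 < N) (hw : 0 < w) :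
    Module.finrank (KNf Fq N) (CZ Fq N w) = dN (gammaN Fq N) (qc Fq) w := by
  have : NeZero N := ⟨by omega⟩
  have hfE : Fintype (EE Fq N) := Fintype.ofFinite _
  have h1 : CZ Fq N w = NN (evE Fq N) (KNf Fq N) (qc Fq) w :=
    le_antisymm ((CZ_le Fq N hN w hw).trans (MM_le_NN Fq N hN w)) ((NN_le_MM Fq N w).trans (MM_le Fq N w hw))
  have h2 := Lik_linInd (evE Fq N) (two_le_qc Fq) (evE_inj Fq N) (evE_ne Fq N) w (KNf Fq N) (KNf_isRat Fq N)
  have h3 : gammaN Fq N = Fintype.card (EE Fq N) := by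
    rw [gammaN, ← Nat.card_eq_fintype_card]
    refine (Nat.card_congr (Equiv.ofBijective (fun e => (⟨evE Fq N e, evE_pow Fq N e⟩ : {x : Fb Fq // x ^ N = 1})) ⟨?_, ?_⟩)).symm
    · intro a b h
      exact evE_inj Fq N (congrArg Subtype.val h)
    · rintro ⟨x, hx⟩
      obtain ⟨e, he⟩ := evE_surj Fq N hN x hx
      exact ⟨e, Subtype.ext he⟩
  have hfin : Fintype (good (EE Fq N) (qc Fq) w) := (good_fin (qc Fq) w).fintype
  rw [h3, ← good_card (qc Fq) (two_le_qc Fq), h1, NN, ← Set.range_domRestrict, Nat.card_eq_fintype_card]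
  exact finrank_span_eq_card h2
end final

set_option synthInstance.maxHeartbeats 1000000

/-- **Zagier's conjecture in positive characteristic** (Theorem B): for every `N ∈ ℕ` and
every `w ∈ ℕ`, the dimension of `CZ_{N,w}` as a `K_N`-vector space equals `d_N(w)`. -/
theorem zagier_conjecture_positive_characteristic
    (Fq : Type) [Field Fq] [Fintype Fq] (N w : ℕ) (hN : 0 < N) (hw : 0 < w) :
    Module.finrank (KNf Fq N) (CZ Fq N w) = dN (gammaN Fq N) (qc Fq) w := by
  exact main_aux Fq N w hN hw

end ZHPC
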